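/- Let ℓ ≥ 1 be a real number and j a positive integer. Set Λ(2,ℓ) := 12ℓ·2^{6ℓ} + 5ℓ C_{2,ℓ} + 9ℓ D_{2,ℓ}, where C_{2,ℓ} := (10ℓ)^{2^{16ℓ}}, A_2 := 125^2 · 1092/8, B_{2,ℓ} := (1/2) e^{4/e} 2^{20ℓ}, D_{2,ℓ} := A_2 · max(A_2, 2·2^{5ℓA_2}) + (2A_2)^{−A_2/4} e^{B_{2,ℓ}/e} 2^{5ℓB_{2,ℓ}} · δ + 5 with δ = 1 if A_2 < B_{2,ℓ} and δ = 0 otherwise, and φ(ℓ) := 16748 · Λ(2,ℓ). Then, uniformly for all real x > max( exp(7^{28} (12eℓ)^{28 log(192eℓ)}), exp(e^{πj/4}) ) and all real y with x^{1/ℓ} ≤ y ≤ x, one has ∑_{x−y < n ≤ x, ω(n) ≤ j} Δ(n) ≤ φ(ℓ) · (y / log x) · (4e log log x / (π j))^j. -/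

import Mathlib

/-- The Erdős–Hooley Δ-function: the maximum over real `u` of the number of
divisors of `n` in the interval `(e^u, e^{u+1}]`. -/
noncomputable def hooleyDelta (n : ℕ) : ℕ :=
  sSup {m : ℕ | ∃ u : ℝ,
    m = (n.divisors.filter (fun d : ℕ => Real.exp u < (d : ℝ) ∧ (d : ℝ) ≤ Real.exp (u + 1))).card}

noncomputable def A2 : ℝ := 125 ^ 2 * 1092 / 8

noncomputable def B2l (ℓ : ℝ) : ℝ := (1 / 2) * Real.exp (4 / Real.exp 1) * (2 : ℝ) ^ (20 * ℓ)

noncomputable def C2l (ℓ : ℝ) : ℝ := (10 * ℓ) ^ ((2 : ℝ) ^ (16 * ℓ))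

noncomputable def D2l (ℓ : ℝ) : ℝ :=
  A2 * max A2 (2 * (2 : ℝ) ^ (5 * ℓ * A2)) +
    (2 * A2) ^ (-A2 / 4) * Real.exp (B2l ℓ / Real.exp 1) *
      (2 : ℝ) ^ (5 * ℓ * B2l ℓ) * (if A2 < B2l ℓ then 1 else 0) + 5

noncomputable def Lam2 (ℓ : ℝ) : ℝ :=
  12 * ℓ * (2 : ℝ) ^ (6 * ℓ) + 5 * ℓ * C2l ℓ + 9 * ℓ * D2l ℓ

noncomputable def phiConst (ℓ : ℝ) : ℝ := 16748 * Lam2 ℓ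

namespace HooleyShort

open Finset

/-- The primes in the half-open interval `(a, b]`. -/
def primesIoc (a b : ℕ) : Finset ℕ := (Ioc a b).filter Nat.Prime

theorem mem_primesIoc {a b p : ℕ} : p ∈ primesIoc a b ↔ (a < p ∧ p ≤ b) ∧ p.Prime := by
  simp [primesIoc]

theorem log_factorial_eq_sum (n : ℕ) :
    Real.log (n.factorial : ℝ) =
      ∑ p ∈ primesIoc 0 n, (n.factorial.factorization p : ℝ) * Real.log p := by
  rw [Real.log_nat_eq_sum_factorization, Finsupp.sum]
  apply Finset.sum_subset
  · intro p hp
    have hp' : p ∈ n.factorial.primeFactors := by simpa using hp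
    have hpp := Nat.prime_of_mem_primeFactors hp'
    exact mem_primesIoc.2 ⟨⟨hpp.pos, (hpp.dvd_factorial).1 (Nat.dvd_of_mem_primeFactors hp')⟩, hpp⟩
  · intro p _ hp
    have : n.factorial.factorization p = 0 := Finsupp.notMem_support_iff.1 hp
    simp [this]

theorem sum_log_div_le (n : ℕ) :
    ∑ p ∈ primesIoc 0 n, Real.log p / p ≤ Real.log n + Real.log 4 := by
  rcases Nat.eq_zero_or_pos n with rfl | hn
  · simp [primesIoc]; positivity
  have hn' : (0 : ℝ) < n := by exact_mod_cast hn
  have h1 : ∑ p ∈ primesIoc 0 n, ((n : ℝ) / p - 1) * Real.log p ≤ Real.log (n.factorial : ℝ) := by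
    rw [log_factorial_eq_sum]
    apply Finset.sum_le_sum
    intro p hp
    have hpp := (mem_primesIoc.1 hp).2
    have hp1 : (1 : ℝ) ≤ p := by exact_mod_cast hpp.one_lt.le
    apply mul_le_mul_of_nonneg_right _ (Real.log_nonneg hp1)
    have h2 : n / p ≤ n.factorial.factorization p := by
      rw [Nat.factorization_factorial hpp (b := Nat.log p n + 2) (by omega)]
      have := Finset.single_le_sum (f := fun i => n / p ^ i) (s := Ico 1 (Nat.log p n + 2))
        (fun i _ => Nat.zero_le _) (show 1 ∈ Ico 1 (Nat.log p n + 2) by simp)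
      simpa using this
    have h3 : (n : ℝ) / p - 1 ≤ ((n / p : ℕ) : ℝ) := by
      rw [← Nat.floor_div_eq_div (K := ℝ)]
      linarith [Nat.lt_floor_add_one ((n : ℝ) / p)]
    exact h3.trans (by exact_mod_cast h2)
  have h4 : Real.log (n.factorial : ℝ) ≤ n * Real.log n := by
    rw [← Real.log_pow]
    apply Real.log_le_log (by exact_mod_cast n.factorial_pos)
    exact_mod_cast n.factorial_le_pow
  have h5 : ∑ p ∈ primesIoc 0 n, Real.log p ≤ Real.log 4 * n := by
    have := Chebyshev.theta_le_log4_mul_x hn'.le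
    rw [Chebyshev.theta, Nat.floor_natCast] at this
    exact this
  have h6 : ∑ p ∈ primesIoc 0 n, ((n : ℝ) / p - 1) * Real.log p =
      n * ∑ p ∈ primesIoc 0 n, Real.log p / p - ∑ p ∈ primesIoc 0 n, Real.log p := by
    rw [Finset.mul_sum, ← Finset.sum_sub_distrib]
    exact Finset.sum_congr rfl fun p _ => by ring
  have h7 : (n : ℝ) * ∑ p ∈ primesIoc 0 n, Real.log p / p ≤ n * (Real.log n + Real.log 4) := by
    linarith
  exact le_of_mul_le_mul_left h7 hn'

theorem sum_log_div_mul_pred_le (n : ℕ) :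
    ∑ k ∈ Ioc 1 n, Real.log k / ((k : ℝ) * (k - 1)) ≤ 4 := by
  rcases Nat.lt_or_ge n 1 with h | h
  · have : n = 0 := by omega
    subst this; simp
  have key : ∑ k ∈ Ioc 1 n, Real.log k / ((k : ℝ) * (k - 1)) ≤ 4 - 4 / √n := by
    induction n, h using Nat.le_induction with
    | base => simp
    | succ m hm ih =>
      rw [Finset.sum_Ioc_succ_top hm]
      have hm' : (1 : ℝ) ≤ m := by exact_mod_cast hm
      suffices Real.log ((m + 1 : ℕ) : ℝ) / (((m + 1 : ℕ) : ℝ) * ((m + 1 : ℕ) - 1)) ≤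
          4 / √m - 4 / √((m + 1 : ℕ) : ℝ) by linarith
      push_cast
      set a := √(m : ℝ) with ha
      set b := √((m : ℝ) + 1) with hb
      have ha2 : a ^ 2 = m := Real.sq_sqrt (by linarith)
      have hb2 : b ^ 2 = m + 1 := Real.sq_sqrt (by linarith)
      have ha1 : 1 ≤ a := Real.one_le_sqrt.2 hm'
      have hab : a ≤ b := Real.sqrt_le_sqrt (by linarith)
      have hlog : Real.log (m + 1) ≤ 2 * a := by
        have h1 : Real.log ((m : ℝ) + 1) ≤ Real.log ((1 + a) ^ 2) :=
          Real.log_le_log (by linarith) (by nlinarith)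
        rw [Real.log_pow] at h1
        have h2 : Real.log (1 + a) ≤ a := by
          have := Real.log_le_sub_one_of_pos (show 0 < 1 + a by linarith)
          linarith
        push_cast at h1
        linarith
      have e1 : 4 / a - 4 / b = 4 / (a * b * (a + b)) := by
        have : b - a = 1 / (a + b) := by
          rw [eq_div_iff (by linarith)]; nlinarith
        rw [div_sub_div _ _ (by linarith) (by linarith),
          show 4 * b - a * 4 = 4 * (b - a) by ring, this]
        field_simp
      rw [e1, add_sub_cancel_right]
      calc Real.log (m + 1) / ((m + 1) * m) ≤ 2 * a / ((m + 1) * m) := by gcongr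
        _ = 4 / (a * b * (b + b)) := by
          rw [← hb2, ← ha2]
          field_simp
          norm_num
        _ ≤ _ := by gcongr
  have : (0 : ℝ) ≤ 4 / √n := by positivity
  linarith

theorem le_sum_log_div {n : ℕ} (hn : 1 ≤ n) :
    Real.log n - 5 ≤ ∑ p ∈ primesIoc 0 n, Real.log p / p := by
  have hn_pos : (0 : ℝ) < n := by exact_mod_cast hn
  have h1 : Real.log (n.factorial : ℝ) ≤
      n * (∑ p ∈ primesIoc 0 n, Real.log p / p + ∑ p ∈ primesIoc 0 n,
        Real.log p / ((p : ℝ) * (p - 1))) := by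
    rw [log_factorial_eq_sum, ← Finset.sum_add_distrib, Finset.mul_sum]
    apply Finset.sum_le_sum
    intro p hp
    have hpp := (mem_primesIoc.1 hp).2
    have hp1 : (1 : ℝ) < p := by exact_mod_cast hpp.one_lt
    have h2 := Nat.factorization_factorial_le_div_pred hpp n
    have h3 : (n.factorial.factorization p : ℝ) ≤ n / ((p : ℝ) - 1) := by
      have h4 : ((n / (p - 1) : ℕ) : ℝ) ≤ (n : ℝ) / ((p - 1 : ℕ) : ℝ) := Nat.cast_div_le
      rw [Nat.cast_sub hpp.one_lt.le, Nat.cast_one] at h4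
      exact le_trans (by exact_mod_cast h2) h4
    calc (n.factorial.factorization p : ℝ) * Real.log p ≤ n / ((p : ℝ) - 1) * Real.log p :=
          mul_le_mul_of_nonneg_right h3 (Real.log_nonneg hp1.le)
      _ = _ := by
        have : (p : ℝ) - 1 ≠ 0 := by linarith
        field_simp
        ring
  have h2 : ∑ p ∈ primesIoc 0 n, Real.log p / ((p : ℝ) * (p - 1)) ≤ 4 := by
    refine le_trans (Finset.sum_le_sum_of_subset_of_nonneg ?_ ?_) (sum_log_div_mul_pred_le n)
    · intro p hp
      have := mem_primesIoc.1 hp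
      exact mem_Ioc.2 ⟨this.2.one_lt, this.1.2⟩
    · intro k hk _
      have : (1 : ℝ) < k := by exact_mod_cast (mem_Ioc.1 hk).1
      exact div_nonneg (Real.log_nonneg this.le) (mul_nonneg (by linarith) (by linarith))
  have h3 : n * Real.log n - n ≤ Real.log (n.factorial : ℝ) := by
    have := Stirling.le_log_factorial_stirling (n := n) (by omega)
    have h4 : 0 ≤ Real.log n := Real.log_nonneg (by exact_mod_cast hn)
    have h5 : 0 ≤ Real.log (2 * Real.pi) := Real.log_nonneg (by linarith [Real.pi_gt_three])
    linarith
  have h4 : n * (Real.log n - 1) ≤ n * (∑ p ∈ primesIoc 0 n, Real.log p / p + 4) := by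
    calc n * (Real.log n - 1) = n * Real.log n - n := by ring
      _ ≤ _ := h3.trans h1
      _ ≤ _ := by gcongr
  linarith [le_of_mul_le_mul_left h4 hn_pos]

/-- Partial summation with a decreasing weight, in the form of a comparison of two sequences. -/
theorem sum_mul_le_of_partial_sums_le {u v g : ℕ → ℝ} {c : ℝ} {a b : ℕ} (hab : a ≤ b)
    (hg : ∀ n, a < n → g (n + 1) ≤ g n) (hg0 : ∀ n, a < n → 0 ≤ g n)
    (h : ∀ m, a ≤ m → m ≤ b → ∑ n ∈ Ioc a m, u n ≤ ∑ n ∈ Ioc a m, v n + c) :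
    ∑ n ∈ Ioc a b, u n * g n ≤ ∑ n ∈ Ioc a b, v n * g n + c * g (a + 1) := by
  have key : ∀ m, a ≤ m → m ≤ b → ∑ n ∈ Ioc a m, u n * g n +
      (∑ n ∈ Ioc a m, v n + c - ∑ n ∈ Ioc a m, u n) * g (m + 1) ≤
        ∑ n ∈ Ioc a m, v n * g n + c * g (a + 1) := by
    intro m hm
    induction m, hm using Nat.le_induction with
    | base => intro _; simp
    | succ m hm ih =>
      intro hmb
      have h1 := ih (by omega)
      have h2 := h (m + 1) (by omega) hmb
      have h3 := hg (m + 1) (by omega)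
      rw [Finset.sum_Ioc_succ_top hm, Finset.sum_Ioc_succ_top hm] at h2
      simp only [Finset.sum_Ioc_succ_top hm]
      nlinarith
  have h1 := key b hab le_rfl
  have h2 := mul_nonneg (sub_nonneg.2 (h b hab le_rfl)) (hg0 (b + 1) (by omega))
  linarith

theorem log_four_le : Real.log 4 ≤ 1.4 := by
  have : Real.log 4 = 2 * Real.log 2 := by
    rw [show (4 : ℝ) = 2 ^ 2 by norm_num, Real.log_pow]; norm_num
  linarith [Real.log_two_lt_d9]

theorem sum_primesIoc_eq (a b : ℕ) (f : ℕ → ℝ) :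
    ∑ p ∈ primesIoc a b, f p = ∑ n ∈ Ioc a b, if n.Prime then f n else 0 := by
  rw [primesIoc, Finset.sum_filter]

theorem sum_primesIoc_add {a b c : ℕ} (hab : a ≤ b) (hbc : b ≤ c) (f : ℕ → ℝ) :
    ∑ p ∈ primesIoc a b, f p + ∑ p ∈ primesIoc b c, f p = ∑ p ∈ primesIoc a c, f p := by
  simp only [sum_primesIoc_eq]
  exact Finset.sum_Ioc_consecutive _ hab hbc

/-- Mertens' second theorem on an interval, as an upper bound. -/
theorem sum_inv_primesIoc_le {a b : ℕ} (ha : 2 ≤ a) (hab : a ≤ b) :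
    ∑ p ∈ primesIoc a b, (1 : ℝ) / p ≤
      Real.log (Real.log b / Real.log a) + 7 / Real.log a := by
  have hlogpos : ∀ n : ℕ, 2 ≤ n → 0 < Real.log n := fun n hn =>
    Real.log_pos (by exact_mod_cast hn)
  have h1 : ∑ p ∈ primesIoc a b, (1 : ℝ) / p =
      ∑ n ∈ Ioc a b, (if n.Prime then Real.log n / n else 0) * (1 / Real.log n) := by
    rw [sum_primesIoc_eq]
    apply Finset.sum_congr rfl
    intro n hn
    have := hlogpos n (by have := (mem_Ioc.1 hn).1; omega)
    split_ifs
    · field_simp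
    · simp
  have h2 := sum_mul_le_of_partial_sums_le (u := fun n => if n.Prime then Real.log n / n else 0)
    (v := fun n => Real.log n - Real.log ((n - 1 : ℕ) : ℝ)) (g := fun n => 1 / Real.log n) (c := 7)
    hab
    (fun n hn => by
      have := hlogpos n (by omega)
      have h3 : Real.log n ≤ Real.log ((n + 1 : ℕ) : ℝ) :=
        Real.log_le_log (by exact_mod_cast (by omega : 0 < n)) (by push_cast; linarith)
      exact one_div_le_one_div_of_le this h3)
    (fun n hn => by have := hlogpos n (by omega); positivity)
    (fun m ham hmb => by
      have h3 : ∑ n ∈ Ioc a m, (Real.log n - Real.log ((n - 1 : ℕ) : ℝ)) =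
          Real.log m - Real.log a := by
        induction m, ham using Nat.le_induction with
        | base => simp
        | succ k hk ih => rw [Finset.sum_Ioc_succ_top hk, ih (by omega)]; simp
      rw [h3, ← sum_primesIoc_eq a m (fun n => Real.log n / n)]
      have h4 := sum_primesIoc_add (Nat.zero_le a) ham (fun n => Real.log n / n)
      have h5 := sum_log_div_le m
      have h6 := le_sum_log_div (n := a) (by omega)
      linarith [log_four_le])
  rw [h1]
  refine h2.trans ?_
  have h3 : ∑ n ∈ Ioc a b, (Real.log n - Real.log ((n - 1 : ℕ) : ℝ)) * (1 / Real.log n) ≤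
      Real.log (Real.log b) - Real.log (Real.log a) := by
    clear h1 h2
    induction b, hab using Nat.le_induction with
    | base => simp
    | succ k hk ih =>
      rw [Finset.sum_Ioc_succ_top hk]
      have hk1 := hlogpos k (by omega)
      have hk2 := hlogpos (k + 1) (by omega)
      have h4 := Real.one_sub_inv_le_log_of_pos (div_pos hk2 hk1)
      rw [Real.log_div hk2.ne' hk1.ne'] at h4
      have h5 : (Real.log ((k + 1 : ℕ) : ℝ) - Real.log ((k + 1 - 1 : ℕ) : ℝ)) *
          (1 / Real.log ((k + 1 : ℕ) : ℝ)) =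
          1 - (Real.log ((k + 1 : ℕ) : ℝ) / Real.log (k : ℝ))⁻¹ := by
        rw [Nat.add_sub_cancel]
        field_simp
      linarith
  have ha0 := hlogpos a ha
  have hb0 := hlogpos b (by omega)
  rw [Real.log_div hb0.ne' ha0.ne']
  have h4 : (7 : ℝ) * (1 / Real.log ((a + 1 : ℕ) : ℝ)) ≤ 7 / Real.log a := by
    rw [mul_one_div]
    apply div_le_div_of_nonneg_left (by norm_num) ha0
    exact Real.log_le_log (by exact_mod_cast (by omega : 0 < a)) (by push_cast; linarith)
  linarith

theorem sum_inv_primes_le {n : ℕ} (hn : 2 ≤ n) :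
    ∑ p ∈ primesIoc 0 n, (1 : ℝ) / p ≤ Real.log (Real.log n) + 12 := by
  rw [← sum_primesIoc_add (Nat.zero_le 2) hn]
  have h1 := sum_inv_primesIoc_le le_rfl hn
  have h2 : primesIoc 0 2 = {2} := by decide
  have hl : (0.69 : ℝ) < Real.log 2 := by linarith [Real.log_two_gt_d9]
  have hn0 : 0 < Real.log n := Real.log_pos (by exact_mod_cast hn)
  rw [h2, Finset.sum_singleton]
  push_cast at h1 ⊢
  rw [Real.log_div hn0.ne' (by linarith)] at h1
  have h3 : 7 / Real.log 2 ≤ 10.2 := by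
    rw [div_le_iff₀ (by linarith)]; linarith
  have h4 : -0.5 ≤ Real.log (Real.log 2) := by
    have := Real.one_sub_inv_le_log_of_pos (show 0 < Real.log 2 by linarith)
    have h5 : (Real.log 2)⁻¹ ≤ 1.5 := by
      rw [inv_le_comm₀ (by linarith) (by norm_num)]; linarith
    linarith
  linarith

/-- Chebyshev's bound for the primes whose logarithms lie in an interval of length one. -/
theorem sum_inv_primes_window_le {B : Finset ℕ} {K w : ℝ} (hK : 1 ≤ K)
    (hB : ∀ p ∈ B, p.Prime ∧ K ≤ Real.log p ∧ w ≤ Real.log p ∧ Real.log p ≤ w + 1) :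
    ∑ p ∈ B, (1 : ℝ) / p ≤ 4 / K := by
  set v := max K w with hv
  have hvK : K ≤ v := le_max_left _ _
  have h1 : ∀ p ∈ B, (1 : ℝ) / p ≤ Real.exp (-v) / K * Real.log p := by
    intro p hp
    obtain ⟨hpp, h2, h3, h4⟩ := hB p hp
    have hp0 : (0 : ℝ) < p := by exact_mod_cast hpp.pos
    have h5 : Real.exp v ≤ p := by
      rw [← Real.exp_log hp0]
      exact Real.exp_le_exp.2 (max_le h2 h3)
    calc (1 : ℝ) / p ≤ 1 / Real.exp v := one_div_le_one_div_of_le (Real.exp_pos v) h5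
      _ = Real.exp (-v) / K * K := by rw [Real.exp_neg]; field_simp
      _ ≤ _ := by gcongr
  have h2 : ∑ p ∈ B, Real.log p ≤ Real.log 4 * Real.exp (v + 1) := by
    refine le_trans ?_ (Chebyshev.theta_le_log4_mul_x (Real.exp_pos (v + 1)).le)
    rw [Chebyshev.theta]
    apply Finset.sum_le_sum_of_subset_of_nonneg
    · intro p hp
      obtain ⟨hpp, h2, h3, h4⟩ := hB p hp
      have hp0 : (0 : ℝ) < p := by exact_mod_cast hpp.pos
      refine mem_filter.2 ⟨mem_Ioc.2 ⟨hpp.pos, Nat.le_floor ?_⟩, hpp⟩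
      rw [← Real.exp_log hp0]
      exact Real.exp_le_exp.2 (h4.trans (by linarith [le_max_right K w]))
    · intro p hp _
      exact Real.log_nonneg (by exact_mod_cast (mem_filter.1 hp).2.one_lt.le)
  calc ∑ p ∈ B, (1 : ℝ) / p ≤ ∑ p ∈ B, Real.exp (-v) / K * Real.log p := Finset.sum_le_sum h1
    _ = Real.exp (-v) / K * ∑ p ∈ B, Real.log p := by rw [Finset.mul_sum]
    _ ≤ Real.exp (-v) / K * (Real.log 4 * Real.exp (v + 1)) := by gcongr
    _ = Real.log 4 * Real.exp 1 / K := by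
      rw [Real.exp_add, Real.exp_neg]; field_simp
    _ ≤ 4 / K := by
      gcongr
      nlinarith [log_four_le, Real.exp_one_lt_d9, Real.exp_pos 1]

/-- The divisors of `n` counted by `hooleyDelta` at the position `u`. -/
noncomputable def window (n : ℕ) (u : ℝ) : Finset ℕ :=
  n.divisors.filter (fun d : ℕ => Real.exp u < (d : ℝ) ∧ (d : ℝ) ≤ Real.exp (u + 1))

theorem bddAbove_window_card (n : ℕ) : BddAbove {m : ℕ | ∃ u : ℝ, m = (window n u).card} :=
  ⟨n.divisors.card, by rintro _ ⟨u, rfl⟩; exact card_filter_le _ _⟩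

theorem window_card_le (n : ℕ) (u : ℝ) : (window n u).card ≤ hooleyDelta n :=
  le_csSup (bddAbove_window_card n) ⟨u, rfl⟩

theorem exists_window_card_eq (n : ℕ) : ∃ u : ℝ, hooleyDelta n = (window n u).card :=
  Nat.sSup_mem (s := {m : ℕ | ∃ u : ℝ, m = (window n u).card}) ⟨_, 0, rfl⟩ (bddAbove_window_card n)

theorem hooleyDelta_le_card_divisors (n : ℕ) : hooleyDelta n ≤ n.divisors.card := by
  obtain ⟨u, hu⟩ := exists_window_card_eq n
  rw [hu]
  exact card_filter_le _ _

theorem mem_window_iff {n d : ℕ} {u : ℝ} :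
    d ∈ window n u ↔ d ∈ n.divisors ∧ u < Real.log d ∧ Real.log d ≤ u + 1 := by
  rw [window, mem_filter]
  refine and_congr_right fun hd => ?_
  have : (0 : ℝ) < d := by exact_mod_cast Nat.pos_of_mem_divisors hd
  rw [Real.lt_log_iff_exp_lt this, Real.log_le_iff_le_exp this]

theorem hooleyDelta_mul_le (m n : ℕ) :
    hooleyDelta (m * n) ≤ m.divisors.card * hooleyDelta n := by
  obtain ⟨u, hu⟩ := exists_window_card_eq (m * n)
  rw [hu]
  have hsub : window (m * n) u ⊆
      m.divisors.biUnion fun e => (window n (u - Real.log e)).image (e * ·) := by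
    intro d hd
    obtain ⟨h1, h2, h3⟩ := mem_window_iff.1 hd
    rw [Nat.divisors_mul, Finset.mem_mul] at h1
    obtain ⟨e, he, f, hf, rfl⟩ := h1
    have he0 : (e : ℝ) ≠ 0 := by exact_mod_cast (Nat.pos_of_mem_divisors he).ne'
    have hf0 : (f : ℝ) ≠ 0 := by exact_mod_cast (Nat.pos_of_mem_divisors hf).ne'
    rw [Nat.cast_mul, Real.log_mul he0 hf0] at h2 h3
    exact mem_biUnion.2 ⟨e, he, mem_image.2 ⟨f, mem_window_iff.2
      ⟨hf, by linarith, by linarith⟩, rfl⟩⟩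
  calc (window (m * n) u).card ≤ _ := card_le_card hsub
    _ ≤ ∑ e ∈ m.divisors, ((window n (u - Real.log e)).image (e * ·)).card := card_biUnion_le
    _ ≤ ∑ _e ∈ m.divisors, hooleyDelta n :=
      Finset.sum_le_sum fun e _ => card_image_le.trans (window_card_le _ _)
    _ = _ := by rw [Finset.sum_const, smul_eq_mul]

/-- Measurable, bounded, nonnegative functions of bounded support. -/
def Tame (g : ℝ → ℝ) : Prop :=
  Measurable g ∧ ∃ C r : ℝ, 0 ≤ C ∧ ∀ u, 0 ≤ g u ∧ g u ≤ C ∧ (r < |u| → g u = 0)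

theorem Tame.nonneg {g : ℝ → ℝ} (hg : Tame g) (u : ℝ) : 0 ≤ g u := by
  obtain ⟨_, C, r, _, h⟩ := hg
  exact (h u).1

theorem Tame.integrable {g : ℝ → ℝ} (hg : Tame g) : MeasureTheory.Integrable g := by
  obtain ⟨hm, C, r, hC, h⟩ := hg
  have h1 : MeasureTheory.Integrable ((Set.Icc (-r) r).indicator fun _ : ℝ => C) :=
    (MeasureTheory.integrable_indicator_iff measurableSet_Icc).2
      (MeasureTheory.integrableOn_const (by simp))
  refine h1.mono hm.aestronglyMeasurable (Filter.Eventually.of_forall fun u => ?_)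
  obtain ⟨h2, h3, h4⟩ := h u
  by_cases hu : r < |u|
  · rw [h4 hu, norm_zero]; exact norm_nonneg _
  · rw [Set.indicator_of_mem (Set.mem_Icc.2 (abs_le.1 (not_lt.1 hu)))]
    rw [Real.norm_of_nonneg h2, Real.norm_of_nonneg hC]
    exact h3

theorem Tame.mul {g h : ℝ → ℝ} (hg : Tame g) (hh : Tame h) : Tame fun u => g u * h u := by
  obtain ⟨hm, C, r, hC, h1⟩ := hg
  obtain ⟨hm', C', r', hC', h2⟩ := hh
  refine ⟨hm.mul hm', C * C', r, mul_nonneg hC hC', fun u => ⟨mul_nonneg (h1 u).1 (h2 u).1,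
    mul_le_mul (h1 u).2.1 (h2 u).2.1 (h2 u).1 hC, fun hu => by simp [(h1 u).2.2 hu]⟩⟩

theorem Tame.pow {g : ℝ → ℝ} (hg : Tame g) (k : ℕ) : Tame fun u => g u ^ (k + 1) := by
  induction k with
  | zero => simpa using hg
  | succ k ih => simpa only [pow_succ] using ih.mul hg

theorem Tame.add {g h : ℝ → ℝ} (hg : Tame g) (hh : Tame h) : Tame fun u => g u + h u := by
  obtain ⟨hm, C, r, hC, h1⟩ := hg
  obtain ⟨hm', C', r', hC', h2⟩ := hh
  refine ⟨hm.add hm', C + C', max r r', add_nonneg hC hC', fun u => ⟨add_nonneg (h1 u).1 (h2 u).1,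
    add_le_add (h1 u).2.1 (h2 u).2.1, fun hu => ?_⟩⟩
  simp [(h1 u).2.2 ((le_max_left _ _).trans_lt hu), (h2 u).2.2 ((le_max_right _ _).trans_lt hu)]

theorem Tame.const_mul {g : ℝ → ℝ} (hg : Tame g) {c : ℝ} (hc : 0 ≤ c) :
    Tame fun u => c * g u := by
  obtain ⟨hm, C, r, hC, h1⟩ := hg
  exact ⟨hm.const_mul c, c * C, r, mul_nonneg hc hC, fun u => ⟨mul_nonneg hc (h1 u).1,
    mul_le_mul_of_nonneg_left (h1 u).2.1 hc, fun hu => by simp [(h1 u).2.2 hu]⟩⟩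

theorem Tame.comp_add {g : ℝ → ℝ} (hg : Tame g) (c : ℝ) : Tame fun u => g (u + c) := by
  obtain ⟨hm, C, r, hC, h1⟩ := hg
  refine ⟨hm.comp (measurable_id.add_const c), C, r + |c|, hC, fun u => ⟨(h1 _).1, (h1 _).2.1,
    fun hu => (h1 _).2.2 ?_⟩⟩
  have : |u| ≤ |u + c| + |c| := by
    calc |u| = |(u + c) - c| := by rw [add_sub_cancel_right]
      _ ≤ _ := abs_sub _ _
  linarith

theorem Tame.sum {ι : Type*} {s : Finset ι} {g : ι → ℝ → ℝ} (hg : ∀ i ∈ s, Tame (g i)) :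
    Tame fun u => ∑ i ∈ s, g i u := by
  classical
  induction s using Finset.induction_on with
  | empty => exact ⟨by simp, 0, 0, le_rfl, fun u => by simp⟩
  | insert i s hi ih =>
    simp only [Finset.sum_insert hi]
    exact (hg i (mem_insert_self i s)).add (ih fun k hk => hg k (mem_insert_of_mem hk))

theorem tame_indicator (a b : ℝ) : Tame ((Set.Ico a b).indicator fun _ => 1) := by
  refine ⟨measurable_const.indicator measurableSet_Ico, 1, max |a| |b|, zero_le_one, fun u =>
    ⟨Set.indicator_nonneg (fun _ _ => zero_le_one) u,
    Set.indicator_apply_le' (fun _ => le_rfl) (fun _ => zero_le_one), fun hu => ?_⟩⟩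
  apply Set.indicator_of_notMem
  rintro ⟨h1, h2⟩
  have := abs_le_max_abs_abs h1 h2.le
  linarith

/-- The number of divisors `d` of `m` with `u < log d ≤ u + 1`. -/
noncomputable def divCount (m : ℕ) (u : ℝ) : ℝ :=
  ∑ d ∈ m.divisors, (Set.Ico (Real.log d - 1) (Real.log d)).indicator (fun _ => 1) u

theorem tame_divCount (m : ℕ) : Tame (divCount m) :=
  Tame.sum fun d _ => tame_indicator (Real.log d - 1) (Real.log d)

theorem divCount_nonneg (m : ℕ) (u : ℝ) : 0 ≤ divCount m u := (tame_divCount m).nonneg u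

theorem divCount_le (m : ℕ) (u : ℝ) : divCount m u ≤ m.divisors.card := by
  rw [divCount, Finset.card_eq_sum_ones, Nat.cast_sum]
  push_cast
  exact Finset.sum_le_sum fun d _ =>
    Set.indicator_apply_le' (fun _ => le_rfl) (fun _ => zero_le_one)

theorem divCount_eq_card_window (m : ℕ) (u : ℝ) : divCount m u = (window m u).card := by
  have : window m u = m.divisors.filter fun d : ℕ =>
      u ∈ Set.Ico (Real.log d - 1) (Real.log d) := by
    ext d
    rw [mem_window_iff, mem_filter, Set.mem_Ico]
    exact and_congr_right fun _ => ⟨fun h => ⟨by linarith, h.1⟩, fun h => ⟨h.2, by linarith⟩⟩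
  rw [this, Finset.card_filter, divCount]
  push_cast
  exact Finset.sum_congr rfl fun d _ => by rw [Set.indicator_apply]

theorem integral_divCount (m : ℕ) : ∫ u, divCount m u = m.divisors.card := by
  unfold divCount
  rw [MeasureTheory.integral_finsetSum _ fun d _ => (tame_indicator _ _).integrable]
  have : ∀ d ∈ m.divisors, ∫ u, (Set.Ico (Real.log (d : ℝ) - 1) (Real.log d)).indicator
      (fun _ => (1 : ℝ)) u = 1 := by
    intro d _
    rw [MeasureTheory.integral_indicator measurableSet_Ico]
    simp
  rw [Finset.sum_congr rfl this]
  simp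

theorem divCount_prime_mul {m p : ℕ} (hp : p.Prime) (hpm : ¬ p ∣ m) (u : ℝ) :
    divCount (p * m) u = divCount m u + divCount m (u + -Real.log p) := by
  have hp0 : (p : ℝ) ≠ 0 := by exact_mod_cast hp.ne_zero
  have h1 : (p * m).divisors = m.divisors ∪ m.divisors.image (p * ·) := by
    rw [Nat.divisors_mul, hp.divisors]
    ext d
    simp [Finset.mem_mul]
  have h2 : Disjoint m.divisors (m.divisors.image (p * ·)) := by
    rw [Finset.disjoint_left]
    intro d hd hd'
    obtain ⟨e, _, rfl⟩ := mem_image.1 hd'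
    exact hpm ((dvd_mul_right p e).trans (Nat.dvd_of_mem_divisors hd))
  rw [divCount, h1, Finset.sum_union h2, Finset.sum_image fun a _ b _ hab =>
    Nat.eq_of_mul_eq_mul_left hp.pos hab]
  congr 1
  apply Finset.sum_congr rfl
  intro d hd
  have hd0 : (d : ℝ) ≠ 0 := by exact_mod_cast (Nat.pos_of_mem_divisors hd).ne'
  rw [Nat.cast_mul, Real.log_mul hp0 hd0]
  simp only [Set.indicator_apply, Set.mem_Ico]
  congr 1
  exact propext ⟨fun h => ⟨by linarith, by linarith⟩, fun h => ⟨by linarith, by linarith⟩⟩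

/-- The fourth moment of `divCount`. -/
noncomputable def fourthMoment (m : ℕ) : ℝ := ∫ u, divCount m u ^ 4

/-- The correlation of `divCount` with its shift by `log p`. -/
noncomputable def crossMoment (p m : ℕ) : ℝ :=
  7 * ∫ u, (divCount m u ^ 3 * divCount m (u + -Real.log p) +
    divCount m u * divCount m (u + -Real.log p) ^ 3)

theorem fourthMoment_nonneg (m : ℕ) : 0 ≤ fourthMoment m :=
  MeasureTheory.integral_nonneg fun u => pow_nonneg (divCount_nonneg m u) 4

theorem crossMoment_nonneg (p m : ℕ) : 0 ≤ crossMoment p m := by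
  refine mul_nonneg (by norm_num) (MeasureTheory.integral_nonneg fun u => ?_)
  have := divCount_nonneg m u
  have := divCount_nonneg m (u + -Real.log p)
  positivity

theorem fourthMoment_le (m : ℕ) : fourthMoment m ≤ (m.divisors.card : ℝ) ^ 4 := by
  calc fourthMoment m ≤ ∫ u, (m.divisors.card : ℝ) ^ 3 * divCount m u := by
        refine MeasureTheory.integral_mono ((tame_divCount m).pow 3).integrable
          ((tame_divCount m).const_mul (by positivity)).integrable fun u => ?_
        have h1 := divCount_nonneg m u
        have h2 := divCount_le m u
        calc divCount m u ^ 4 = divCount m u ^ 3 * divCount m u := by ring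
          _ ≤ _ := by gcongr
    _ = _ := by rw [MeasureTheory.integral_const_mul, integral_divCount]; ring

theorem hooleyDelta_pow_le (m : ℕ) : (hooleyDelta m : ℝ) ^ 4 ≤ 16 * fourthMoment m := by
  obtain ⟨v, hv⟩ := exists_window_card_eq m
  have hpt : ∀ u ∈ Set.Icc (v - 1) v,
      (hooleyDelta m : ℝ) ^ 4 ≤ 8 * (divCount m u ^ 4 + divCount m (u + 1) ^ 4) := by
    rintro u ⟨hu1, hu2⟩
    have h1 : (hooleyDelta m : ℝ) ≤ divCount m u + divCount m (u + 1) := by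
      rw [hv, divCount_eq_card_window, divCount_eq_card_window, ← Nat.cast_add, Nat.cast_le]
      refine (card_le_card fun d hd => ?_).trans (card_union_le _ _)
      obtain ⟨h1, h2, h3⟩ := mem_window_iff.1 hd
      rw [mem_union, mem_window_iff, mem_window_iff]
      rcases le_or_gt (Real.log d) (u + 1) with h | h
      · exact Or.inl ⟨h1, by linarith, h⟩
      · exact Or.inr ⟨h1, h, by linarith⟩
    have h2 := divCount_nonneg m u
    have h3 := divCount_nonneg m (u + 1)
    calc (hooleyDelta m : ℝ) ^ 4 ≤ (divCount m u + divCount m (u + 1)) ^ 4 := by gcongr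
      _ ≤ _ := by
        nlinarith [sq_nonneg (divCount m u - divCount m (u + 1)),
          sq_nonneg (divCount m u ^ 2 - divCount m (u + 1) ^ 2),
          mul_nonneg (mul_nonneg h2 h3) (sq_nonneg (divCount m u - divCount m (u + 1)))]
  have ht : Tame fun u => 8 * (divCount m u ^ 4 + divCount m (u + 1) ^ 4) :=
    (((tame_divCount m).pow 3).add (((tame_divCount m).comp_add 1).pow 3)).const_mul (by norm_num)
  calc (hooleyDelta m : ℝ) ^ 4 = ∫ _u in Set.Icc (v - 1) v, (hooleyDelta m : ℝ) ^ 4 := by simp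
    _ ≤ ∫ u in Set.Icc (v - 1) v, 8 * (divCount m u ^ 4 + divCount m (u + 1) ^ 4) :=
      MeasureTheory.setIntegral_mono_on (by simp) ht.integrable.integrableOn measurableSet_Icc hpt
    _ ≤ ∫ u, 8 * (divCount m u ^ 4 + divCount m (u + 1) ^ 4) :=
      MeasureTheory.setIntegral_le_integral ht.integrable (Filter.Eventually.of_forall ht.nonneg)
    _ = 8 * (fourthMoment m + ∫ u, divCount m (u + 1) ^ 4) := by
      rw [MeasureTheory.integral_const_mul, MeasureTheory.integral_add
        ((tame_divCount m).pow 3).integrable (((tame_divCount m).comp_add 1).pow 3).integrable,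
        fourthMoment]
    _ = _ := by
      rw [MeasureTheory.integral_add_right_eq_self (fun u => divCount m u ^ 4) 1, fourthMoment]
      ring

theorem fourthMoment_prime_mul_le {m p : ℕ} (hp : p.Prime) (hpm : ¬ p ∣ m) :
    fourthMoment (p * m) ≤ 2 * fourthMoment m + crossMoment p m := by
  have t1 := tame_divCount m
  have t2 := t1.comp_add (-Real.log p)
  have t3 := ((t1.pow 2).mul t2).add (t1.mul (t2.pow 2))
  have e1 : ∫ u, divCount m (u + -Real.log p) ^ 4 = fourthMoment m :=
    MeasureTheory.integral_add_right_eq_self (fun u => divCount m u ^ 4) _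
  calc fourthMoment (p * m) ≤ ∫ u, (divCount m u ^ 4 + divCount m (u + -Real.log p) ^ 4 +
        7 * (divCount m u ^ 3 * divCount m (u + -Real.log p) +
          divCount m u * divCount m (u + -Real.log p) ^ 3)) := by
        refine MeasureTheory.integral_mono ((tame_divCount _).pow 3).integrable
          (((t1.pow 3).add (t2.pow 3)).add (t3.const_mul (by norm_num))).integrable fun u => ?_
        simp only [divCount_prime_mul hp hpm]
        have h2 := divCount_nonneg m u
        have h3 := divCount_nonneg m (u + -Real.log p)
        nlinarith [mul_nonneg (mul_nonneg h2 h3)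
          (sq_nonneg (divCount m u - divCount m (u + -Real.log p)))]
    _ = _ := by
      rw [MeasureTheory.integral_add ((t1.pow 3).add (t2.pow 3)).integrable
        (t3.const_mul (by norm_num)).integrable, MeasureTheory.integral_add (t1.pow 3).integrable
        (t2.pow 3).integrable, MeasureTheory.integral_const_mul]
      simp only [Nat.reduceAdd]
      rw [e1, crossMoment, fourthMoment]
      ring

theorem sum_inv_mul_divCount_add_le {B : Finset ℕ} {K : ℝ} (hK : 1 ≤ K)
    (hB : ∀ p ∈ B, p.Prime ∧ K ≤ Real.log p) (m : ℕ) (u : ℝ) :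
    ∑ p ∈ B, (1 : ℝ) / p * (divCount m (u + -Real.log p) + divCount m (u + Real.log p)) ≤
      8 * m.divisors.card / K := by
  have key : ∀ d ∈ m.divisors, ∑ p ∈ B, (1 : ℝ) / p *
      ((Set.Ico (Real.log d - 1) (Real.log d)).indicator (fun _ => 1) (u + -Real.log p) +
        (Set.Ico (Real.log d - 1) (Real.log d)).indicator (fun _ => 1) (u + Real.log p)) ≤
      8 / K := by
    intro d _
    simp only [mul_add, Finset.sum_add_distrib, Set.indicator_apply, mul_ite, mul_one, mul_zero,
      ← Finset.sum_filter, Set.mem_Ico]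
    have h1 := sum_inv_primes_window_le (B := B.filter fun p : ℕ =>
      Real.log d - 1 ≤ u + -Real.log p ∧ u + -Real.log p < Real.log d) (w := u - Real.log d) hK
      (fun p hp => by
        obtain ⟨h1, h2, h3⟩ := mem_filter.1 hp
        exact ⟨(hB p h1).1, (hB p h1).2, by linarith, by linarith⟩)
    have h2 := sum_inv_primes_window_le (B := B.filter fun p : ℕ =>
      Real.log d - 1 ≤ u + Real.log p ∧ u + Real.log p < Real.log d) (w := Real.log d - u - 1) hK
      (fun p hp => by
        obtain ⟨h1, h2, h3⟩ := mem_filter.1 hp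
        exact ⟨(hB p h1).1, (hB p h1).2, by linarith, by linarith⟩)
    have : 8 / K = 4 / K + 4 / K := by ring
    linarith
  calc _ = ∑ d ∈ m.divisors, ∑ p ∈ B, (1 : ℝ) / p *
      ((Set.Ico (Real.log d - 1) (Real.log d)).indicator (fun _ => 1) (u + -Real.log p) +
        (Set.Ico (Real.log d - 1) (Real.log d)).indicator (fun _ => 1) (u + Real.log p)) := by
        rw [Finset.sum_comm]
        apply Finset.sum_congr rfl
        intro p _
        rw [← Finset.mul_sum, Finset.sum_add_distrib]
        rfl
    _ ≤ ∑ _d ∈ m.divisors, 8 / K := Finset.sum_le_sum key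
    _ = _ := by rw [Finset.sum_const, nsmul_eq_mul]; ring

theorem crossMoment_eq (p m : ℕ) :
    crossMoment p m = 7 * ∫ u, divCount m u ^ 3 *
      (divCount m (u + -Real.log p) + divCount m (u + Real.log p)) := by
  have t1 := tame_divCount m
  have t2 := t1.comp_add (-Real.log p)
  have t3 := t1.comp_add (Real.log p)
  rw [crossMoment, MeasureTheory.integral_add ((t1.pow 2).mul t2).integrable
    (t1.mul (t2.pow 2)).integrable]
  simp only [mul_add]
  rw [MeasureTheory.integral_add ((t1.pow 2).mul t2).integrable ((t1.pow 2).mul t3).integrable]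
  rw [← MeasureTheory.integral_add_right_eq_self (fun u => divCount m u *
    divCount m (u + -Real.log p) ^ (2 + 1)) (Real.log p)]
  simp only [add_neg_cancel_right]
  simp only [mul_comm (divCount m (_ + Real.log p)), mul_add]

theorem sum_inv_mul_crossMoment_le {B : Finset ℕ} {K : ℝ} (hK : 1 ≤ K)
    (hB : ∀ p ∈ B, p.Prime ∧ K ≤ Real.log p) (m : ℕ) :
    ∑ p ∈ B, (1 : ℝ) / p * crossMoment p m ≤
      56 * m.divisors.card / K * ∫ u, divCount m u ^ 3 := by
  have t1 := tame_divCount m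
  have t2 : ∀ p : ℕ, Tame fun u => (1 : ℝ) / p * (divCount m u ^ 3 *
      (divCount m (u + -Real.log p) + divCount m (u + Real.log p))) := fun p =>
    (((t1.pow 2).mul ((t1.comp_add _).add (t1.comp_add _)))).const_mul (by positivity)
  calc ∑ p ∈ B, (1 : ℝ) / p * crossMoment p m
      = 7 * ∑ p ∈ B, ∫ u, (1 : ℝ) / p * (divCount m u ^ 3 *
      (divCount m (u + -Real.log p) + divCount m (u + Real.log p))) := by
        rw [Finset.mul_sum]
        apply Finset.sum_congr rfl
        intro p _
        rw [crossMoment_eq, MeasureTheory.integral_const_mul]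
        ring
    _ = 7 * ∫ u, ∑ p ∈ B, (1 : ℝ) / p * (divCount m u ^ 3 *
      (divCount m (u + -Real.log p) + divCount m (u + Real.log p))) := by
        rw [MeasureTheory.integral_finsetSum _ fun p _ => (t2 p).integrable]
    _ ≤ 7 * ∫ u, 8 * m.divisors.card / K * divCount m u ^ 3 := by
        refine mul_le_mul_of_nonneg_left ?_ (by norm_num)
        refine MeasureTheory.integral_mono (Tame.sum fun p _ => t2 p).integrable
          ((t1.pow 2).const_mul (by positivity)).integrable fun u => ?_
        have h1 := sum_inv_mul_divCount_add_le hK hB m u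
        have h2 := pow_nonneg (divCount_nonneg m u) 3
        calc _ = divCount m u ^ 3 * ∑ p ∈ B, (1 : ℝ) / p *
              (divCount m (u + -Real.log p) + divCount m (u + Real.log p)) := by
              rw [Finset.mul_sum]
              exact Finset.sum_congr rfl fun p _ => by ring
          _ ≤ divCount m u ^ 3 * (8 * m.divisors.card / K) := by gcongr
          _ = _ := mul_comm _ _
    _ = _ := by rw [MeasureTheory.integral_const_mul]; ring

theorem integral_divCount_pow_three_le (m : ℕ) {c : ℝ} (hc : 0 < c) :
    ∫ u, divCount m u ^ 3 ≤ c * fourthMoment m + (c ^ 2)⁻¹ * m.divisors.card := by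
  have t1 := tame_divCount m
  have t2 := (t1.pow 3).const_mul hc.le
  have t3 := t1.const_mul (c := (c ^ 2)⁻¹) (by positivity)
  calc ∫ u, divCount m u ^ 3 ≤ ∫ u, (c * divCount m u ^ 4 + (c ^ 2)⁻¹ * divCount m u) := by
        refine MeasureTheory.integral_mono (t1.pow 2).integrable (t2.add t3).integrable fun u => ?_
        have h := divCount_nonneg m u
        set a := divCount m u
        change a ^ 3 ≤ c * a ^ 4 + (c ^ 2)⁻¹ * a
        rcases le_total 1 (c * a) with h1 | h1
        · have : 0 ≤ (c ^ 2)⁻¹ * a := by positivity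
          nlinarith [pow_nonneg h 3]
        · have h2 : a ^ 2 ≤ (c ^ 2)⁻¹ := by
            rw [← one_div, le_div_iff₀ (by positivity)]
            nlinarith [mul_nonneg hc.le h]
          have : 0 ≤ c * a ^ 4 := by positivity
          nlinarith
    _ = _ := by
      rw [MeasureTheory.integral_add t2.integrable t3.integrable, MeasureTheory.integral_const_mul,
        MeasureTheory.integral_const_mul, integral_divCount]
      rfl

/-- The `L⁴` norm of `divCount`. -/
noncomputable def fourthNorm (m : ℕ) : ℝ := fourthMoment m ^ (1 / 4 : ℝ)

/-- The fourth root of `crossMoment`. -/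
noncomputable def crossNorm (p m : ℕ) : ℝ := crossMoment p m ^ (1 / 4 : ℝ)

theorem fourthNorm_nonneg (m : ℕ) : 0 ≤ fourthNorm m :=
  Real.rpow_nonneg (fourthMoment_nonneg m) _

theorem crossNorm_nonneg (p m : ℕ) : 0 ≤ crossNorm p m :=
  Real.rpow_nonneg (crossMoment_nonneg p m) _

theorem fourthNorm_pow (m : ℕ) : fourthNorm m ^ 4 = fourthMoment m := by
  rw [fourthNorm, ← Real.rpow_natCast, ← Real.rpow_mul (fourthMoment_nonneg m)]
  norm_num

theorem crossNorm_pow (p m : ℕ) : crossNorm p m ^ 4 = crossMoment p m := by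
  rw [crossNorm, ← Real.rpow_natCast, ← Real.rpow_mul (crossMoment_nonneg p m)]
  norm_num

theorem fourthNorm_le (m : ℕ) : fourthNorm m ≤ m.divisors.card :=
  le_of_pow_le_pow_left₀ four_ne_zero (by positivity)
    ((fourthNorm_pow m).le.trans (fourthMoment_le m))

theorem hooleyDelta_le_fourthNorm (m : ℕ) : (hooleyDelta m : ℝ) ≤ 2 * fourthNorm m := by
  refine le_of_pow_le_pow_left₀ four_ne_zero (mul_nonneg zero_le_two (fourthNorm_nonneg m)) ?_
  rw [mul_pow, fourthNorm_pow]
  linarith [hooleyDelta_pow_le m]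

theorem fourthNorm_prime_mul_le {m p : ℕ} (hp : p.Prime) (hpm : ¬ p ∣ m) :
    fourthNorm (p * m) ≤ 1.19 * fourthNorm m + crossNorm p m := by
  have h1 := fourthNorm_nonneg m
  have h2 := crossNorm_nonneg p m
  refine le_of_pow_le_pow_left₀ four_ne_zero (by positivity) ?_
  rw [fourthNorm_pow]
  refine (fourthMoment_prime_mul_le hp hpm).trans ?_
  rw [← fourthNorm_pow m, ← crossNorm_pow p m]
  have h3 : 2 * fourthNorm m ^ 4 ≤ (1.19 * fourthNorm m) ^ 4 := by
    rw [mul_pow]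
    gcongr
    norm_num
  have h4 : ∀ a b : ℝ, 0 ≤ a → 0 ≤ b → a ^ 4 + b ^ 4 ≤ (a + b) ^ 4 := fun a b ha hb => by
    have : (a + b) ^ 4 = a ^ 4 + b ^ 4 + (4 * a ^ 3 * b + 6 * a ^ 2 * b ^ 2 + 4 * a * b ^ 3) := by
      ring
    rw [this]
    linarith [show 0 ≤ 4 * a ^ 3 * b + 6 * a ^ 2 * b ^ 2 + 4 * a * b ^ 3 by positivity]
  linarith [h4 _ _ (show 0 ≤ 1.19 * fourthNorm m by positivity) h2]

theorem sum_inv_mul_crossNorm_le {B : Finset ℕ} {K q ε : ℝ} (hq : 1 ≤ q) (hqK : q ^ 4 = K)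
    (hε : 0 < ε) (hB : ∀ p ∈ B, p.Prime ∧ K ≤ Real.log p) (hB1 : ∑ p ∈ B, (1 : ℝ) / p ≤ 1)
    {m : ℕ} (hm : m ≠ 0) :
    ∑ p ∈ B, (1 : ℝ) / p * crossNorm p m ≤
      57 * (ε * fourthNorm m + m.divisors.card / (ε ^ 2 * q ^ 3)) := by
  have hK : 1 ≤ K := hqK ▸ one_le_pow₀ hq
  have hR := fourthNorm_nonneg m
  have hτ : (0 : ℝ) < m.divisors.card := by
    exact_mod_cast Finset.card_pos.2 ⟨1, Nat.one_mem_divisors.2 hm⟩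
  set τ := (m.divisors.card : ℝ)
  set a := ε * fourthNorm m with ha
  set b := τ / (ε ^ 2 * q ^ 3) with hb
  have ha0 : 0 ≤ a := by positivity
  have hb0 : 0 < b := by positivity
  set μ := a + b with hμ
  have hμ0 : 0 < μ := by positivity
  have h1 : ∀ p : ℕ, crossNorm p m ≤ μ + crossMoment p m / μ ^ 3 := by
    intro p
    have h2 := crossNorm_nonneg p m
    rw [← crossNorm_pow]
    rcases le_total (crossNorm p m) μ with h | h
    · linarith [show 0 ≤ crossNorm p m ^ 4 / μ ^ 3 by positivity]
    · have : crossNorm p m ≤ crossNorm p m ^ 4 / μ ^ 3 := by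
        rw [le_div_iff₀ (by positivity)]
        calc crossNorm p m * μ ^ 3 ≤ crossNorm p m * crossNorm p m ^ 3 := by gcongr
          _ = _ := by ring
      linarith
  have h3 : ∑ p ∈ B, (1 : ℝ) / p * crossMoment p m ≤ 56 * (a ^ 4 + b ^ 4) := by
    refine (sum_inv_mul_crossMoment_le hK hB m).trans ?_
    have h4 := integral_divCount_pow_three_le m (c := ε ^ 4 * K / τ) (by positivity)
    calc 56 * τ / K * ∫ u, divCount m u ^ 3 ≤ 56 * τ / K * _ :=
          mul_le_mul_of_nonneg_left h4 (by positivity)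
      _ = _ := by
        rw [ha, hb, mul_pow, fourthNorm_pow, ← hqK]
        change 56 * τ / q ^ 4 * (ε ^ 4 * q ^ 4 / τ * _ + _ * τ) = _
        field_simp
  calc ∑ p ∈ B, (1 : ℝ) / p * crossNorm p m
      ≤ ∑ p ∈ B, (1 : ℝ) / p * (μ + crossMoment p m / μ ^ 3) :=
        Finset.sum_le_sum fun p _ => mul_le_mul_of_nonneg_left (h1 p) (by positivity)
    _ = μ * ∑ p ∈ B, (1 : ℝ) / p + (∑ p ∈ B, (1 : ℝ) / p * crossMoment p m) / μ ^ 3 := by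
        rw [Finset.mul_sum, Finset.sum_div, ← Finset.sum_add_distrib]
        exact Finset.sum_congr rfl fun p _ => by ring
    _ ≤ μ * 1 + 56 * (a ^ 4 + b ^ 4) / μ ^ 3 := by gcongr
    _ ≤ μ * 1 + 56 * μ := by
        gcongr
        rw [div_le_iff₀ (by positivity)]
        have h5 : a ^ 3 ≤ μ ^ 3 := by gcongr; linarith
        have h6 : b ^ 3 ≤ μ ^ 3 := by gcongr; linarith
        have : a ^ 4 + b ^ 4 ≤ μ * μ ^ 3 := by
          calc a ^ 4 + b ^ 4 = a * a ^ 3 + b * b ^ 3 := by ring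
            _ ≤ a * μ ^ 3 + b * μ ^ 3 := by gcongr
            _ = _ := by rw [hμ]; ring
        linarith
    _ = _ := by ring

/-- The sum of `t ^ ω(m) g(m) / m` over the products `m` of distinct elements of `A`. -/
noncomputable def weightedSum (t : ℝ) (A : Finset ℕ) (g : ℕ → ℝ) : ℝ :=
  ∑ s ∈ A.powerset, t ^ s.card / ((∏ p ∈ s, p : ℕ) : ℝ) * g (∏ p ∈ s, p)

theorem weightedSum_insert (t : ℝ) {A : Finset ℕ} (g : ℕ → ℝ) {p : ℕ} (hp : p ∉ A) :
    weightedSum t (insert p A) g =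
      weightedSum t A g + t / p * weightedSum t A (fun m => g (p * m)) := by
  rw [weightedSum, Finset.sum_powerset_insert hp, weightedSum, weightedSum, Finset.mul_sum]
  congr 1
  apply Finset.sum_congr rfl
  intro s hs
  have hps : p ∉ s := fun h => hp (mem_powerset.1 hs h)
  rw [Finset.card_insert_of_notMem hps, Finset.prod_insert hps, pow_succ, Nat.cast_mul, ← mul_assoc,
    div_mul_div_comm, mul_comm t, mul_comm (p : ℝ)]

theorem weightedSum_le {t : ℝ} (ht : 0 ≤ t) {A : Finset ℕ} {g h : ℕ → ℝ}
    (hgh : ∀ s ⊆ A, g (∏ p ∈ s, p) ≤ h (∏ p ∈ s, p)) : weightedSum t A g ≤ weightedSum t A h :=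
  Finset.sum_le_sum fun s hs =>
    mul_le_mul_of_nonneg_left (hgh s (mem_powerset.1 hs)) (by positivity)

theorem weightedSum_mono {t : ℝ} (ht : 0 ≤ t) {A B : Finset ℕ} (hAB : A ⊆ B) {g : ℕ → ℝ}
    (hg : ∀ m, 0 ≤ g m) : weightedSum t A g ≤ weightedSum t B g :=
  Finset.sum_le_sum_of_subset_of_nonneg (powerset_mono.2 hAB) fun s _ _ =>
    mul_nonneg (by positivity) (hg _)

theorem weightedSum_nonneg {t : ℝ} (ht : 0 ≤ t) {A : Finset ℕ} {g : ℕ → ℝ}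
    (hg : ∀ m, 0 ≤ g m) : 0 ≤ weightedSum t A g :=
  Finset.sum_nonneg fun s _ => mul_nonneg (by positivity) (hg _)

theorem weightedSum_add (t : ℝ) (A : Finset ℕ) (g h : ℕ → ℝ) :
    weightedSum t A (fun m => g m + h m) = weightedSum t A g + weightedSum t A h := by
  simp only [weightedSum, mul_add, Finset.sum_add_distrib]

theorem weightedSum_const_mul (t c : ℝ) (A : Finset ℕ) (g : ℕ → ℝ) :
    weightedSum t A (fun m => c * g m) = c * weightedSum t A g := by
  simp only [weightedSum, Finset.mul_sum]
  exact Finset.sum_congr rfl fun s _ => by ring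

theorem sum_mul_weightedSum (t : ℝ) (A B : Finset ℕ) (c : ℕ → ℝ) (g : ℕ → ℕ → ℝ) :
    ∑ p ∈ B, c p * weightedSum t A (g p) = weightedSum t A (fun m => ∑ p ∈ B, c p * g p m) := by
  simp only [weightedSum, Finset.mul_sum]
  rw [Finset.sum_comm]
  exact Finset.sum_congr rfl fun s _ => Finset.sum_congr rfl fun p _ => by ring

theorem card_divisors_prime_mul_le {p : ℕ} (hp : p.Prime) (m : ℕ) :
    (p * m).divisors.card ≤ 2 * m.divisors.card := by
  rw [Nat.divisors_mul]
  refine Finset.card_mul_le.trans (Nat.mul_le_mul_right _ ?_)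
  rw [hp.divisors]
  exact card_le_two

theorem primesIoc_succ {a n : ℕ} (h : a ≤ n) (hp : (n + 1).Prime) :
    primesIoc a (n + 1) = insert (n + 1) (primesIoc a n) := by
  ext p
  simp only [mem_primesIoc, mem_insert]
  constructor
  · rintro ⟨⟨h1, h2⟩, h3⟩
    by_cases hpn : p = n + 1
    · exact Or.inl hpn
    · exact Or.inr ⟨⟨h1, by omega⟩, h3⟩
  · rintro (rfl | ⟨⟨h1, h2⟩, h3⟩)
    · exact ⟨⟨by omega, le_rfl⟩, hp⟩
    · exact ⟨⟨h1, by omega⟩, h3⟩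

theorem primesIoc_succ_of_not {a n : ℕ} (hp : ¬ (n + 1).Prime) :
    primesIoc a (n + 1) = primesIoc a n := by
  ext p
  simp only [mem_primesIoc]
  constructor
  · rintro ⟨⟨h1, h2⟩, h3⟩
    have : p ≠ n + 1 := by rintro rfl; exact hp h3
    exact ⟨⟨h1, by omega⟩, h3⟩
  · rintro ⟨⟨h1, h2⟩, h3⟩
    exact ⟨⟨h1, by omega⟩, h3⟩

theorem succ_notMem_primesIoc (a n : ℕ) : n + 1 ∉ primesIoc a n := fun h => by
  have := (mem_primesIoc.1 h).1.2
  omega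

theorem primesIoc_subset {a b c : ℕ} (h : b ≤ c) : primesIoc a b ⊆ primesIoc a c := fun p hp => by
  obtain ⟨⟨h1, h2⟩, h3⟩ := mem_primesIoc.1 hp
  exact mem_primesIoc.2 ⟨⟨h1, h2.trans h⟩, h3⟩

theorem weightedSum_card_divisors_le {t : ℝ} (ht : 0 ≤ t) (n : ℕ) :
    weightedSum t (primesIoc 0 n) (fun m => m.divisors.card) ≤
      Real.exp (2 * t * ∑ p ∈ primesIoc 0 n, (1 : ℝ) / p) := by
  induction n with
  | zero => simp [primesIoc, weightedSum]
  | succ n ih =>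
    by_cases hp : (n + 1).Prime
    · rw [primesIoc_succ (Nat.zero_le n) hp, weightedSum_insert _ _ (succ_notMem_primesIoc 0 n),
        Finset.sum_insert (succ_notMem_primesIoc 0 n)]
      set A := primesIoc 0 n
      set p := n + 1
      have h1 : weightedSum t A (fun m => ((p * m).divisors.card : ℝ)) ≤
          2 * weightedSum t A (fun m => m.divisors.card) := by
        rw [← weightedSum_const_mul]
        exact weightedSum_le ht fun s _ => by exact_mod_cast card_divisors_prime_mul_le hp _
      have h0 : 0 ≤ weightedSum t A (fun m => (m.divisors.card : ℝ)) :=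
        weightedSum_nonneg ht fun m => by positivity
      calc _ ≤ weightedSum t A (fun m => (m.divisors.card : ℝ)) +
            t / p * (2 * weightedSum t A (fun m => m.divisors.card)) := by gcongr
        _ = (2 * t * (1 / p) + 1) * weightedSum t A (fun m => (m.divisors.card : ℝ)) := by ring
        _ ≤ Real.exp (2 * t * (1 / p)) * Real.exp (2 * t * ∑ p ∈ A, (1 : ℝ) / p) := by
          gcongr
          exact Real.add_one_le_exp _
        _ = _ := by rw [← Real.exp_add]; congr 1; ring
    · rwa [primesIoc_succ_of_not hp]

/-- The sum of `t ^ ω(m) ‖divCount m‖₄ / m` over squarefree `m` with no prime factor above `n`. -/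
noncomputable def normSum (t : ℝ) (n : ℕ) : ℝ := weightedSum t (primesIoc 0 n) fourthNorm

theorem normSum_nonneg {t : ℝ} (ht : 0 ≤ t) (n : ℕ) : 0 ≤ normSum t n :=
  weightedSum_nonneg ht fourthNorm_nonneg

theorem normSum_mono {t : ℝ} (ht : 0 ≤ t) {m n : ℕ} (h : m ≤ n) : normSum t m ≤ normSum t n :=
  weightedSum_mono ht (primesIoc_subset h) fourthNorm_nonneg

theorem not_dvd_prod_of_notMem {n p : ℕ} (hp : p.Prime) {s : Finset ℕ} (hs : s ⊆ primesIoc 0 n)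
    (hps : p ∉ s) : ¬ p ∣ ∏ q ∈ s, q := by
  rw [hp.prime.dvd_finsetProd_iff]
  rintro ⟨q, hq, hpq⟩
  have := (Nat.prime_dvd_prime_iff_eq hp (mem_primesIoc.1 (hs hq)).2).1 hpq
  exact hps (this ▸ hq)

theorem normSum_le_mul_prod {t : ℝ} (ht : 0 ≤ t) {a b n : ℕ} (han : a ≤ n) (hnb : n ≤ b) :
    normSum t n ≤ (normSum t a + ∑ p ∈ primesIoc a n,
      t / p * weightedSum t (primesIoc 0 b) (crossNorm p)) *
        Real.exp (1.19 * t * ∑ p ∈ primesIoc a n, (1 : ℝ) / p) := by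
  induction n, han using Nat.le_induction with
  | base => simp [primesIoc]
  | succ n han ih =>
    have ih := ih (by omega)
    by_cases hp : (n + 1).Prime
    · rw [primesIoc_succ han hp, Finset.sum_insert (succ_notMem_primesIoc a n),
        Finset.sum_insert (succ_notMem_primesIoc a n), normSum,
        primesIoc_succ (Nat.zero_le n) hp, weightedSum_insert _ _ (succ_notMem_primesIoc 0 n)]
      set A := primesIoc 0 n with hA
      set p := n + 1 with hpn
      set E := weightedSum t (primesIoc 0 b) (crossNorm p)
      have hE : 0 ≤ E := weightedSum_nonneg ht (crossNorm_nonneg p)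
      have h1 : weightedSum t A (fun m => fourthNorm (p * m)) ≤ 1.19 * normSum t n + E := by
        calc _ ≤ weightedSum t A (fun m => 1.19 * fourthNorm m + crossNorm p m) :=
              weightedSum_le ht fun s hs => fourthNorm_prime_mul_le hp
                (not_dvd_prod_of_notMem hp hs fun h => succ_notMem_primesIoc 0 n (hs h))
          _ = 1.19 * normSum t n + weightedSum t A (crossNorm p) := by
              rw [weightedSum_add, weightedSum_const_mul]; rfl
          _ ≤ _ := by
              gcongr
              exact weightedSum_mono ht (primesIoc_subset (by omega)) (crossNorm_nonneg p)
      change normSum t n + _ ≤ _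
      set G := normSum t a + ∑ p ∈ primesIoc a n,
        t / p * weightedSum t (primesIoc 0 b) (crossNorm p) with hG
      set σ := ∑ p ∈ primesIoc a n, (1 : ℝ) / p
      have hσ : 0 ≤ σ := Finset.sum_nonneg fun q _ => by positivity
      have hG0 : 0 ≤ G := add_nonneg (normSum_nonneg ht a) (Finset.sum_nonneg fun q _ =>
        mul_nonneg (by positivity) (weightedSum_nonneg ht (crossNorm_nonneg q)))
      have hp0 : (0 : ℝ) < p := by exact_mod_cast hp.pos
      have e1 : (1 : ℝ) ≤ Real.exp (1.19 * t * ((1 : ℝ) / p + σ)) :=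
        Real.one_le_exp (by positivity)
      calc normSum t n + t / p * weightedSum t A (fun m => fourthNorm (p * m))
          ≤ normSum t n + t / p * (1.19 * normSum t n + E) := by gcongr
        _ = (1.19 * t * (1 / p) + 1) * normSum t n + t / p * E := by ring
        _ ≤ Real.exp (1.19 * t * (1 / p)) * (G * Real.exp (1.19 * t * σ)) +
            t / p * E * Real.exp (1.19 * t * ((1 : ℝ) / p + σ)) := by
            refine add_le_add (mul_le_mul (Real.add_one_le_exp _) ih (normSum_nonneg ht n)
              (Real.exp_pos _).le) (le_mul_of_one_le_right (by positivity) e1)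
        _ = (normSum t a + (t / p * E + ∑ p ∈ primesIoc a n,
              t / p * weightedSum t (primesIoc 0 b) (crossNorm p))) *
              Real.exp (1.19 * t * ((1 : ℝ) / p + σ)) := by
            rw [mul_add (1.19 * t), Real.exp_add, hG]
            ring
    · rw [primesIoc_succ_of_not hp, normSum, primesIoc_succ_of_not hp]
      exact ih

theorem normSum_sq_le {t : ℝ} (ht : 0 ≤ t) (ht1 : t ≤ 1) {a : ℕ} {q : ℝ} (hq : 1 ≤ q)
    (hqa : q ^ 4 = Real.log a) (ha : 1000 ≤ Real.log a) :
    normSum t (a ^ 2) ≤ Real.exp (1.26 * t * Real.log 2) *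
      (normSum t a + 2 * 10 ^ 11 * t / q ^ 3 *
        weightedSum t (primesIoc 0 (a ^ 2)) (fun m => m.divisors.card)) := by
  have ha2 : 2 ≤ a := by
    by_contra h
    have : a = 0 ∨ a = 1 := by omega
    rcases this with rfl | rfl <;> norm_num at ha
  have hsq : a ≤ a ^ 2 := Nat.le_self_pow two_ne_zero a
  have h1 := normSum_le_mul_prod ht hsq le_rfl
  have h2 := sum_inv_primesIoc_le ha2 hsq
  have hl : Real.log ((a ^ 2 : ℕ) : ℝ) / Real.log a = 2 := by
    rw [Nat.cast_pow, Real.log_pow, mul_div_cancel_right₀ _ (by linarith)]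
    norm_num
  have hl2 := Real.log_two_lt_d9
  have hl2' := Real.log_two_gt_d9
  have h3 : ∑ p ∈ primesIoc a (a ^ 2), (1 : ℝ) / p ≤ Real.log 2 + 0.007 := by
    rw [hl] at h2
    have : 7 / Real.log a ≤ 0.007 := by
      rw [div_le_iff₀ (by linarith)]; linarith
    linarith
  set σ := ∑ p ∈ primesIoc a (a ^ 2), (1 : ℝ) / p
  set A := primesIoc 0 (a ^ 2)
  set T := weightedSum t A (fun m => (m.divisors.card : ℝ))
  have hT0 : 0 ≤ T := weightedSum_nonneg ht fun m => by positivity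
  set S := normSum t (a ^ 2)
  have hS0 : 0 ≤ S := normSum_nonneg ht _
  have h4 : ∑ p ∈ primesIoc a (a ^ 2), t / p * weightedSum t A (crossNorm p) ≤
      t * (1 / 1000 * S + 57 / ((1 / 57000) ^ 2 * q ^ 3) * T) := by
    calc _ = t * ∑ p ∈ primesIoc a (a ^ 2), 1 / (p : ℝ) * weightedSum t A (crossNorm p) := by
          rw [Finset.mul_sum]
          exact Finset.sum_congr rfl fun p _ => by ring
      _ = t * weightedSum t A (fun m => ∑ p ∈ primesIoc a (a ^ 2),
            1 / (p : ℝ) * crossNorm p m) := by rw [sum_mul_weightedSum]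
      _ ≤ t * weightedSum t A (fun m => 1 / 1000 * fourthNorm m +
            57 / ((1 / 57000) ^ 2 * q ^ 3) * (m.divisors.card : ℝ)) := by
          refine mul_le_mul_of_nonneg_left (weightedSum_le ht fun s hs => ?_) ht
          have hs0 : ∏ p ∈ s, p ≠ 0 := Finset.prod_ne_zero_iff.2 fun p hp =>
            (mem_primesIoc.1 (hs hp)).2.ne_zero
          refine (sum_inv_mul_crossNorm_le (ε := 1 / 57000) hq hqa (by norm_num) (fun p hp => ?_)
            (by linarith) hs0).trans (le_of_eq (by ring))
          obtain ⟨⟨h5, _⟩, h6⟩ := mem_primesIoc.1 hp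
          exact ⟨h6, Real.log_le_log (by exact_mod_cast (by omega : 0 < a))
            (by exact_mod_cast h5.le)⟩
      _ = _ := by rw [weightedSum_add, weightedSum_const_mul, weightedSum_const_mul]; rfl
  set G := normSum t a + 2 * 10 ^ 11 * t / q ^ 3 * T with hG
  have hG0 : 0 ≤ G := by have := normSum_nonneg ht a; positivity
  have h5 : normSum t a + ∑ p ∈ primesIoc a (a ^ 2), t / p * weightedSum t A (crossNorm p) ≤
      G + t / 1000 * S := by
    have : t * (57 / ((1 / 57000) ^ 2 * q ^ 3) * T) ≤ 2 * 10 ^ 11 * t / q ^ 3 * T := by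
      calc t * (57 / ((1 / 57000) ^ 2 * q ^ 3) * T) = 185193000000 * (t / q ^ 3 * T) := by
            field_simp; ring
        _ ≤ 2 * 10 ^ 11 * (t / q ^ 3 * T) := by gcongr; norm_num
        _ = _ := by ring
    linarith
  set Q := Real.exp (1.19 * t * σ) with hQ
  have hQ3 : Q ≤ 3 := by
    have : Q ≤ Real.exp 1 := by
      apply Real.exp_le_exp.2
      nlinarith
    linarith [Real.exp_one_lt_d9]
  have h6 : S * (1 - 0.003 * t) ≤ Q * G := by
    have h7 : S ≤ (G + t / 1000 * S) * Q := h1.trans (by gcongr)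
    have : t / 1000 * S * Q ≤ t / 1000 * S * 3 := by gcongr
    nlinarith
  have h7 : 1 ≤ (1 - 0.003 * t) * Real.exp (0.006 * t) := by
    nlinarith [Real.add_one_le_exp (0.006 * t)]
  calc S ≤ S * ((1 - 0.003 * t) * Real.exp (0.006 * t)) := le_mul_of_one_le_right hS0 h7
    _ = S * (1 - 0.003 * t) * Real.exp (0.006 * t) := by ring
    _ ≤ Q * G * Real.exp (0.006 * t) := by gcongr
    _ = Real.exp (1.19 * t * σ + 0.006 * t) * G := by rw [hQ, Real.exp_add]; ring
    _ ≤ _ := by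
      gcongr
      nlinarith

theorem log_two_pow_two_pow (k : ℕ) :
    Real.log (((2 ^ 2 ^ k : ℕ) : ℕ) : ℝ) = Real.exp (k * Real.log 2 + Real.log (Real.log 2)) := by
  have h : 0 < Real.log 2 := Real.log_pos one_lt_two
  rw [Real.exp_add, Real.exp_log h, mul_comm (k : ℝ), ← Real.rpow_def_of_pos two_pos,
    Real.rpow_natCast]
  push_cast
  rw [Real.log_pow]
  push_cast
  rfl

theorem log_log_two_bounds : -0.5 ≤ Real.log (Real.log 2) ∧ Real.log (Real.log 2) ≤ 0 := by
  have hl := Real.log_two_gt_d9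
  have hl' := Real.log_two_lt_d9
  refine ⟨?_, Real.log_nonpos (by linarith) (by linarith)⟩
  have := Real.one_sub_inv_le_log_of_pos (show 0 < Real.log 2 by linarith)
  have h5 : (Real.log 2)⁻¹ ≤ 1.5 := by
    rw [inv_le_comm₀ (by linarith) (by norm_num)]; linarith
  linarith

theorem two_mul_ten_pow_le : (2 : ℝ) * 10 ^ 11 ≤ Real.exp 27 := by
  have h := Real.exp_one_gt_d9
  calc (2 : ℝ) * 10 ^ 11 ≤ 2.7 ^ 27 := by norm_num
    _ ≤ Real.exp 1 ^ 27 := by gcongr; linarith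
    _ = _ := by rw [← Real.exp_nat_mul]; norm_num

theorem weightedSum_card_divisors_two_pow_le {t : ℝ} (ht : 0 ≤ t) (k : ℕ) :
    weightedSum t (primesIoc 0 (2 ^ 2 ^ k)) (fun m => m.divisors.card) ≤
      Real.exp (2 * t * (k * Real.log 2 + 12)) := by
  refine (weightedSum_card_divisors_le ht _).trans (Real.exp_le_exp.2 ?_)
  have h1 : 2 ≤ 2 ^ 2 ^ k := Nat.le_self_pow (by positivity) 2
  have h2 := sum_inv_primes_le h1
  rw [log_two_pow_two_pow, Real.log_exp] at h2
  gcongr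
  linarith [log_log_two_bounds.2]

theorem normSum_two_pow_succ_le {t : ℝ} (ht : 0 ≤ t) (ht1 : t ≤ 1) (i : ℕ) :
    normSum t (2 ^ 2 ^ (11 + (i + 1))) ≤ Real.exp (1.26 * t * Real.log 2) *
      (normSum t (2 ^ 2 ^ (11 + i)) +
        Real.exp (1.26 * t * (i * Real.log 2)) *
          (Real.exp 63 * Real.exp (-0.01 * Real.log 2) ^ i)) := by
  have hl := Real.log_two_gt_d9
  have hl' := Real.log_two_lt_d9
  have hll := log_log_two_bounds
  have hK := log_two_pow_two_pow (11 + i)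
  set v := ((11 + i : ℕ) : ℝ) * Real.log 2 + Real.log (Real.log 2) with hv
  have hi : (0 : ℝ) ≤ i := Nat.cast_nonneg i
  have hv0 : (10 + i) * Real.log 2 ≤ v := by
    rw [hv]; push_cast; linarith
  have hv1 : 0 ≤ v := by nlinarith
  have h1 := normSum_sq_le ht ht1 (a := 2 ^ 2 ^ (11 + i)) (q := Real.exp (v / 4))
    (Real.one_le_exp (by linarith)) (by rw [hK, ← Real.exp_nat_mul]; congr 1; push_cast; ring) (by
      have : Real.log (((2 ^ 2 ^ (11 + i) : ℕ) : ℕ) : ℝ) = 2 ^ (11 + i) * Real.log 2 := by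
        push_cast
        rw [Real.log_pow]
        push_cast
        rfl
      rw [this, pow_add]
      have : (1 : ℝ) ≤ 2 ^ i := one_le_pow₀ one_le_two
      nlinarith)
  rw [← pow_mul, ← pow_succ] at h1
  refine h1.trans ?_
  have h2 := weightedSum_card_divisors_two_pow_le ht (11 + i + 1)
  have h3 : 2 * 10 ^ 11 * t / Real.exp (v / 4) ^ 3 ≤ Real.exp (27 - 3 / 4 * v) := by
    rw [Real.exp_sub, ← Real.exp_nat_mul]
    have : ((3 : ℕ) : ℝ) * (v / 4) = 3 / 4 * v := by push_cast; ring
    rw [this]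
    gcongr
    calc 2 * 10 ^ 11 * t ≤ 2 * 10 ^ 11 * 1 := by gcongr
      _ ≤ _ := by linarith [two_mul_ten_pow_le]
  refine mul_le_mul_of_nonneg_left (add_le_add le_rfl ?_) (Real.exp_pos _).le
  calc _ ≤ Real.exp (27 - 3 / 4 * v) *
        Real.exp (2 * t * (((11 + i + 1 : ℕ) : ℝ) * Real.log 2 + 12)) :=
        mul_le_mul h3 h2 (weightedSum_nonneg ht fun m => by positivity) (Real.exp_pos _).le
    _ ≤ _ := by
      rw [← Real.exp_add, ← Real.exp_nat_mul, ← Real.exp_add, ← Real.exp_add, Real.exp_le_exp]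
      push_cast
      have h4 : t * (i * Real.log 2) ≤ i * Real.log 2 := mul_le_of_le_one_left (by positivity) ht1
      have h5 : t * Real.log 2 ≤ Real.log 2 := mul_le_of_le_one_left (by positivity) ht1
      nlinarith

theorem normSum_two_pow_le {t : ℝ} (ht : 0 ≤ t) (ht1 : t ≤ 1) (i : ℕ) :
    normSum t (2 ^ 2 ^ (11 + i)) ≤ Real.exp (1.26 * t * (i * Real.log 2)) * (Real.exp 40 +
      200 * Real.exp 63 * (1 - Real.exp (-0.01 * Real.log 2) ^ i)) := by
  have hl := Real.log_two_gt_d9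
  have hl' := Real.log_two_lt_d9
  induction i with
  | zero =>
    have h1 := weightedSum_card_divisors_two_pow_le ht 11
    have h2 : normSum t (2 ^ 2 ^ 11) ≤ weightedSum t (primesIoc 0 (2 ^ 2 ^ 11))
        (fun m => m.divisors.card) := weightedSum_le ht fun s _ => fourthNorm_le _
    simp only [add_zero, Nat.cast_zero, zero_mul, mul_zero, Real.exp_zero, pow_zero, sub_self,
      one_mul]
    refine (h2.trans h1).trans (Real.exp_le_exp.2 ?_)
    push_cast
    nlinarith
  | succ i ih =>
    refine (normSum_two_pow_succ_le ht ht1 i).trans ?_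
    set r := Real.exp (-0.01 * Real.log 2) with hr
    set E := Real.exp (1.26 * t * (i * Real.log 2))
    have h1 : Real.exp (1.26 * t * (((i + 1 : ℕ) : ℝ) * Real.log 2)) =
        Real.exp (1.26 * t * Real.log 2) * E := by
      rw [← Real.exp_add]; congr 1; push_cast; ring
    have hr1 : r ≤ 199 / 200 := by
      have h2 := Real.one_sub_inv_le_log_of_pos (show (0 : ℝ) < 199 / 200 by norm_num)
      rw [hr, ← Real.le_log_iff_exp_le (by norm_num)]
      norm_num at h2 ⊢
      linarith
    rw [h1, mul_assoc (Real.exp _)]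
    refine mul_le_mul_of_nonneg_left ?_ (Real.exp_pos _).le
    refine (add_le_add ih le_rfl).trans ?_
    rw [← mul_add]
    refine mul_le_mul_of_nonneg_left ?_ (Real.exp_pos _).le
    have hri : 0 ≤ Real.exp 63 * r ^ i := by positivity
    rw [pow_succ]
    nlinarith

theorem normSum_le {t : ℝ} (ht : 0 ≤ t) (ht1 : t ≤ 1) {n : ℕ} (hn : 3 ≤ n) :
    normSum t n ≤ Real.exp 70 * Real.exp (1.26 * t * Real.log (Real.log n)) := by
  have hl := Real.log_two_gt_d9
  have hn0 : (0 : ℝ) < n := by exact_mod_cast (by omega : 0 < n)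
  have hln : 1 ≤ Real.log n := by
    rw [Real.le_log_iff_exp_le hn0]
    have : (3 : ℝ) ≤ n := by exact_mod_cast hn
    linarith [Real.exp_one_lt_d9]
  obtain ⟨i, hi, hi'⟩ : ∃ i : ℕ, n ≤ 2 ^ 2 ^ (11 + i) ∧ i * Real.log 2 ≤ Real.log (Real.log n) := by
    have hex : ∃ i : ℕ, n ≤ 2 ^ 2 ^ (11 + i) := by
      refine ⟨n, (Nat.lt_two_pow_self.trans Nat.lt_two_pow_self).le.trans ?_⟩
      exact Nat.pow_le_pow_right two_pos (Nat.pow_le_pow_right two_pos (by omega))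
    classical
    refine ⟨Nat.find hex, Nat.find_spec hex, ?_⟩
    rcases Nat.eq_zero_or_pos (Nat.find hex) with h0 | hpos
    · rw [h0, Nat.cast_zero, zero_mul]
      exact Real.log_nonneg hln
    · obtain ⟨k, hk⟩ : ∃ k, Nat.find hex = k + 1 := ⟨Nat.find hex - 1, by omega⟩
      have h1 := Nat.find_min hex (m := k) (by omega)
      have h2 : Real.log ((2 ^ 2 ^ (11 + k) : ℕ) : ℝ) ≤ Real.log n :=
        Real.log_le_log (by positivity) (by exact_mod_cast (not_le.1 h1).le)
      rw [log_two_pow_two_pow, ← Real.le_log_iff_exp_le (by linarith)] at h2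
      rw [hk]
      push_cast at h2 ⊢
      linarith [log_log_two_bounds.1]
  refine (normSum_mono ht hi).trans ((normSum_two_pow_le ht ht1 i).trans ?_)
  rw [mul_comm]
  gcongr
  have h1 : 0 ≤ Real.exp 63 * Real.exp (-0.01 * Real.log 2) ^ i := by positivity
  have h2 : Real.exp 40 ≤ Real.exp 63 := Real.exp_le_exp.2 (by norm_num)
  have h3 : (201 : ℝ) ≤ Real.exp 7 := by
    have h := Real.exp_one_gt_d9
    calc (201 : ℝ) ≤ 2.7 ^ 7 := by norm_num
      _ ≤ Real.exp 1 ^ 7 := by gcongr; linarith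
      _ = _ := by rw [← Real.exp_nat_mul]; norm_num
  calc _ ≤ 201 * Real.exp 63 := by linarith
    _ ≤ Real.exp 7 * Real.exp 63 := by gcongr
    _ = _ := by rw [← Real.exp_add]; norm_num

theorem sum_le_sum_of_cover {α β : Type*} {s : Finset α} {u : Finset β} {g : α → ℝ} {h : β → ℝ}
    (φ : β → α) (hh : ∀ b ∈ u, 0 ≤ h b) (H : ∀ a ∈ s, ∃ b ∈ u, φ b = a ∧ g a ≤ h b) :
    ∑ a ∈ s, g a ≤ ∑ b ∈ u, h b := by
  classical
  calc ∑ a ∈ s, g a ≤ ∑ a ∈ s, ∑ b ∈ u with φ b = a, h b := by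
        refine Finset.sum_le_sum fun a ha => ?_
        obtain ⟨b, hb, h1, h2⟩ := H a ha
        exact h2.trans (Finset.single_le_sum (f := h) (fun c hc => hh c (mem_filter.1 hc).1)
          (mem_filter.2 ⟨hb, h1⟩))
    _ ≤ _ := Finset.sum_fiberwise_le_sum_of_sum_fiber_nonneg fun a _ =>
        Finset.sum_nonneg fun c hc => hh c (mem_filter.1 hc).1

theorem sum_inv_sq_le (N : ℕ) : ∑ i ∈ Icc 1 N, ((i : ℝ) ^ 2)⁻¹ ≤ 2 := by
  have h := sum_Ioo_inv_sq_le (α := ℝ) 0 (N + 1)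
  have : Ioo 0 (N + 1) = Icc 1 N := by ext i; simp only [mem_Ioo, mem_Icc]; omega
  rw [this] at h
  simpa using h

theorem sum_card_divisors_sq_le (N : ℕ) :
    ∑ d ∈ Icc 1 N, ((d ^ 2).divisors.card : ℝ) / (d : ℝ) ^ 2 ≤ 8 := by
  have h1 : ∑ d ∈ Icc 1 N, ((d ^ 2).divisors.card : ℝ) / (d : ℝ) ^ 2 =
      ∑ x ∈ (Icc 1 N).sigma fun d => (d ^ 2).divisors, ((x.1 : ℝ) ^ 2)⁻¹ := by
    rw [Finset.sum_sigma]
    refine Finset.sum_congr rfl fun d _ => ?_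
    simp only [Finset.sum_const, nsmul_eq_mul]
    rfl
  have h2 : ∑ x ∈ (Icc 1 N).sigma fun d => (d ^ 2).divisors, ((x.1 : ℝ) ^ 2)⁻¹ ≤
      ∑ z ∈ Icc 1 N ×ˢ Icc 1 N ×ˢ Icc 1 N,
        ((z.1 : ℝ) ^ 2)⁻¹ * (((z.2.1 : ℝ) ^ 2)⁻¹ * ((z.2.2 : ℝ) ^ 2)⁻¹) := by
    refine sum_le_sum_of_cover (fun z : ℕ × ℕ × ℕ => (⟨z.1 * z.2.1 * z.2.2, z.1 * z.2.1 ^ 2⟩ :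
      Σ _ : ℕ, ℕ)) (fun z _ => by positivity) ?_
    rintro ⟨d, e⟩ hx
    obtain ⟨hd, he⟩ := mem_sigma.1 hx
    simp only at hd he
    obtain ⟨hd1, hdN⟩ := mem_Icc.1 hd
    obtain ⟨a, b, ha, hb, rfl, hsf⟩ := Nat.sq_mul_squarefree_of_pos (Nat.pos_of_mem_divisors he)
    have hdvd := Nat.dvd_of_mem_divisors he
    have hbd : b ∣ d := (Nat.pow_dvd_pow_iff two_ne_zero).1 ((dvd_mul_right _ _).trans hdvd)
    obtain ⟨k, rfl⟩ := hbd
    have hk : a ∣ k := by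
      rw [mul_pow] at hdvd
      exact (hsf.dvd_pow_iff_dvd two_ne_zero).1 (Nat.dvd_of_mul_dvd_mul_left (by positivity) hdvd)
    obtain ⟨q, rfl⟩ := hk
    have hle : ∀ i : ℕ, i ∣ b * (a * q) → i ∈ Icc 1 N := fun i hi =>
      mem_Icc.2 ⟨Nat.pos_of_dvd_of_pos hi (by omega), (Nat.le_of_dvd (by omega) hi).trans hdN⟩
    refine ⟨(a, b, q), ?_, ?_, ?_⟩
    · simp only [mem_product]
      exact ⟨hle a ⟨b * q, by ring⟩, hle b ⟨a * q, rfl⟩, hle q ⟨b * a, by ring⟩⟩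
    · congr 1
      · ring
      · ring
    · apply le_of_eq
      simp only [Nat.cast_mul, mul_pow, mul_inv]
      ring
  rw [h1]
  refine h2.trans ?_
  rw [Finset.sum_product]
  simp only [← Finset.mul_sum, Finset.sum_product]
  simp only [← Finset.sum_mul]
  have h3 := sum_inv_sq_le N
  have h4 : 0 ≤ ∑ i ∈ Icc 1 N, ((i : ℝ) ^ 2)⁻¹ := Finset.sum_nonneg fun i _ => by positivity
  calc _ ≤ (2 : ℝ) * (2 * 2) := by gcongr
    _ = 8 := by norm_num

/-- The weight `t ^ ω(n) Δ(n)`. -/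
noncomputable def twisted (t : ℝ) (n : ℕ) : ℝ := t ^ n.primeFactors.card * hooleyDelta n

theorem twisted_nonneg {t : ℝ} (ht : 0 ≤ t) (n : ℕ) : 0 ≤ twisted t n := by
  unfold twisted; positivity

theorem twisted_mul_le {t : ℝ} (ht : 0 ≤ t) (ht1 : t ≤ 1) {m n : ℕ} (hm : m ≠ 0) (hn : n ≠ 0) :
    twisted t (m * n) ≤ m.divisors.card * twisted t n := by
  have h1 : t ^ (m * n).primeFactors.card ≤ t ^ n.primeFactors.card :=
    pow_le_pow_of_le_one ht ht1
      (card_le_card (Nat.primeFactors_mono (dvd_mul_left n m) (mul_ne_zero hm hn)))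
  have h2 : (hooleyDelta (m * n) : ℝ) ≤ m.divisors.card * hooleyDelta n := by
    exact_mod_cast hooleyDelta_mul_le m n
  calc twisted t (m * n) ≤ t ^ n.primeFactors.card * (m.divisors.card * hooleyDelta n) :=
        mul_le_mul h1 h2 (by positivity) (by positivity)
    _ = _ := by rw [twisted]; ring

theorem sum_squarefree_twisted_div_le {t : ℝ} (ht : 0 ≤ t) (N : ℕ) :
    ∑ m ∈ Icc 1 N with Squarefree m, twisted t m / m ≤ 2 * normSum t N := by
  rw [normSum, weightedSum, Finset.mul_sum]
  refine sum_le_sum_of_cover (fun s => ∏ p ∈ s, p) (fun s _ => ?_) fun m hm => ?_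
  · have := fourthNorm_nonneg (∏ p ∈ s, p)
    positivity
  · obtain ⟨hm1, hm2⟩ := mem_filter.1 hm
    obtain ⟨hm3, hm4⟩ := mem_Icc.1 hm1
    refine ⟨m.primeFactors, mem_powerset.2 fun p hp => ?_,
      Nat.prod_primeFactors_of_squarefree hm2, ?_⟩
    · have hpp := Nat.prime_of_mem_primeFactors hp
      exact mem_primesIoc.2 ⟨⟨hpp.pos, (Nat.le_of_mem_primeFactors hp).trans hm4⟩, hpp⟩
    · rw [Nat.prod_primeFactors_of_squarefree hm2, twisted]
      have := hooleyDelta_le_fourthNorm m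
      calc t ^ m.primeFactors.card * (hooleyDelta m : ℝ) / m
          ≤ t ^ m.primeFactors.card * (2 * fourthNorm m) / m := by gcongr
        _ = _ := by ring

theorem sum_twisted_div_le {t : ℝ} (ht : 0 ≤ t) (ht1 : t ≤ 1) (N : ℕ) :
    ∑ a ∈ Icc 1 N, twisted t a / a ≤ 16 * normSum t N := by
  calc ∑ a ∈ Icc 1 N, twisted t a / a
      ≤ ∑ z ∈ Icc 1 N ×ˢ (Icc 1 N).filter Squarefree,
        ((z.1 ^ 2).divisors.card : ℝ) / (z.1 : ℝ) ^ 2 * (twisted t z.2 / z.2) := by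
        refine sum_le_sum_of_cover (fun z : ℕ × ℕ => z.1 ^ 2 * z.2)
          (fun z _ => ?_) fun a ha => ?_
        · have := twisted_nonneg ht z.2
          positivity
        · obtain ⟨ha1, haN⟩ := mem_Icc.1 ha
          obtain ⟨m, d, hm, hd, rfl, hsf⟩ := Nat.sq_mul_squarefree_of_pos ha1
          have hdle : d ≤ d ^ 2 * m :=
            Nat.le_of_dvd (by positivity) ((dvd_pow_self d two_ne_zero).trans (dvd_mul_right _ _))
          have hmle : m ≤ d ^ 2 * m := Nat.le_of_dvd (by positivity) (dvd_mul_left _ _)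
          refine ⟨(d, m), mem_product.2 ⟨mem_Icc.2 ⟨hd, hdle.trans haN⟩, mem_filter.2
            ⟨mem_Icc.2 ⟨hm, hmle.trans haN⟩, hsf⟩⟩, rfl, ?_⟩
          have h1 := twisted_mul_le ht ht1 (m := d ^ 2) (n := m) (by positivity) hm.ne'
          calc twisted t (d ^ 2 * m) / ((d ^ 2 * m : ℕ) : ℝ)
              ≤ (d ^ 2).divisors.card * twisted t m / ((d ^ 2 * m : ℕ) : ℝ) := by gcongr
            _ = _ := by push_cast; rw [mul_div_mul_comm]
    _ = (∑ d ∈ Icc 1 N, ((d ^ 2).divisors.card : ℝ) / (d : ℝ) ^ 2) *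
        ∑ m ∈ Icc 1 N with Squarefree m, twisted t m / m := by
        rw [Finset.sum_mul_sum, Finset.sum_product]
    _ ≤ 8 * (2 * normSum t N) := by
        have h0 : 0 ≤ ∑ m ∈ Icc 1 N with Squarefree m, twisted t m / m :=
          Finset.sum_nonneg fun m _ => div_nonneg (twisted_nonneg ht m) (by positivity)
        exact mul_le_mul (sum_card_divisors_sq_le N) (sum_squarefree_twisted_div_le ht N) h0
          (by norm_num)
    _ = _ := by ring

theorem sum_moebius_div (m : ℕ) :
    ∑ c ∈ m.divisors, ((ArithmeticFunction.moebius (m / c) : ℤ) : ℝ) = if m = 1 then 1 else 0 := by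
  have h := congrArg (fun F : ArithmeticFunction ℤ => F m)
    ArithmeticFunction.moebius_mul_coe_zeta
  simp only [ArithmeticFunction.coe_mul_zeta_apply, ArithmeticFunction.one_apply] at h
  rw [Nat.sum_div_divisors m fun c => ((ArithmeticFunction.moebius c : ℤ) : ℝ)]
  exact_mod_cast congrArg (fun z : ℤ => (z : ℝ)) h

theorem sum_moebius_between {w e f : ℕ} (he : e ∈ Icc 1 w) (hf : f ∈ Icc 1 w) :
    ∑ d ∈ Icc 1 w, (if f ∣ d ∧ d ∣ e then ((ArithmeticFunction.moebius (e / d) : ℤ) : ℝ) else 0) =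
      if e = f then 1 else 0 := by
  obtain ⟨he1, hew⟩ := mem_Icc.1 he
  obtain ⟨hf1, hfw⟩ := mem_Icc.1 hf
  by_cases hfe : f ∣ e
  · obtain ⟨m, rfl⟩ := hfe
    have hm : m ≠ 0 := by rintro rfl; simp at he1
    have h1 : (Icc 1 w).filter (fun d => f ∣ d ∧ d ∣ f * m) = m.divisors.image (f * ·) := by
      ext d
      simp only [mem_filter, mem_Icc, mem_image, Nat.mem_divisors]
      constructor
      · rintro ⟨_, ⟨c, rfl⟩, h2⟩
        exact ⟨c, ⟨Nat.dvd_of_mul_dvd_mul_left hf1 h2, hm⟩, rfl⟩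
      · rintro ⟨c, ⟨hc, _⟩, rfl⟩
        have hc0 : 0 < c := Nat.pos_of_dvd_of_pos hc (by omega)
        have hdvd : f * c ∣ f * m := Nat.mul_dvd_mul_left f hc
        exact ⟨⟨Nat.mul_pos hf1 hc0, (Nat.le_of_dvd he1 hdvd).trans hew⟩, dvd_mul_right _ _, hdvd⟩
    rw [← Finset.sum_filter, h1, Finset.sum_image fun a _ b _ hab =>
      Nat.eq_of_mul_eq_mul_left hf1 hab]
    simp only [Nat.mul_div_mul_left _ _ (show 0 < f from hf1)]
    rw [sum_moebius_div m]
    congr 1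
    exact propext ⟨fun h => by rw [h, mul_one], fun h =>
      Nat.eq_of_mul_eq_mul_left hf1 (by rw [h, mul_one])⟩
  · rw [if_neg (by rintro rfl; exact hfe dvd_rfl)]
    exact Finset.sum_eq_zero fun d _ => if_neg fun h => hfe (h.1.trans h.2)

/-- The sum of `1 / e` over squarefree `e ≤ w`. -/
noncomputable def sieveSum (w : ℕ) : ℝ := ∑ e ∈ Icc 1 w with Squarefree e, (1 : ℝ) / e

/-- The diagonalising variables of Selberg's quadratic form. -/
noncomputable def sieveVar (w e : ℕ) : ℝ :=
  ((ArithmeticFunction.moebius e : ℤ) : ℝ) / (sieveSum w * e)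

/-- Selberg's sieve weights. -/
noncomputable def sieveWeight (w d : ℕ) : ℝ :=
  d * ∑ e ∈ Icc 1 w,
    if d ∣ e then ((ArithmeticFunction.moebius (e / d) : ℤ) : ℝ) * sieveVar w e else 0

theorem log_le_sieveSum (w : ℕ) : Real.log w / 2 ≤ sieveSum w := by
  rcases Nat.eq_zero_or_pos w with rfl | hw
  · simp [sieveSum]
  have h1 : ∑ n ∈ Icc 1 w, (1 : ℝ) / n ≤ 2 * sieveSum w := by
    calc ∑ n ∈ Icc 1 w, (1 : ℝ) / n ≤ ∑ z ∈ Icc 1 w ×ˢ (Icc 1 w).filter Squarefree,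
          ((z.1 : ℝ) ^ 2)⁻¹ * (1 / z.2) := by
          refine sum_le_sum_of_cover (fun z : ℕ × ℕ => z.1 ^ 2 * z.2)
            (fun z _ => by positivity) fun a ha => ?_
          obtain ⟨ha1, haN⟩ := mem_Icc.1 ha
          obtain ⟨m, d, hm, hd, rfl, hsf⟩ := Nat.sq_mul_squarefree_of_pos ha1
          have hdle : d ≤ d ^ 2 * m :=
            Nat.le_of_dvd (by positivity) ((dvd_pow_self d two_ne_zero).trans (dvd_mul_right _ _))
          have hmle : m ≤ d ^ 2 * m := Nat.le_of_dvd (by positivity) (dvd_mul_left _ _)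
          refine ⟨(d, m), mem_product.2 ⟨mem_Icc.2 ⟨hd, hdle.trans haN⟩, mem_filter.2
            ⟨mem_Icc.2 ⟨hm, hmle.trans haN⟩, hsf⟩⟩, rfl, ?_⟩
          push_cast
          rw [one_div, mul_inv, one_div]
      _ = (∑ d ∈ Icc 1 w, ((d : ℝ) ^ 2)⁻¹) * sieveSum w := by
          rw [sieveSum, Finset.sum_mul_sum, Finset.sum_product]
      _ ≤ 2 * sieveSum w := by
          refine mul_le_mul_of_nonneg_right (sum_inv_sq_le w) ?_
          exact Finset.sum_nonneg fun e _ => by positivity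
  have h2 := log_add_one_le_harmonic w
  rw [harmonic_eq_sum_Icc] at h2
  push_cast at h2
  simp only [one_div] at h1
  have h3 : Real.log w ≤ Real.log (w + 1) :=
    Real.log_le_log (by exact_mod_cast hw) (by linarith)
  linarith

theorem abs_moebius_div_le (e : ℕ) :
    |((ArithmeticFunction.moebius e : ℤ) : ℝ)| ≤ if Squarefree e then 1 else 0 := by
  split_ifs with h
  · exact_mod_cast ArithmeticFunction.abs_moebius_le_one (n := e)
  · rw [ArithmeticFunction.moebius_eq_zero_of_not_squarefree h]; simp

theorem sum_abs_sieveVar_le {w : ℕ} (hG : 0 < sieveSum w) :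
    ∑ e ∈ Icc 1 w, |sieveVar w e| ≤ 1 := by
  calc ∑ e ∈ Icc 1 w, |sieveVar w e|
      ≤ ∑ e ∈ Icc 1 w, (if Squarefree e then (1 : ℝ) / e else 0) / sieveSum w := by
        refine Finset.sum_le_sum fun e he => ?_
        have he0 : (0 : ℝ) < e := by exact_mod_cast (mem_Icc.1 he).1
        rw [sieveVar, abs_div, abs_of_pos (show 0 < sieveSum w * e by positivity)]
        calc _ ≤ (if Squarefree e then (1 : ℝ) else 0) / (sieveSum w * e) := by
              gcongr; exact abs_moebius_div_le e
          _ = _ := by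
              split_ifs
              · field_simp
              · simp
    _ = 1 := by
        rw [← Finset.sum_div, ← Finset.sum_filter]
        exact div_self hG.ne'

theorem abs_sieveWeight_le {w : ℕ} (hG : 0 < sieveSum w) (d : ℕ) : |sieveWeight w d| ≤ d := by
  rw [sieveWeight, abs_mul, Nat.abs_cast]
  refine mul_le_of_le_one_right (Nat.cast_nonneg d) ?_
  refine (Finset.abs_sum_le_sum_abs _ _).trans ((Finset.sum_le_sum fun e _ => ?_).trans
    (sum_abs_sieveVar_le hG))
  split_ifs
  · rw [abs_mul]
    refine mul_le_of_le_one_left (abs_nonneg _) ?_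
    exact_mod_cast ArithmeticFunction.abs_moebius_le_one (n := e / d)
  · rw [abs_zero]; exact abs_nonneg _

theorem sieveWeight_one {w : ℕ} (hG : 0 < sieveSum w) : sieveWeight w 1 = 1 := by
  simp only [sieveWeight, Nat.cast_one, one_mul, one_dvd, if_true, Nat.div_one]
  calc _ = ∑ e ∈ Icc 1 w, (if Squarefree e then (1 : ℝ) / e else 0) / sieveSum w := by
        refine Finset.sum_congr rfl fun e he => ?_
        have he0 : (0 : ℝ) < e := by exact_mod_cast (mem_Icc.1 he).1
        have h1 : ((ArithmeticFunction.moebius e : ℤ) : ℝ) * (ArithmeticFunction.moebius e : ℤ) =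
            if Squarefree e then 1 else 0 := by
          have := ArithmeticFunction.moebius_sq (n := e)
          rw [← sq]
          exact_mod_cast congrArg (fun z : ℤ => (z : ℝ)) this
        rw [sieveVar, ← mul_div_assoc, h1]
        split_ifs
        · field_simp
        · simp
    _ = 1 := by
        rw [← Finset.sum_div, ← Finset.sum_filter]
        exact div_self hG.ne'

theorem sum_sieveWeight_div {w f : ℕ} (hf : f ∈ Icc 1 w) :
    ∑ d ∈ Icc 1 w, (if f ∣ d then sieveWeight w d / d else 0) = sieveVar w f := by
  calc _ = ∑ d ∈ Icc 1 w, ∑ e ∈ Icc 1 w, (if f ∣ d ∧ d ∣ e then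
        ((ArithmeticFunction.moebius (e / d) : ℤ) : ℝ) else 0) * sieveVar w e := by
        refine Finset.sum_congr rfl fun d hd => ?_
        have hd0 : (d : ℝ) ≠ 0 := by exact_mod_cast (Nat.one_le_iff_ne_zero.1 (mem_Icc.1 hd).1)
        split_ifs with h
        · rw [sieveWeight, mul_div_cancel_left₀ _ hd0]
          refine Finset.sum_congr rfl fun e _ => ?_
          by_cases hde : d ∣ e <;> simp [h, hde]
        · simp [h]
    _ = ∑ e ∈ Icc 1 w, (if e = f then 1 else 0) * sieveVar w e := by
        rw [Finset.sum_comm]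
        refine Finset.sum_congr rfl fun e he => ?_
        rw [← Finset.sum_mul, sum_moebius_between he hf]
    _ = _ := by simp [hf]

theorem sum_sieveWeight_lcm_le {w : ℕ} (hG : 0 < sieveSum w) :
    ∑ d ∈ Icc 1 w, ∑ d' ∈ Icc 1 w,
      sieveWeight w d * sieveWeight w d' / (Nat.lcm d d' : ℝ) ≤ 1 / sieveSum w := by
  calc _ = ∑ d ∈ Icc 1 w, ∑ d' ∈ Icc 1 w, ∑ e ∈ Icc 1 w, (Nat.totient e : ℝ) *
        ((if e ∣ d then sieveWeight w d / d else 0) *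
          (if e ∣ d' then sieveWeight w d' / d' else 0)) := by
        refine Finset.sum_congr rfl fun d hd => Finset.sum_congr rfl fun d' hd' => ?_
        obtain ⟨hd1, hdw⟩ := mem_Icc.1 hd
        obtain ⟨hd1', hdw'⟩ := mem_Icc.1 hd'
        have hd0 : (d : ℝ) ≠ 0 := by exact_mod_cast (Nat.one_le_iff_ne_zero.1 hd1)
        have hd0' : (d' : ℝ) ≠ 0 := by exact_mod_cast (Nat.one_le_iff_ne_zero.1 hd1')
        have hg : ((Nat.gcd d d' : ℕ) : ℝ) = ∑ e ∈ Icc 1 w,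
            if e ∣ d ∧ e ∣ d' then (Nat.totient e : ℝ) else 0 := by
          rw [← Finset.sum_filter]
          conv_lhs => rw [← Nat.sum_totient (Nat.gcd d d')]
          push_cast
          refine Finset.sum_congr ?_ fun _ _ => rfl
          ext e
          simp only [Nat.mem_divisors, mem_filter, mem_Icc, Nat.dvd_gcd_iff]
          constructor
          · rintro ⟨h, _⟩
            exact ⟨⟨Nat.pos_of_dvd_of_pos h.1 hd1, (Nat.le_of_dvd hd1 h.1).trans hdw⟩, h⟩
          · rintro ⟨_, h⟩
            exact ⟨h, (Nat.gcd_pos_of_pos_left _ hd1).ne'⟩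
        have hlcm : ((Nat.lcm d d' : ℕ) : ℝ) ≠ 0 := by
          exact_mod_cast (Nat.lcm_pos hd1 hd1').ne'
        have hgl : ((Nat.gcd d d' : ℕ) : ℝ) * (Nat.lcm d d' : ℕ) = d * d' := by
          exact_mod_cast Nat.gcd_mul_lcm d d'
        calc _ = ((Nat.gcd d d' : ℕ) : ℝ) * (sieveWeight w d / d * (sieveWeight w d' / d')) := by
              rw [div_mul_div_comm, ← hgl]
              have : ((Nat.gcd d d' : ℕ) : ℝ) ≠ 0 := by
                exact_mod_cast (Nat.gcd_pos_of_pos_left _ hd1).ne'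
              field_simp
          _ = _ := by
              rw [hg, Finset.sum_mul]
              refine Finset.sum_congr rfl fun e _ => ?_
              by_cases h1 : e ∣ d <;> by_cases h2 : e ∣ d' <;> simp [h1, h2]
    _ = ∑ e ∈ Icc 1 w, (Nat.totient e : ℝ) * sieveVar w e ^ 2 := by
        rw [Finset.sum_congr rfl fun d _ => Finset.sum_comm, Finset.sum_comm]
        refine Finset.sum_congr rfl fun e he => ?_
        simp only [← Finset.mul_sum]
        rw [← Finset.sum_mul, sum_sieveWeight_div he, sq]
    _ ≤ ∑ e ∈ Icc 1 w, |sieveVar w e| / sieveSum w := by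
        refine Finset.sum_le_sum fun e he => ?_
        have he0 : (0 : ℝ) < e := by exact_mod_cast (mem_Icc.1 he).1
        have h1 : (Nat.totient e : ℝ) ≤ e := by exact_mod_cast Nat.totient_le e
        have h2 : |sieveVar w e| ≤ 1 / (sieveSum w * e) := by
          rw [sieveVar, abs_div, abs_of_pos (show 0 < sieveSum w * e by positivity)]
          gcongr
          exact_mod_cast ArithmeticFunction.abs_moebius_le_one (n := e)
        calc (Nat.totient e : ℝ) * sieveVar w e ^ 2
            = (Nat.totient e : ℝ) * (|sieveVar w e| * |sieveVar w e|) := by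
              rw [← sq, sq_abs]
          _ ≤ e * (|sieveVar w e| * (1 / (sieveSum w * e))) := by gcongr
          _ = _ := by field_simp
    _ ≤ _ := by
        rw [← Finset.sum_div]
        gcongr
        exact sum_abs_sieveVar_le hG

theorem abs_card_multiples_sub_le {A B l : ℕ} (hAB : A ≤ B) (hl : 0 < l) :
    |(((Ioc A B).filter (l ∣ ·)).card : ℝ) - ((B : ℝ) - A) / l| ≤ 1 := by
  have h1 : ((Ioc A B).filter (l ∣ ·)).card + A / l = B / l := by
    rw [← Nat.Ioc_filter_dvd_card_eq_div A l, ← Nat.Ioc_filter_dvd_card_eq_div B l, add_comm,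
      ← card_union_of_disjoint, ← filter_union, Ioc_union_Ioc_eq_Ioc (Nat.zero_le A) hAB]
    exact disjoint_filter_filter (Ioc_disjoint_Ioc_of_le le_rfl)
  have h2 : (((Ioc A B).filter (l ∣ ·)).card : ℝ) + ((A / l : ℕ) : ℝ) = ((B / l : ℕ) : ℝ) := by
    exact_mod_cast h1
  have hl0 : (0 : ℝ) < l := by exact_mod_cast hl
  have h3 : ∀ n : ℕ, ((n / l : ℕ) : ℝ) ≤ n / l ∧ (n : ℝ) / l < ((n / l : ℕ) : ℝ) + 1 := by
    intro n
    refine ⟨Nat.cast_div_le, ?_⟩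
    rw [← Nat.floor_div_eq_div (K := ℝ)]
    exact Nat.lt_floor_add_one _
  obtain ⟨ha1, ha2⟩ := h3 A
  obtain ⟨hb1, hb2⟩ := h3 B
  rw [sub_div, abs_le]
  constructor <;> linarith

open Classical in
/-- Selberg's sieve: the integers in an interval without prime factors up to `w`. -/
theorem card_rough_le {A B w : ℕ} (hAB : A ≤ B) (hw : 2 ≤ w) :
    (((Ioc A B).filter fun k => ∀ p : ℕ, p.Prime → p ≤ w → ¬ p ∣ k).card : ℝ) ≤
      ((B : ℝ) - A) * (2 / Real.log w) + (w : ℝ) ^ 4 := by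
  have hlog : 0 < Real.log w := Real.log_pos (by exact_mod_cast hw)
  have hG1 := log_le_sieveSum w
  have hG : 0 < sieveSum w := by linarith
  have hBA : (0 : ℝ) ≤ (B : ℝ) - A := sub_nonneg.2 (by exact_mod_cast hAB)
  calc _ ≤ ∑ k ∈ Ioc A B, (∑ d ∈ Icc 1 w, if d ∣ k then sieveWeight w d else 0) ^ 2 := by
        rw [Finset.card_filter]
        push_cast
        refine Finset.sum_le_sum fun k _ => ?_
        split_ifs with h
        · rw [Finset.sum_eq_single 1]
          · simp [sieveWeight_one hG]
          · intro d hd hd1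
            refine if_neg fun hdk => ?_
            have hle := Nat.minFac_le (mem_Icc.1 hd).1
            exact h _ (Nat.minFac_prime hd1) (hle.trans (mem_Icc.1 hd).2)
              ((Nat.minFac_dvd d).trans hdk)
          · intro h1
            exact absurd (mem_Icc.2 ⟨le_rfl, by omega⟩) h1
        · positivity
    _ = ∑ d ∈ Icc 1 w, ∑ d' ∈ Icc 1 w, sieveWeight w d * sieveWeight w d' *
          (((Ioc A B).filter (Nat.lcm d d' ∣ ·)).card : ℝ) := by
        simp only [sq, Finset.sum_mul_sum]
        rw [Finset.sum_comm]
        refine Finset.sum_congr rfl fun d _ => ?_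
        rw [Finset.sum_comm]
        refine Finset.sum_congr rfl fun d' _ => ?_
        rw [Finset.card_filter]
        push_cast
        rw [Finset.mul_sum]
        refine Finset.sum_congr rfl fun k _ => ?_
        by_cases h1 : d ∣ k <;> by_cases h2 : d' ∣ k <;> simp [h1, h2, Nat.lcm_dvd_iff]
    _ ≤ ∑ d ∈ Icc 1 w, ∑ d' ∈ Icc 1 w, (((B : ℝ) - A) *
          (sieveWeight w d * sieveWeight w d' / (Nat.lcm d d' : ℝ)) + (d : ℝ) * d') := by
        refine Finset.sum_le_sum fun d hd => Finset.sum_le_sum fun d' hd' => ?_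
        have h1 := abs_card_multiples_sub_le hAB
          (Nat.lcm_pos (mem_Icc.1 hd).1 (mem_Icc.1 hd').1)
        set c := (((Ioc A B).filter (Nat.lcm d d' ∣ ·)).card : ℝ)
        have h2 := abs_sieveWeight_le hG d
        have h3 := abs_sieveWeight_le hG d'
        calc _ = ((B : ℝ) - A) * (sieveWeight w d * sieveWeight w d' / (Nat.lcm d d' : ℝ)) +
              sieveWeight w d * sieveWeight w d' *
                (c - ((B : ℝ) - A) / (Nat.lcm d d' : ℝ)) := by ring
          _ ≤ _ := by
              refine add_le_add le_rfl ((le_abs_self _).trans ?_)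
              rw [abs_mul, abs_mul]
              calc _ ≤ (d : ℝ) * d' * 1 := by gcongr
                _ = _ := mul_one _
    _ = ((B : ℝ) - A) * ∑ d ∈ Icc 1 w, ∑ d' ∈ Icc 1 w,
          sieveWeight w d * sieveWeight w d' / (Nat.lcm d d' : ℝ) +
          (∑ d ∈ Icc 1 w, (d : ℝ)) * ∑ d ∈ Icc 1 w, (d : ℝ) := by
        rw [Finset.sum_mul_sum]
        simp only [Finset.sum_add_distrib, Finset.mul_sum]
    _ ≤ ((B : ℝ) - A) * (1 / sieveSum w) + (w : ℝ) ^ 2 * (w : ℝ) ^ 2 := by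
        have h1 : ∑ d ∈ Icc 1 w, (d : ℝ) ≤ (w : ℝ) ^ 2 := by
          calc ∑ d ∈ Icc 1 w, (d : ℝ) ≤ ∑ _d ∈ Icc 1 w, (w : ℝ) :=
                Finset.sum_le_sum fun d hd => by exact_mod_cast (mem_Icc.1 hd).2
            _ = _ := by simp [sq]
        have h0 : 0 ≤ ∑ d ∈ Icc 1 w, (d : ℝ) := Finset.sum_nonneg fun d _ => by positivity
        gcongr
        exact sum_sieveWeight_lcm_le hG
    _ ≤ _ := by
        have : 1 / sieveSum w ≤ 2 / Real.log w := by
          rw [div_le_div_iff₀ hG hlog]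
          linarith
        have h2 : (w : ℝ) ^ 2 * (w : ℝ) ^ 2 = (w : ℝ) ^ 4 := by ring
        rw [h2]
        gcongr

theorem sum_range_add_two_mul_pow_le {ρ : ℝ} (h0 : 0 ≤ ρ) (h1 : ρ ≤ 3 / 5) (n : ℕ) :
    ∑ k ∈ range n, ((k : ℝ) + 2) * ρ ^ k ≤ 9 := by
  have h : ∑ k ∈ range n, ((k : ℝ) + 2) * ρ ^ k + (5 / 2 * n + 35 / 4) * ρ ^ n ≤ 9 := by
    induction n with
    | zero => norm_num
    | succ n ih =>
      rw [Finset.sum_range_succ]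
      refine le_trans ?_ ih
      have h2 : (5 / 2 * ((n + 1 : ℕ) : ℝ) + 35 / 4) * ρ ^ (n + 1) ≤
          (5 / 2 * ((n + 1 : ℕ) : ℝ) + 35 / 4) * (ρ ^ n * (3 / 5)) := by
        rw [pow_succ]; gcongr
      push_cast at h2 ⊢
      linarith
  have : 0 ≤ (5 / 2 * (n : ℝ) + 35 / 4) * ρ ^ n := by positivity
  linarith

theorem pow_factorization_eq {p a N : ℕ} (hp : p.Prime) (ha : a ∈ Icc 1 N) (r : ℝ) :
    r ^ a.factorization p =
      1 + (r - 1) * ∑ k ∈ range N, if p ^ (k + 1) ∣ a then r ^ k else 0 := by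
  obtain ⟨ha1, haN⟩ := mem_Icc.1 ha
  have h1 : (range N).filter (fun k => p ^ (k + 1) ∣ a) = range (a.factorization p) := by
    ext k
    rw [mem_filter, mem_range, mem_range, hp.pow_dvd_iff_le_factorization (by omega)]
    have := Nat.factorization_lt p (n := a) (by omega)
    omega
  rw [← Finset.sum_filter, h1, mul_comm, geom_sum_mul]
  ring

theorem sum_mul_pow_factorization_le {p N : ℕ} (hp : p.Prime) {g : ℕ → ℝ} (hg : ∀ a, 0 ≤ g a)
    (hgp : ∀ k b : ℕ, b ≠ 0 → g (p ^ k * b) ≤ (k + 1) / (p : ℝ) ^ k * g b) {r : ℝ} (hr : 1 ≤ r)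
    (hrp : r / p ≤ 3 / 5) :
    ∑ a ∈ Icc 1 N, g a * r ^ a.factorization p ≤
      (1 + 9 * (r - 1) / p) * ∑ a ∈ Icc 1 N, g a := by
  have hp0 : (0 : ℝ) < p := by exact_mod_cast hp.pos
  have hmult : ∀ k : ℕ, ∑ a ∈ Icc 1 N with p ^ (k + 1) ∣ a, g a ≤
      (k + 2) / (p : ℝ) ^ (k + 1) * ∑ b ∈ Icc 1 N, g b := by
    intro k
    rw [Finset.mul_sum]
    refine sum_le_sum_of_cover (fun b => p ^ (k + 1) * b)
      (fun b _ => mul_nonneg (by positivity) (hg b)) fun a ha => ?_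
    obtain ⟨ha1, b, rfl⟩ := mem_filter.1 ha
    obtain ⟨ha2, ha3⟩ := mem_Icc.1 ha1
    have hb : 0 < b := Nat.pos_of_ne_zero fun h => by simp [h] at ha2
    refine ⟨b, mem_Icc.2 ⟨hb, (Nat.le_mul_of_pos_left b (pow_pos hp.pos _)).trans ha3⟩, rfl, ?_⟩
    have := hgp (k + 1) b hb.ne'
    push_cast at this
    convert this using 3
    ring
  calc ∑ a ∈ Icc 1 N, g a * r ^ a.factorization p
      = ∑ a ∈ Icc 1 N, g a +
        (r - 1) * ∑ k ∈ range N, r ^ k * ∑ a ∈ Icc 1 N with p ^ (k + 1) ∣ a, g a := by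
        have h1 : ∀ k : ℕ, r ^ k * ∑ a ∈ Icc 1 N with p ^ (k + 1) ∣ a, g a =
            ∑ a ∈ Icc 1 N, g a * if p ^ (k + 1) ∣ a then r ^ k else 0 := by
          intro k
          rw [Finset.sum_filter, Finset.mul_sum]
          refine Finset.sum_congr rfl fun a _ => ?_
          split_ifs <;> ring
        simp only [h1]
        rw [Finset.sum_comm, Finset.mul_sum, ← Finset.sum_add_distrib]
        refine Finset.sum_congr rfl fun a ha => ?_
        rw [pow_factorization_eq hp ha, ← Finset.mul_sum]
        ring
    _ ≤ ∑ a ∈ Icc 1 N, g a + (r - 1) * ∑ k ∈ range N,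
          r ^ k * ((k + 2) / (p : ℝ) ^ (k + 1) * ∑ b ∈ Icc 1 N, g b) := by
        have : 0 ≤ r - 1 := by linarith
        gcongr with k _
        exact hmult k
    _ = ∑ a ∈ Icc 1 N, g a + (r - 1) / p * (∑ a ∈ Icc 1 N, g a) *
          ∑ k ∈ range N, ((k : ℝ) + 2) * (r / p) ^ k := by
        rw [Finset.mul_sum, Finset.mul_sum]
        congr 1
        refine Finset.sum_congr rfl fun k _ => ?_
        rw [div_pow, pow_succ]
        field_simp
    _ ≤ ∑ a ∈ Icc 1 N, g a + (r - 1) / p * (∑ a ∈ Icc 1 N, g a) * 9 := by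
        have h2 : 0 ≤ (r - 1) / p * ∑ a ∈ Icc 1 N, g a :=
          mul_nonneg (div_nonneg (by linarith) hp0.le) (Finset.sum_nonneg fun a _ => hg a)
        have h3 := sum_range_add_two_mul_pow_le (show 0 ≤ r / p by positivity) hrp N
        gcongr
    _ = _ := by ring

theorem factorization_prime_pow_mul_of_ne {p q : ℕ} (hp : p.Prime) (hpq : q ≠ p) (k : ℕ) {b : ℕ}
    (hb : b ≠ 0) : (p ^ k * b).factorization q = b.factorization q := by
  rw [Nat.factorization_mul (pow_ne_zero _ hp.ne_zero) hb, Finsupp.add_apply,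
    hp.factorization_pow, Finsupp.single_eq_of_ne hpq, zero_add]

theorem sum_mul_prod_pow_factorization_le {N : ℕ} {f : ℕ → ℝ} (hf : ∀ a, 0 ≤ f a)
    (hfp : ∀ p k b : ℕ, p.Prime → b ≠ 0 → f (p ^ k * b) ≤ (k + 1) * f b) {r : ℕ → ℝ} (S : Finset ℕ)
    (hS : ∀ p ∈ S, p.Prime ∧ 1 ≤ r p ∧ r p / p ≤ 3 / 5) :
    ∑ a ∈ Icc 1 N, f a / a * ∏ p ∈ S, r p ^ a.factorization p ≤
      Real.exp (9 * ∑ p ∈ S, (r p - 1) / p) * ∑ a ∈ Icc 1 N, f a / a := by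
  classical
  induction S using Finset.induction_on with
  | empty => simp
  | insert p S hpS ih =>
    obtain ⟨hp, hr, hrp⟩ := hS p (mem_insert_self p S)
    have hS' : ∀ q ∈ S, q.Prime ∧ 1 ≤ r q ∧ r q / q ≤ 3 / 5 := fun q hq =>
      hS q (mem_insert_of_mem hq)
    have ih' := ih hS'
    have hr0 : ∀ a : ℕ, 0 ≤ ∏ q ∈ S, r q ^ a.factorization q := fun a =>
      Finset.prod_nonneg fun q hq => pow_nonneg (zero_le_one.trans (hS' q hq).2.1) _
    have hp0 : (0 : ℝ) < p := by exact_mod_cast hp.pos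
    have hstep := sum_mul_pow_factorization_le (N := N) hp
      (g := fun a => f a / a * ∏ q ∈ S, r q ^ a.factorization q)
      (fun a => mul_nonneg (div_nonneg (hf a) (Nat.cast_nonneg a)) (hr0 a))
      (fun k b hb => by
        have h1 : ∏ q ∈ S, r q ^ (p ^ k * b).factorization q =
            ∏ q ∈ S, r q ^ b.factorization q :=
          Finset.prod_congr rfl fun q hq => by
            rw [factorization_prime_pow_mul_of_ne hp (fun h => hpS (h ▸ hq)) k hb]
        rw [h1]
        calc _ ≤ (k + 1) * f b / ((p ^ k * b : ℕ) : ℝ) * ∏ q ∈ S, r q ^ b.factorization q := by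
              have := hr0 b
              have h2 := hfp p k b hp hb
              gcongr
          _ = _ := by push_cast; rw [mul_div_mul_comm]; ring) hr hrp
    calc _ = ∑ a ∈ Icc 1 N,
          f a / a * (∏ q ∈ S, r q ^ a.factorization q) * r p ^ a.factorization p := by
          refine Finset.sum_congr rfl fun a _ => ?_
          rw [Finset.prod_insert hpS]
          ring
      _ ≤ _ := hstep
      _ ≤ Real.exp (9 * (r p - 1) / p) * (Real.exp (9 * ∑ q ∈ S, (r q - 1) / q) *
            ∑ a ∈ Icc 1 N, f a / a) := by
          have h3 : 1 + 9 * (r p - 1) / p ≤ Real.exp (9 * (r p - 1) / p) := by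
            rw [add_comm]; exact Real.add_one_le_exp _
          exact mul_le_mul h3 ih' (Finset.sum_nonneg fun a _ =>
            mul_nonneg (div_nonneg (hf a) (Nat.cast_nonneg a)) (hr0 a)) (Real.exp_nonneg _)
      _ = _ := by
          rw [← mul_assoc, ← Real.exp_add, Finset.sum_insert hpS]
          congr 2
          ring

theorem rpow_quarter_div_le {p : ℝ} (hp : 2 ≤ p) {δ : ℝ} (hδ : δ ≤ 1 / 4) :
    p ^ δ / p ≤ 3 / 5 := by
  have hp0 : 0 < p := by linarith
  calc p ^ δ / p = p ^ (δ - 1) := by rw [Real.rpow_sub_one hp0.ne']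
    _ ≤ p ^ (-(3 / 4) : ℝ) := Real.rpow_le_rpow_of_exponent_le (by linarith) (by linarith)
    _ ≤ 2 ^ (-(3 / 4) : ℝ) := Real.rpow_le_rpow_of_nonpos (by norm_num) hp (by norm_num)
    _ ≤ 3 / 5 := by
        refine le_of_pow_le_pow_left₀ (n := 4) (by norm_num) (by norm_num) ?_
        rw [← Real.rpow_natCast, ← Real.rpow_mul (by norm_num)]
        norm_num

theorem exp_sub_one_le (u : ℝ) : Real.exp u - 1 ≤ u * Real.exp u := by
  have h1 := Real.add_one_le_exp (-u)
  have h2 : Real.exp (-u) * Real.exp u = 1 := by rw [← Real.exp_add]; simp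
  nlinarith [Real.exp_pos u]

theorem sum_rpow_sub_one_div_le {Q δ κ : ℝ} (hQ : 1 ≤ Q) (hδ : 0 ≤ δ) (hδ1 : δ ≤ 1 / 4)
    (hκ : δ * Real.log Q = κ) :
    ∑ p ∈ primesIoc 0 ⌊Q⌋₊, ((p : ℝ) ^ δ - 1) / p ≤ Real.exp κ * (κ + 7 / 20) := by
  have hN : 1 ≤ ⌊Q⌋₊ := Nat.le_floor (by simpa using hQ)
  have hNQ : (⌊Q⌋₊ : ℝ) ≤ Q := Nat.floor_le (by linarith)
  calc ∑ p ∈ primesIoc 0 ⌊Q⌋₊, ((p : ℝ) ^ δ - 1) / p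
      ≤ ∑ p ∈ primesIoc 0 ⌊Q⌋₊, (δ * Real.exp κ) * (Real.log p / p) := by
        refine Finset.sum_le_sum fun p hp => ?_
        obtain ⟨⟨_, hpN⟩, hpp⟩ := mem_primesIoc.1 hp
        have hp0 : (0 : ℝ) < p := by exact_mod_cast hpp.pos
        have hp1 : (1 : ℝ) ≤ p := by exact_mod_cast hpp.one_le
        have hpQ : (p : ℝ) ≤ Q := le_trans (by exact_mod_cast hpN) hNQ
        have hlog : Real.log p ≤ Real.log Q := Real.log_le_log hp0 hpQ
        have hlog0 : 0 ≤ Real.log p := Real.log_nonneg hp1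
        have h1 := exp_sub_one_le (Real.log p * δ)
        rw [Real.rpow_def_of_pos hp0]
        calc _ ≤ (Real.log p * δ * Real.exp (Real.log p * δ)) / p := by gcongr
          _ ≤ (Real.log p * δ * Real.exp κ) / p := by
              gcongr
              rw [← hκ, mul_comm]
              gcongr
          _ = _ := by ring
    _ = δ * Real.exp κ * ∑ p ∈ primesIoc 0 ⌊Q⌋₊, Real.log p / p := by rw [Finset.mul_sum]
    _ ≤ δ * Real.exp κ * (Real.log Q + 1.4) := by
        have h1 := sum_log_div_le ⌊Q⌋₊
        have h2 := log_four_le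
        have h3 : Real.log ⌊Q⌋₊ ≤ Real.log Q :=
          Real.log_le_log (by exact_mod_cast hN) hNQ
        gcongr
        linarith
    _ = Real.exp κ * (κ + 1.4 * δ) := by rw [← hκ]; ring
    _ ≤ _ := by
        gcongr
        linarith

theorem prod_rpow_factorization {S : Finset ℕ} {a : ℕ} (ha : a ≠ 0) (hS : a.primeFactors ⊆ S)
    (δ : ℝ) : ∏ p ∈ S, ((p : ℝ) ^ δ) ^ a.factorization p = (a : ℝ) ^ δ := by
  have h1 : ∏ p ∈ S, p ^ a.factorization p = a := by
    conv_rhs => rw [← Nat.prod_factorization_pow_eq_self ha]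
    rw [Finsupp.prod_of_support_subset _ (by simpa using hS) _ (fun _ _ => pow_zero _)]
  calc _ = ∏ p ∈ S, ((p : ℝ) ^ a.factorization p) ^ δ := by
        refine Finset.prod_congr rfl fun p _ => ?_
        rw [← Real.rpow_natCast, ← Real.rpow_natCast, ← Real.rpow_mul (Nat.cast_nonneg p),
          ← Real.rpow_mul (Nat.cast_nonneg p), mul_comm]
    _ = (∏ p ∈ S, (p : ℝ) ^ a.factorization p) ^ δ :=
        Real.finsetProd_rpow _ _ (fun p _ => by positivity) _
    _ = _ := by
        congr 1
        exact_mod_cast congrArg (fun m : ℕ => (m : ℝ)) h1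

/-- Rankin's bound for the smooth integers beyond `M`. -/
theorem sum_smooth_div_le {f : ℕ → ℝ} (hf : ∀ a, 0 ≤ f a)
    (hfp : ∀ p k b : ℕ, p.Prime → b ≠ 0 → f (p ^ k * b) ≤ (k + 1) * f b) {N : ℕ} {T : Finset ℕ}
    {Q δ κ M : ℝ} (hM : 0 < M) (hQ : 1 ≤ Q) (hδ : 0 ≤ δ) (hδ1 : δ ≤ 1 / 4)
    (hκ : δ * Real.log Q = κ)
    (hT : ∀ a ∈ T, a ∈ Icc 1 N ∧ M ≤ (a : ℝ) ∧ ∀ p : ℕ, p.Prime → p ∣ a → (p : ℝ) ≤ Q) :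
    ∑ a ∈ T, f a / a ≤
      M ^ (-δ) * (Real.exp (9 * (Real.exp κ * (κ + 7 / 20))) * ∑ a ∈ Icc 1 N, f a / a) := by
  have hprod0 : ∀ a : ℕ, 0 ≤ ∏ p ∈ primesIoc 0 ⌊Q⌋₊, ((p : ℝ) ^ δ) ^ a.factorization p := fun a =>
    Finset.prod_nonneg fun p _ => by positivity
  have hfa : ∀ a : ℕ, 0 ≤ f a / a := fun a => div_nonneg (hf a) (Nat.cast_nonneg a)
  calc ∑ a ∈ T, f a / a ≤ ∑ a ∈ T, M ^ (-δ) *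
        (f a / a * ∏ p ∈ primesIoc 0 ⌊Q⌋₊, ((p : ℝ) ^ δ) ^ a.factorization p) := by
        refine Finset.sum_le_sum fun a ha => ?_
        obtain ⟨h1, h2, h3⟩ := hT a ha
        have ha0 : a ≠ 0 := by have := (mem_Icc.1 h1).1; omega
        rw [prod_rpow_factorization ha0 (fun p hp => ?_)]
        · have h4 : 1 ≤ M ^ (-δ) * (a : ℝ) ^ δ := by
            calc 1 = M ^ (-δ) * M ^ δ := by rw [← Real.rpow_add hM]; simp
              _ ≤ _ := by gcongr
          calc f a / a ≤ (f a / a) * (M ^ (-δ) * (a : ℝ) ^ δ) :=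
                le_mul_of_one_le_right (hfa a) h4
            _ = _ := by ring
        · have hpp := Nat.prime_of_mem_primeFactors hp
          exact mem_primesIoc.2 ⟨⟨hpp.pos, Nat.le_floor
            (h3 p hpp (Nat.dvd_of_mem_primeFactors hp))⟩, hpp⟩
    _ ≤ ∑ a ∈ Icc 1 N, M ^ (-δ) *
        (f a / a * ∏ p ∈ primesIoc 0 ⌊Q⌋₊, ((p : ℝ) ^ δ) ^ a.factorization p) :=
        Finset.sum_le_sum_of_subset_of_nonneg (fun a ha => (hT a ha).1) fun a _ _ =>
          mul_nonneg (by positivity) (mul_nonneg (hfa a) (hprod0 a))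
    _ ≤ _ := by
        rw [← Finset.mul_sum]
        gcongr
        refine (sum_mul_prod_pow_factorization_le hf hfp (r := fun p => (p : ℝ) ^ δ) _
          fun p hp => ?_).trans ?_
        · obtain ⟨_, hpp⟩ := mem_primesIoc.1 hp
          exact ⟨hpp, Real.one_le_rpow (by exact_mod_cast hpp.one_le) hδ,
            rpow_quarter_div_le (by exact_mod_cast hpp.two_le) hδ1⟩
        · have h5 := sum_rpow_sub_one_div_le hQ hδ hδ1 hκ
          have h6 : 0 ≤ ∑ a ∈ Icc 1 N, f a / a := Finset.sum_nonneg fun a _ => hfa a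
          gcongr

theorem exists_isHead {n : ℕ} {Y : ℝ} (hY : 1 ≤ Y) (hn : Y < n) :
    ∃ a k : ℕ, a * k = n ∧ (a : ℝ) ≤ Y ∧ k ≠ 1 ∧ Y < a * k.minFac ∧
      ∀ p : ℕ, p.Prime → p ∣ a → p ≤ k.minFac := by
  classical
  have hn0 : n ≠ 0 := by
    rintro rfl
    simp only [Nat.cast_zero] at hn
    linarith
  set s := n.divisors.filter fun a : ℕ => (a : ℝ) ≤ Y ∧
    ∀ p q : ℕ, p.Prime → p ∣ a → q.Prime → q ∣ n / a → p ≤ q with hs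
  have h1 : 1 ∈ s := by
    refine mem_filter.2 ⟨Nat.one_mem_divisors.2 hn0, by simpa using hY, fun p q hp hp1 => ?_⟩
    exact absurd (Nat.dvd_one.1 hp1) hp.ne_one
  obtain ⟨a, ha, hmax⟩ := s.exists_max_image id ⟨1, h1⟩
  obtain ⟨hadvd, haY, hpq⟩ := mem_filter.1 ha
  obtain ⟨k, rfl⟩ := Nat.dvd_of_mem_divisors hadvd
  obtain ⟨ha0, hk0⟩ := mul_ne_zero_iff.1 hn0
  rw [Nat.mul_div_cancel_left k (Nat.pos_of_ne_zero ha0)] at hpq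
  have hk1 : k ≠ 1 := by
    rintro rfl
    rw [mul_one] at hn
    linarith
  have hq := Nat.minFac_prime hk1
  refine ⟨a, k, rfl, haY, hk1, ?_, fun p hp hpa => hpq p _ hp hpa hq (Nat.minFac_dvd k)⟩
  by_contra hle
  rw [not_lt] at hle
  obtain ⟨c, hc⟩ := Nat.minFac_dvd k
  have hmem : a * k.minFac ∈ s := by
    refine mem_filter.2 ⟨Nat.mem_divisors.2 ⟨Nat.mul_dvd_mul_left a (Nat.minFac_dvd k), hn0⟩,
      by push_cast; exact hle, fun p q hp hpd hq' hqd => ?_⟩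
    have hdiv : a * k / (a * k.minFac) = c := by
      refine Nat.div_eq_of_eq_mul_right (Nat.mul_pos (Nat.pos_of_ne_zero ha0) hq.pos) ?_
      rw [mul_assoc, ← hc]
    rw [hdiv] at hqd
    have hqk : q ∣ k := hqd.trans ⟨k.minFac, by rw [mul_comm, ← hc]⟩
    rcases (Nat.Prime.dvd_mul hp).1 hpd with h | h
    · exact hpq p q hp h hq' hqk
    · rw [(Nat.prime_dvd_prime_iff_eq hp hq).1 h]
      exact Nat.minFac_le_of_dvd hq'.two_le hqk
  have hlt := hmax _ hmem
  simp only [id] at hlt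
  have : a * 2 ≤ a * k.minFac := Nat.mul_le_mul_left a hq.two_le
  omega

theorem card_divisors_le_exp {E : ℝ} (hE : 1 < E) {k : ℕ} (hk : k ≠ 0)
    (hkE : ∀ p : ℕ, p.Prime → p ∣ k → E < p) :
    (k.divisors.card : ℝ) ≤ Real.exp (Real.log 2 * (Real.log k / Real.log E)) := by
  have hlogE : 0 < Real.log E := Real.log_pos hE
  induction k using induction_on_primes with
  | zero => exact absurd rfl hk
  | one => simp
  | prime_mul p m hp ih =>
    have hm : m ≠ 0 := (mul_ne_zero_iff.1 hk).2
    have ih' := ih hm fun q hq hqm => hkE q hq (hqm.mul_left p)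
    have hpE := hkE p hp (dvd_mul_right p m)
    have hp0 : (p : ℝ) ≠ 0 := by exact_mod_cast hp.ne_zero
    have hm0 : (m : ℝ) ≠ 0 := by exact_mod_cast hm
    have h1 : ((p * m).divisors.card : ℝ) ≤ 2 * m.divisors.card := by
      exact_mod_cast card_divisors_prime_mul_le hp m
    have h2 : (2 : ℝ) ≤ Real.exp (Real.log 2 * (Real.log p / Real.log E)) := by
      have h3 : 1 ≤ Real.log p / Real.log E := by
        rw [one_le_div hlogE]
        exact Real.log_le_log (by linarith) hpE.le
      calc (2 : ℝ) = Real.exp (Real.log 2 * 1) := by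
            rw [mul_one, Real.exp_log (by norm_num)]
        _ ≤ _ := by gcongr
    calc ((p * m).divisors.card : ℝ) ≤ 2 * m.divisors.card := h1
      _ ≤ Real.exp (Real.log 2 * (Real.log p / Real.log E)) *
          Real.exp (Real.log 2 * (Real.log m / Real.log E)) := by gcongr
      _ = _ := by
          rw [← Real.exp_add, Nat.cast_mul, Real.log_mul hp0 hm0]
          congr 1
          ring

open Classical in
/-- The cofactors `k` with `x - y < a k ≤ x` all of whose prime factors exceed `E`. -/
noncomputable def roughCofactors (x y E : ℝ) (a : ℕ) : Finset ℕ :=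
  (Icc 1 ⌊x⌋₊).filter fun k : ℕ => x - y < a * k ∧ (a : ℝ) * k ≤ x ∧
    ∀ p : ℕ, p.Prime → p ∣ k → E < p

theorem card_roughCofactors_le {x y V E : ℝ} (hyx : y ≤ x) (hyV : y = V ^ 100)
    (hE : 4 ≤ E) (hEV : E ≤ V) {a : ℕ} (ha : 1 ≤ a) (haV : (a : ℝ) ≤ V ^ 25) :
    ((roughCofactors x y E a).card : ℝ) ≤ 9 * y / Real.log E * (1 / a) := by
  classical
  have ha0 : (0 : ℝ) < a := by exact_mod_cast ha
  have hV4 : 4 ≤ V := hE.trans hEV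
  have hy0 : 0 < y := by rw [hyV]; positivity
  have hlogE : 0 < Real.log E := Real.log_pos (by linarith)
  have hw2 : 2 ≤ ⌊E⌋₊ := Nat.le_floor (by push_cast; linarith)
  have hwE : (⌊E⌋₊ : ℝ) ≤ E := Nat.floor_le (by linarith)
  have hlogw : Real.log E / 2 ≤ Real.log ⌊E⌋₊ := by
    have h1 : E < ⌊E⌋₊ + 1 := Nat.lt_floor_add_one E
    have h2 : (2 : ℝ) ≤ ⌊E⌋₊ := by exact_mod_cast hw2
    have h3 : E ≤ (⌊E⌋₊ : ℝ) ^ 2 := by nlinarith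
    have h4 := Real.log_le_log (by linarith) h3
    rw [Real.log_pow] at h4
    push_cast at h4
    linarith
  have hsub : roughCofactors x y E a ⊆ (Ioc ⌊(x - y) / a⌋₊ ⌊x / a⌋₊).filter
      fun k => ∀ p : ℕ, p.Prime → p ≤ ⌊E⌋₊ → ¬ p ∣ k := by
    intro k hk
    obtain ⟨hk1, hk2, hk3, hk4⟩ := mem_filter.1 hk
    refine mem_filter.2 ⟨mem_Ioc.2 ⟨?_, Nat.le_floor ?_⟩, fun p hp hpE hpk => ?_⟩
    · rw [Nat.floor_lt (div_nonneg (by linarith) ha0.le), div_lt_iff₀ ha0]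
      linarith
    · rw [le_div_iff₀ ha0]; linarith
    · have h1 := hk4 p hp hpk
      have h2 : (p : ℝ) ≤ ⌊E⌋₊ := by exact_mod_cast hpE
      linarith
  have hAB : ⌊(x - y) / a⌋₊ ≤ ⌊x / a⌋₊ := by
    apply Nat.floor_mono
    gcongr
    linarith
  have hlen : (⌊x / a⌋₊ : ℝ) - ⌊(x - y) / a⌋₊ ≤ y / a + 1 := by
    have h1 : (⌊x / a⌋₊ : ℝ) ≤ x / a := Nat.floor_le (div_nonneg (by linarith) ha0.le)
    have h2 : (x - y) / a < ⌊(x - y) / a⌋₊ + 1 := Nat.lt_floor_add_one _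
    have h3 : (x - y) / a = x / a - y / a := sub_div _ _ _
    linarith
  have hay : (a : ℝ) ≤ y := by
    refine haV.trans ?_
    rw [hyV]
    exact pow_le_pow_right₀ (by linarith) (by norm_num)
  have h1 : 1 ≤ y / a := by rwa [one_le_div ha0]
  have hw4 : (⌊E⌋₊ : ℝ) ^ 4 ≤ y / Real.log E * (1 / a) := by
    have h2 : (⌊E⌋₊ : ℝ) ^ 4 ≤ V ^ 4 := by gcongr; linarith
    have h3 : Real.log E ≤ V := (Real.log_le_self (by linarith)).trans hEV
    rw [div_mul_div_comm, mul_one, le_div_iff₀ (by positivity)]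
    calc (⌊E⌋₊ : ℝ) ^ 4 * (Real.log E * a) ≤ V ^ 4 * (V * V ^ 25) := by gcongr
      _ = V ^ 30 := by ring
      _ ≤ y := by rw [hyV]; exact pow_le_pow_right₀ (by linarith) (by norm_num)
  have hcard : ((roughCofactors x y E a).card : ℝ) ≤ _ :=
    (Nat.cast_le.2 (card_le_card hsub)).trans (card_rough_le hAB hw2)
  have hL : 2 / Real.log ⌊E⌋₊ ≤ 4 / Real.log E := by
    rw [div_le_div_iff₀ (by linarith) hlogE]
    linarith
  calc _ ≤ _ := hcard
    _ ≤ (2 * (y / a)) * (4 / Real.log E) + y / Real.log E * (1 / a) := by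
        refine add_le_add (mul_le_mul (by linarith) hL ?_ (by positivity)) hw4
        exact div_nonneg (by norm_num) (by linarith)
    _ = _ := by ring

theorem sum_twisted_le_of_factor {x y V E t : ℝ} (hyx : y ≤ x) (hyV : y = V ^ 100)
    (hE : 4 ≤ E) (hEV : E ≤ V) (ht : 0 ≤ t) (ht1 : t ≤ 1) {T U : Finset ℕ}
    (hT : ∀ a ∈ T, 1 ≤ a ∧ (a : ℝ) ≤ V ^ 25)
    (hU : ∀ n ∈ U, ∃ a ∈ T, ∃ k ∈ roughCofactors x y E a, a * k = n) :
    ∑ n ∈ U, twisted t n ≤ Real.exp (Real.log 2 * (Real.log x / Real.log E)) *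
      (9 * y / Real.log E) * ∑ a ∈ T, twisted t a / a := by
  classical
  have hlogE : 0 < Real.log E := Real.log_pos (by linarith)
  set c := Real.exp (Real.log 2 * (Real.log x / Real.log E)) with hc
  calc ∑ n ∈ U, twisted t n
      ≤ ∑ z ∈ T.sigma fun a => roughCofactors x y E a, c * twisted t z.1 := by
        refine sum_le_sum_of_cover (fun z : Σ _ : ℕ, ℕ => z.1 * z.2)
          (fun z _ => mul_nonneg (Real.exp_nonneg _) (twisted_nonneg ht _)) fun n hn => ?_
        obtain ⟨a, haT, k, hk, rfl⟩ := hU n hn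
        refine ⟨⟨a, k⟩, mem_sigma.2 ⟨haT, hk⟩, rfl, ?_⟩
        obtain ⟨hk1, _, hkx, hk4⟩ := mem_filter.1 hk
        have hk0 : k ≠ 0 := by have := (mem_Icc.1 hk1).1; omega
        have ha1 := (hT a haT).1
        have h1 := card_divisors_le_exp (by linarith) hk0 hk4
        have h2 := twisted_mul_le ht ht1 hk0 (show a ≠ 0 by omega)
        have hk0' : (0 : ℝ) < k := by exact_mod_cast Nat.pos_of_ne_zero hk0
        have h3 : Real.log k ≤ Real.log x := by
          refine Real.log_le_log hk0' (le_trans ?_ hkx)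
          exact le_mul_of_one_le_left hk0'.le (by exact_mod_cast ha1)
        have h4 := twisted_nonneg ht a
        rw [mul_comm a k]
        calc _ ≤ _ := h2
          _ ≤ Real.exp (Real.log 2 * (Real.log k / Real.log E)) * twisted t a := by gcongr
          _ ≤ c * twisted t a := by
              rw [hc]
              gcongr
    _ = ∑ a ∈ T, c * twisted t a * (roughCofactors x y E a).card := by
        rw [Finset.sum_sigma]
        refine Finset.sum_congr rfl fun a _ => ?_
        simp only [Finset.sum_const, nsmul_eq_mul]
        ring
    _ ≤ ∑ a ∈ T, c * twisted t a * (9 * y / Real.log E * (1 / a)) := by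
        refine Finset.sum_le_sum fun a ha => ?_
        have h1 := card_roughCofactors_le hyx hyV hE hEV (hT a ha).1 (hT a ha).2
        have h2 := twisted_nonneg ht a
        gcongr
    _ = _ := by
        rw [Finset.mul_sum]
        refine Finset.sum_congr rfl fun a _ => ?_
        ring

theorem card_le_sum_of_dvd {x y : ℝ} (hy : 1 ≤ y) (hyx : y ≤ x) {T U : Finset ℕ}
    (hT : ∀ a ∈ T, 1 ≤ a ∧ (a : ℝ) ≤ y)
    (hU : ∀ n ∈ U, x - y < n ∧ (n : ℝ) ≤ x ∧ ∃ a ∈ T, a ∣ n) :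
    (U.card : ℝ) ≤ 3 * y * ∑ a ∈ T, (1 : ℝ) / a := by
  have hsub : U ⊆ T.biUnion fun a => (Ioc ⌊x - y⌋₊ ⌊x⌋₊).filter (a ∣ ·) := by
    intro n hn
    obtain ⟨h1, h2, a, ha, hd⟩ := hU n hn
    refine mem_biUnion.2 ⟨a, ha, mem_filter.2 ⟨mem_Ioc.2 ⟨?_, Nat.le_floor h2⟩, hd⟩⟩
    rwa [Nat.floor_lt (by linarith)]
  have h1 : (U.card : ℝ) ≤
      ∑ a ∈ T, (((Ioc ⌊x - y⌋₊ ⌊x⌋₊).filter (a ∣ ·)).card : ℝ) := by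
    exact_mod_cast (card_le_card hsub).trans card_biUnion_le
  rw [Finset.mul_sum]
  refine h1.trans (Finset.sum_le_sum fun a ha => ?_)
  obtain ⟨ha1, hay⟩ := hT a ha
  have ha0 : (0 : ℝ) < a := by exact_mod_cast ha1
  have h2 := (abs_le.1 (abs_card_multiples_sub_le
    (Nat.floor_mono (show x - y ≤ x by linarith)) ha1)).2
  have h3 : (⌊x⌋₊ : ℝ) ≤ x := Nat.floor_le (by linarith)
  have h4 : x - y < ⌊x - y⌋₊ + 1 := Nat.lt_floor_add_one _
  have h5 : ((⌊x⌋₊ : ℝ) - ⌊x - y⌋₊) / a ≤ (2 * y) / a := by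
    gcongr
    linarith
  have h6 : 1 ≤ y / a := by rwa [one_le_div ha0]
  calc _ ≤ (2 * y) / a + y / a := by linarith
    _ = _ := by ring

/-- `n = a k`, where `a` is the product of the smallest primes of `n` (with multiplicity), as many
as fit below `Y`. -/
def IsHead (Y : ℝ) (n a k : ℕ) : Prop :=
  a * k = n ∧ (a : ℝ) ≤ Y ∧ k ≠ 1 ∧ Y < a * k.minFac ∧
    ∀ p : ℕ, p.Prime → p ∣ a → p ≤ k.minFac

theorem IsHead.mem_roughCofactors {x y Y E : ℝ} {n a k : ℕ} (h : IsHead Y n a k) (hn : n ≠ 0)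
    (hn1 : x - y < n) (hn2 : (n : ℝ) ≤ x) (hE : E < k.minFac) : k ∈ roughCofactors x y E a := by
  classical
  obtain ⟨rfl, -, -, -, -⟩ := h
  obtain ⟨ha0, hk0⟩ := mul_ne_zero_iff.1 hn
  push_cast at hn1 hn2
  have ha1 : (1 : ℝ) ≤ a := by exact_mod_cast Nat.one_le_iff_ne_zero.2 ha0
  have hle : (k : ℝ) ≤ x := (le_mul_of_one_le_left (Nat.cast_nonneg k) ha1).trans hn2
  refine mem_filter.2 ⟨mem_Icc.2 ⟨Nat.one_le_iff_ne_zero.2 hk0, Nat.le_floor hle⟩, hn1, hn2,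
    fun p hp hpk => hE.trans_le ?_⟩
  exact_mod_cast Nat.minFac_le_of_dvd hp.two_le hpk

theorem IsHead.mem_Icc {Y : ℝ} {n a k : ℕ} (h : IsHead Y n a k) (hn : n ≠ 0) :
    a ∈ Icc 1 ⌊Y⌋₊ := by
  obtain ⟨rfl, haY, -, -, -⟩ := h
  exact Finset.mem_Icc.2 ⟨Nat.one_le_iff_ne_zero.2 (mul_ne_zero_iff.1 hn).1, Nat.le_floor haY⟩

theorem IsHead.le_left {V : ℝ} (hV : 0 < V) {n a k : ℕ} (h : IsHead (V ^ 25) n a k)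
    (hk : (k.minFac : ℝ) ≤ V) : V ^ 24 ≤ a := by
  obtain ⟨-, -, -, h1, -⟩ := h
  refine le_of_mul_le_mul_right ?_ hV
  calc V ^ 24 * V = V ^ 25 := by ring
    _ ≤ (a : ℝ) * k.minFac := h1.le
    _ ≤ a * V := by gcongr

section Classes

variable {x y V ℓ t : ℝ} {U : Finset ℕ}

theorem sum_twisted_large_le (hyx : y ≤ x) (hyV : y = V ^ 100) (hV : 4 ≤ V) (ht : 0 ≤ t)
    (ht1 : t ≤ 1) (hxV : Real.log x ≤ 100 * ℓ * Real.log V)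
    (hU : ∀ n ∈ U, n ≠ 0 ∧ x - y < n ∧ (n : ℝ) ≤ x ∧
      ∃ a k, IsHead (V ^ 25) n a k ∧ V < k.minFac) :
    ∑ n ∈ U, twisted t n ≤ Real.exp (Real.log 2 * (100 * ℓ)) * (9 * y / Real.log V) *
      ∑ a ∈ Icc 1 ⌊V ^ 25⌋₊, twisted t a / a := by
  have hlogV : 0 < Real.log V := Real.log_pos (by linarith)
  have hy0 : 0 < y := by rw [hyV]; positivity
  refine (sum_twisted_le_of_factor hyx hyV hV le_rfl ht ht1
    (fun a ha => ⟨(mem_Icc.1 ha).1, (Nat.le_floor_iff (by positivity)).1 (mem_Icc.1 ha).2⟩)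
    fun n hn => ?_).trans ?_
  · obtain ⟨h0, h1, h2, a, k, hp, hk⟩ := hU n hn
    exact ⟨a, hp.mem_Icc h0, k, hp.mem_roughCofactors h0 h1 h2 hk, hp.1⟩
  · have h3 : 0 ≤ ∑ a ∈ Icc 1 ⌊V ^ 25⌋₊, twisted t a / a :=
      Finset.sum_nonneg fun a _ => div_nonneg (twisted_nonneg ht a) (Nat.cast_nonneg a)
    have h4 : Real.log x / Real.log V ≤ 100 * ℓ := by rwa [div_le_iff₀ hlogV]
    gcongr

theorem card_divisors_prime_pow {p : ℕ} (hp : p.Prime) (k : ℕ) :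
    (p ^ k).divisors.card = k + 1 := by
  rw [Nat.divisors_prime_pow hp, card_map, card_range]

theorem twisted_prime_pow_mul_le (ht : 0 ≤ t) (ht1 : t ≤ 1) (p k b : ℕ) (hp : p.Prime)
    (hb : b ≠ 0) : twisted t (p ^ k * b) ≤ (k + 1) * twisted t b := by
  have h := twisted_mul_le ht ht1 (pow_ne_zero k hp.ne_zero) hb
  rw [card_divisors_prime_pow hp] at h
  exact_mod_cast h

/-- The loss in Rankin's bound. -/
noncomputable def rankinFactor (ℓ : ℝ) : ℝ :=
  Real.exp (9 * (Real.exp (6 * ℓ) * (6 * ℓ + 7 / 20)))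

theorem sum_twisted_dyadic_le (hyx : y ≤ x) (hyV : y = V ^ 100) (hℓ : 1 ≤ ℓ) (ht : 0 ≤ t)
    (ht1 : t ≤ 1) (hxV : Real.log x ≤ 100 * ℓ * Real.log V) (hV0 : 0 < V) {m : ℝ} (hm : 1 ≤ m)
    (hmV : 24 * ℓ ≤ Real.log V / m)
    (hU : ∀ n ∈ U, n ≠ 0 ∧ x - y < n ∧ (n : ℝ) ≤ x ∧
      ∃ a k, IsHead (V ^ 25) n a k ∧ Real.log V / (2 * m) < Real.log k.minFac ∧
        Real.log k.minFac ≤ Real.log V / m) :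
    ∑ n ∈ U, twisted t n ≤ (1 / m) * (18 * y / Real.log V) *
      (rankinFactor ℓ * ∑ a ∈ Icc 1 ⌊V ^ 25⌋₊, twisted t a / a) := by
  classical
  have hm0 : 0 < m := by linarith
  have hlogV : 24 ≤ Real.log V := by
    have h1 : Real.log V / m * m = Real.log V := div_mul_cancel₀ _ hm0.ne'
    nlinarith
  have hlogV0 : 0 < Real.log V := by linarith
  have hy0 : 0 < y := by rw [hyV]; positivity
  set E := Real.exp (Real.log V / (2 * m)) with hEdef
  set Q := Real.exp (Real.log V / m) with hQdef
  have hlogE : Real.log E = Real.log V / (2 * m) := Real.log_exp _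
  have hlogE12 : 12 ≤ Real.log V / (2 * m) := by
    have : Real.log V / (2 * m) = Real.log V / m / 2 := by rw [div_div, mul_comm]
    rw [this]; linarith
  have hE4 : 4 ≤ E := by
    have := Real.add_one_le_exp (Real.log V / (2 * m))
    linarith
  have hEV : E ≤ V := by
    rw [hEdef, ← Real.le_log_iff_exp_le hV0]
    exact div_le_self hlogV0.le (by linarith)
  have hQV : Q ≤ V := by
    rw [hQdef, ← Real.le_log_iff_exp_le hV0]
    exact div_le_self hlogV0.le hm
  have hQ1 : 1 ≤ Q := Real.one_le_exp (by linarith)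
  set T := (Icc 1 ⌊V ^ 25⌋₊).filter fun a : ℕ => V ^ 24 ≤ a ∧
    ∀ p : ℕ, p.Prime → p ∣ a → (p : ℝ) ≤ Q with hT
  have hTI : ∀ a ∈ T, a ∈ Icc 1 ⌊V ^ 25⌋₊ := fun a ha => (mem_filter.1 ha).1
  have hF : 0 ≤ ∑ a ∈ Icc 1 ⌊V ^ 25⌋₊, twisted t a / a :=
    Finset.sum_nonneg fun a _ => div_nonneg (twisted_nonneg ht a) (Nat.cast_nonneg a)
  have hstep := sum_twisted_le_of_factor hyx hyV hE4 hEV ht ht1 (T := T) (U := U)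
    (fun a ha => ⟨(mem_Icc.1 (hTI a ha)).1,
      (Nat.le_floor_iff (by positivity)).1 (mem_Icc.1 (hTI a ha)).2⟩)
    (fun n hn => by
      obtain ⟨h0, h1, h2, a, k, hp, hk1, hk2⟩ := hU n hn
      have hq0 : (0 : ℝ) < k.minFac := by exact_mod_cast Nat.minFac_pos k
      have hkE : E < k.minFac := by rwa [hEdef, ← Real.lt_log_iff_exp_lt hq0]
      have hkQ : (k.minFac : ℝ) ≤ Q := by rwa [hQdef, ← Real.log_le_iff_le_exp hq0]
      refine ⟨a, mem_filter.2 ⟨hp.mem_Icc h0, hp.le_left hV0 (hkQ.trans hQV), fun p hpp hpa => ?_⟩,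
        k, hp.mem_roughCofactors h0 h1 h2 hkE, hp.1⟩
      exact le_trans (by exact_mod_cast hp.2.2.2.2 p hpp hpa) hkQ)
  set δ := 6 * ℓ * m / Real.log V with hδ
  have hδ0 : 0 ≤ δ := by positivity
  have hδ1 : δ ≤ 1 / 4 := by
    rw [hδ, div_le_iff₀ hlogV0]
    rw [le_div_iff₀ hm0] at hmV
    linarith
  have hκ : δ * Real.log Q = 6 * ℓ := by
    rw [hδ, hQdef, Real.log_exp]
    field_simp
  have hrankin := sum_smooth_div_le (twisted_nonneg ht) (twisted_prime_pow_mul_le ht ht1)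
    (T := T) (N := ⌊V ^ 25⌋₊) (M := V ^ 24) (by positivity) hQ1 hδ0 hδ1 hκ
    (fun a ha => mem_filter.1 ha)
  have hM : (V ^ 24) ^ (-δ) = Real.exp (-(144 * ℓ * m)) := by
    rw [Real.rpow_def_of_pos (by positivity), Real.log_pow, hδ]
    congr 1
    push_cast
    field_simp
    norm_num
  rw [hM] at hrankin
  have hlogx : Real.log x / Real.log E ≤ 200 * ℓ * m := by
    rw [hlogE, div_le_iff₀ (by linarith)]
    calc _ ≤ _ := hxV
      _ = _ := by field_simp; norm_num
  have hdecay : Real.exp (Real.log 2 * (200 * ℓ * m)) * Real.exp (-(144 * ℓ * m)) ≤ 1 / m ^ 2 := by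
    rw [← Real.exp_add]
    have h2 := Real.log_two_lt_d9
    have hℓm : m ≤ ℓ * m := le_mul_of_one_le_left hm0.le hℓ
    have h3 : Real.log 2 * (200 * ℓ * m) + -(144 * ℓ * m) ≤ -(2 * m) := by nlinarith
    calc _ ≤ Real.exp (-(2 * m)) := Real.exp_le_exp.2 h3
      _ = 1 / Real.exp m ^ 2 := by
          rw [← Real.exp_nat_mul, Real.exp_neg, one_div]
          norm_num
      _ ≤ 1 / m ^ 2 := by
          have := Real.add_one_le_exp m
          gcongr
          linarith
  calc ∑ n ∈ U, twisted t n ≤ _ := hstep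
    _ ≤ Real.exp (Real.log 2 * (200 * ℓ * m)) * (9 * y / Real.log E) *
        (Real.exp (-(144 * ℓ * m)) *
          (rankinFactor ℓ * ∑ a ∈ Icc 1 ⌊V ^ 25⌋₊, twisted t a / a)) := by
        rw [hlogE] at *
        have h5 : 0 ≤ 9 * y / (Real.log V / (2 * m)) := by positivity
        refine mul_le_mul ?_ hrankin ?_ (by positivity)
        · gcongr
        · exact Finset.sum_nonneg fun a _ => div_nonneg (twisted_nonneg ht a) (Nat.cast_nonneg a)
    _ = (Real.exp (Real.log 2 * (200 * ℓ * m)) * Real.exp (-(144 * ℓ * m))) *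
        (m * (18 * y / Real.log V)) *
          (rankinFactor ℓ * ∑ a ∈ Icc 1 ⌊V ^ 25⌋₊, twisted t a / a) := by
        rw [hlogE]
        field_simp
        ring
    _ ≤ (1 / m ^ 2) * (m * (18 * y / Real.log V)) *
          (rankinFactor ℓ * ∑ a ∈ Icc 1 ⌊V ^ 25⌋₊, twisted t a / a) := by
        have : 0 ≤ rankinFactor ℓ := Real.exp_nonneg _
        gcongr
    _ = _ := by
        field_simp

theorem sum_twisted_middle_le (hyx : y ≤ x) (hyV : y = V ^ 100) (hℓ : 1 ≤ ℓ) (ht : 0 ≤ t)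
    (ht1 : t ≤ 1) (hxV : Real.log x ≤ 100 * ℓ * Real.log V) (hV0 : 0 < V)
    (hlogV : 0 < Real.log V)
    (hU : ∀ n ∈ U, n ≠ 0 ∧ x - y < n ∧ (n : ℝ) ≤ x ∧
      ∃ a k, IsHead (V ^ 25) n a k ∧ 24 * ℓ < Real.log k.minFac ∧ (k.minFac : ℝ) ≤ V) :
    ∑ n ∈ U, twisted t n ≤ 36 * y / Real.log V *
      (rankinFactor ℓ * ∑ a ∈ Icc 1 ⌊V ^ 25⌋₊, twisted t a / a) := by
  classical
  set G := rankinFactor ℓ * ∑ a ∈ Icc 1 ⌊V ^ 25⌋₊, twisted t a / a with hG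
  have hG0 : 0 ≤ G := mul_nonneg (Real.exp_nonneg _)
    (Finset.sum_nonneg fun a _ => div_nonneg (twisted_nonneg ht a) (Nat.cast_nonneg a))
  have hy0 : 0 < y := by rw [hyV]; positivity
  set W : ℕ → Finset ℕ := fun i => U.filter fun n => 24 * ℓ ≤ Real.log V / 2 ^ i ∧
    ∃ a k, IsHead (V ^ 25) n a k ∧ Real.log V / (2 * 2 ^ i) < Real.log k.minFac ∧
      Real.log k.minFac ≤ Real.log V / 2 ^ i with hW
  calc ∑ n ∈ U, twisted t n
      ≤ ∑ z ∈ (range (⌊Real.log V⌋₊ + 1)).sigma W, twisted t z.2 := by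
        refine sum_le_sum_of_cover (fun z : Σ _ : ℕ, ℕ => z.2)
          (fun z _ => twisted_nonneg ht _) fun n hn => ?_
        obtain ⟨h0, h1, h2, a, k, hp, hk1, hk2⟩ := hU n hn
        have hq0 : (0 : ℝ) < k.minFac := by exact_mod_cast Nat.minFac_pos k
        have hlq : 0 < Real.log k.minFac := by linarith
        have hlq1 : 1 ≤ Real.log k.minFac := by linarith
        have hu : 1 ≤ Real.log V / Real.log k.minFac := by
          rw [one_le_div hlq]
          exact Real.log_le_log hq0 hk2
        obtain ⟨i, hi1, hi2⟩ := exists_nat_pow_near hu (one_lt_two : (1 : ℝ) < 2)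
        have h2i : (0 : ℝ) < 2 ^ i := by positivity
        rw [le_div_iff₀ hlq] at hi1
        rw [div_lt_iff₀ hlq] at hi2
        have hle : Real.log k.minFac ≤ Real.log V / 2 ^ i := by
          rw [le_div_iff₀ h2i]; linarith
        have hlt : Real.log V / (2 * 2 ^ i) < Real.log k.minFac := by
          rw [div_lt_iff₀ (by positivity)]
          rw [pow_succ] at hi2
          linarith
        have hiV : i ≤ ⌊Real.log V⌋₊ := by
          refine Nat.le_floor ?_
          have h3 : (i : ℝ) ≤ 2 ^ i := by exact_mod_cast (Nat.lt_two_pow_self (n := i)).le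
          nlinarith
        exact ⟨⟨i, n⟩, mem_sigma.2 ⟨mem_range.2 (by simp only; omega),
          mem_filter.2 ⟨hn, by linarith, a, k, hp, hlt, hle⟩⟩, rfl, le_rfl⟩
    _ = ∑ i ∈ range (⌊Real.log V⌋₊ + 1), ∑ n ∈ W i, twisted t n := Finset.sum_sigma _ _ _
    _ ≤ ∑ i ∈ range (⌊Real.log V⌋₊ + 1), (1 / 2) ^ i * (18 * y / Real.log V * G) := by
        refine Finset.sum_le_sum fun i _ => ?_
        rcases (W i).eq_empty_or_nonempty with h | ⟨n0, hn0⟩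
        · rw [h, Finset.sum_empty]
          positivity
        · have h24 := (mem_filter.1 hn0).2.1
          have := sum_twisted_dyadic_le (U := W i) hyx hyV hℓ ht ht1 hxV hV0
            (m := 2 ^ i) (one_le_pow₀ (by norm_num)) h24 (fun n hn => by
              obtain ⟨hnU, -, h4⟩ := mem_filter.1 hn
              obtain ⟨h0, h1, h2, -⟩ := hU n hnU
              exact ⟨h0, h1, h2, h4⟩)
          rw [one_div_pow, ← mul_assoc]
          exact this
    _ ≤ 2 * (18 * y / Real.log V * G) := by
        rw [← Finset.sum_mul]
        have h6 := sum_geometric_two_le (⌊Real.log V⌋₊ + 1)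
        gcongr
    _ = _ := by ring

theorem card_small_le (hyx : y ≤ x) (hyV : y = V ^ 100) (hℓ : 1 ≤ ℓ)
    (hlogV : 24 * ℓ ≤ Real.log V) (hV : 100 ≤ V)
    (hU : ∀ n ∈ U, n ≠ 0 ∧ x - y < n ∧ (n : ℝ) ≤ x ∧
      ∃ a k, IsHead (V ^ 25) n a k ∧ Real.log k.minFac ≤ 24 * ℓ) :
    (U.card : ℝ) ≤ rankinFactor ℓ * (y / V ^ 3) := by
  classical
  have hV0 : 0 < V := by linarith
  have hy1 : 1 ≤ y := by rw [hyV]; exact one_le_pow₀ (by linarith)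
  set Q := Real.exp (24 * ℓ) with hQdef
  have hQV : Q ≤ V := by rwa [hQdef, ← Real.le_log_iff_exp_le hV0]
  set T := (Icc 1 ⌊V ^ 25⌋₊).filter fun a : ℕ => V ^ 24 ≤ a ∧
    ∀ p : ℕ, p.Prime → p ∣ a → (p : ℝ) ≤ Q with hT
  have hTI : ∀ a ∈ T, a ∈ Icc 1 ⌊V ^ 25⌋₊ := fun a ha => (mem_filter.1 ha).1
  have hVy : V ^ 25 ≤ y := by rw [hyV]; exact pow_le_pow_right₀ (by linarith) (by norm_num)
  have hcard := card_le_sum_of_dvd hy1 hyx (T := T) (U := U)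
    (fun a ha => ⟨(mem_Icc.1 (hTI a ha)).1,
      ((Nat.le_floor_iff (by positivity)).1 (mem_Icc.1 (hTI a ha)).2).trans hVy⟩)
    (fun n hn => by
      obtain ⟨h0, h1, h2, a, k, hp, hk⟩ := hU n hn
      have hq0 : (0 : ℝ) < k.minFac := by exact_mod_cast Nat.minFac_pos k
      have hkQ : (k.minFac : ℝ) ≤ Q := by rwa [hQdef, ← Real.log_le_iff_le_exp hq0]
      refine ⟨h1, h2, a, mem_filter.2 ⟨hp.mem_Icc h0, hp.le_left hV0 (hkQ.trans hQV),
        fun p hpp hpa => ?_⟩, ⟨k, hp.1.symm⟩⟩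
      exact le_trans (by exact_mod_cast hp.2.2.2.2 p hpp hpa) hkQ)
  have hrankin := sum_smooth_div_le (f := fun _ => 1) (fun _ => zero_le_one)
    (fun p k b _ _ => by linarith [show (0 : ℝ) ≤ k from Nat.cast_nonneg k])
    (T := T) (N := ⌊V ^ 25⌋₊) (M := V ^ 24) (by positivity)
    (Q := Q) (Real.one_le_exp (by linarith)) (δ := 1 / 4) (κ := 6 * ℓ) (by norm_num) le_rfl
    (by rw [hQdef, Real.log_exp]; ring) (fun a ha => mem_filter.1 ha)
  have hM : (V ^ 24) ^ (-(1 / 4) : ℝ) = (V ^ 6)⁻¹ := by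
    rw [Real.rpow_neg (by positivity), show V ^ 24 = (V ^ 6) ^ 4 by ring, ← Real.rpow_natCast
      (V ^ 6) 4, ← Real.rpow_mul (by positivity)]
    norm_num
  have hH : ∑ a ∈ Icc 1 ⌊V ^ 25⌋₊, (1 : ℝ) / a ≤ V ^ 2 / 3 := by
    have h1 := harmonic_le_one_add_log ⌊V ^ 25⌋₊
    rw [harmonic_eq_sum_Icc] at h1
    push_cast at h1
    have h2 : Real.log ⌊V ^ 25⌋₊ ≤ 25 * V := by
      calc Real.log ⌊V ^ 25⌋₊ ≤ Real.log (V ^ 25) := by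
            refine Real.log_le_log ?_ (Nat.floor_le (by positivity))
            exact_mod_cast Nat.floor_pos.2 (one_le_pow₀ (by linarith))
        _ = 25 * Real.log V := by rw [Real.log_pow]; norm_num
        _ ≤ _ := by
            have := Real.log_le_self hV0.le
            linarith
    simp only [one_div]
    nlinarith
  rw [hM] at hrankin
  calc (U.card : ℝ) ≤ _ := hcard
    _ ≤ 3 * y * ((V ^ 6)⁻¹ * (rankinFactor ℓ * (V ^ 2 / 3))) := by
        refine mul_le_mul_of_nonneg_left (hrankin.trans ?_) (by linarith)
        have : 0 ≤ rankinFactor ℓ := Real.exp_nonneg _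
        rw [← rankinFactor]
        gcongr
    _ = rankinFactor ℓ * (y / V ^ 4) := by
        field_simp
    _ ≤ _ := by
        have : 0 ≤ rankinFactor ℓ := Real.exp_nonneg _
        have h7 : V ^ 3 ≤ V ^ 4 := pow_le_pow_right₀ (by linarith) (by norm_num)
        gcongr

end Classes

theorem card_divisors_le_pow {n : ℕ} (hn : n ≠ 0) {B : ℝ} (hB : 2 * Real.log n + 1 ≤ B) :
    (n.divisors.card : ℝ) ≤ B ^ n.primeFactors.card := by
  rw [Nat.card_divisors hn]
  push_cast
  rw [← Finset.prod_const]
  refine Finset.prod_le_prod (fun p _ => by positivity) fun p hp => ?_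
  have hpp := Nat.prime_of_mem_primeFactors hp
  have h1 : 2 ^ n.factorization p ≤ n :=
    (Nat.pow_le_pow_left hpp.two_le _).trans (Nat.le_of_dvd (Nat.pos_of_ne_zero hn)
      (Nat.ordProj_dvd n p))
  have h2 : Real.log (2 ^ n.factorization p) ≤ Real.log n :=
    Real.log_le_log (by positivity) (by exact_mod_cast h1)
  rw [Real.log_pow] at h2
  have h3 := Real.log_two_gt_d9
  have h4 : (0 : ℝ) ≤ n.factorization p := Nat.cast_nonneg _
  nlinarith

theorem hooleyDelta_le_mul_twisted {t : ℝ} (ht : 0 < t) (ht1 : t ≤ 1) {n j : ℕ}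
    (hn : n.primeFactors.card ≤ j) : (hooleyDelta n : ℝ) ≤ (t ^ j)⁻¹ * twisted t n := by
  have h1 : t ^ j ≤ t ^ n.primeFactors.card := pow_le_pow_of_le_one ht.le ht1 hn
  rw [inv_mul_eq_div, le_div_iff₀ (by positivity), twisted, mul_comm]
  gcongr

theorem sum_hooleyDelta_le_sq {U : Finset ℕ} {Y : ℝ} (hY : 0 ≤ Y)
    (hU : ∀ n ∈ U, n ≠ 0 ∧ (n : ℝ) ≤ Y) : ∑ n ∈ U, (hooleyDelta n : ℝ) ≤ Y ^ 2 := by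
  have hsub : U ⊆ Icc 1 ⌊Y⌋₊ := fun n hn =>
    mem_Icc.2 ⟨Nat.one_le_iff_ne_zero.2 (hU n hn).1, Nat.le_floor (hU n hn).2⟩
  have hcard : (U.card : ℝ) ≤ Y := by
    have h1 := card_le_card hsub
    rw [Nat.card_Icc, Nat.add_sub_cancel] at h1
    exact le_trans (by exact_mod_cast h1) (Nat.floor_le hY)
  calc ∑ n ∈ U, (hooleyDelta n : ℝ) ≤ ∑ _n ∈ U, Y := by
        refine Finset.sum_le_sum fun n hn => le_trans ?_ (hU n hn).2
        exact_mod_cast (hooleyDelta_le_card_divisors n).trans (Nat.card_divisors_le_self n)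
    _ = U.card * Y := by rw [Finset.sum_const, nsmul_eq_mul]
    _ ≤ Y ^ 2 := by rw [sq]; gcongr

theorem rankinFactor_le {ℓ : ℝ} (hℓ : 1 ≤ ℓ) : rankinFactor ℓ ≤ Real.exp (2 ^ (16 * ℓ)) := by
  refine Real.exp_le_exp.2 ?_
  have h1 : Real.exp 1 * ℓ ≤ Real.exp ℓ := by
    have h2 := Real.add_one_le_exp (ℓ - 1)
    calc Real.exp 1 * ℓ ≤ Real.exp 1 * Real.exp (ℓ - 1) := by gcongr; linarith
      _ = Real.exp ℓ := by rw [← Real.exp_add]; ring_nf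
  have h2 : 58 * ℓ ≤ Real.exp (5 * ℓ) := by
    have h3 := Real.exp_one_gt_d9
    calc 58 * ℓ ≤ (2.7 : ℝ) ^ 5 * ℓ ^ 5 := by
          have : ℓ ≤ ℓ ^ 5 := le_self_pow₀ hℓ (by norm_num)
          nlinarith
      _ = (2.7 * ℓ) ^ 5 := by ring
      _ ≤ Real.exp ℓ ^ 5 := by
          gcongr
          nlinarith
      _ = Real.exp (5 * ℓ) := by rw [← Real.exp_nat_mul]; norm_num
  have h3 : Real.exp (6 * ℓ) * Real.exp (5 * ℓ) ≤ (2 : ℝ) ^ (16 * ℓ) := by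
    rw [← Real.exp_add, Real.rpow_def_of_pos (by norm_num)]
    refine Real.exp_le_exp.2 ?_
    have := Real.log_two_gt_d9
    nlinarith
  calc 9 * (Real.exp (6 * ℓ) * (6 * ℓ + 7 / 20)) = Real.exp (6 * ℓ) * (54 * ℓ + 63 / 20) := by ring
    _ ≤ Real.exp (6 * ℓ) * Real.exp (5 * ℓ) := by
        gcongr
        linarith
    _ ≤ _ := h3

theorem le_two_rpow {ℓ : ℝ} (hℓ : 1 ≤ ℓ) : 140 * ℓ ≤ (2 : ℝ) ^ (16 * ℓ) := by
  have h := one_add_mul_self_le_rpow_one_add (s := 65535) (by norm_num) hℓ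
  rw [Real.rpow_mul (by norm_num)]
  norm_num at h ⊢
  linarith

theorem le_phiConst {ℓ : ℝ} (hℓ : 1 ≤ ℓ) :
    83740 * ℓ * Real.exp (2 * 2 ^ (16 * ℓ)) ≤ phiConst ℓ := by
  have hC : Real.exp (2 * 2 ^ (16 * ℓ)) ≤ C2l ℓ := by
    rw [C2l, Real.rpow_def_of_pos (show 0 < 10 * ℓ by linarith)]
    refine Real.exp_le_exp.2 ?_
    have h1 : (2 : ℝ) ≤ Real.log (10 * ℓ) := by
      rw [Real.le_log_iff_exp_le (by linarith)]
      have h2 := Real.exp_one_lt_d9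
      calc Real.exp 2 = Real.exp 1 ^ 2 := by rw [← Real.exp_nat_mul]; norm_num
        _ ≤ 2.8 ^ 2 := by gcongr; linarith
        _ ≤ _ := by norm_num; linarith
    gcongr
  have hA : 0 < A2 := by norm_num [A2]
  have hD : 0 ≤ D2l ℓ := by
    unfold D2l
    have : 0 ≤ max A2 (2 * (2 : ℝ) ^ (5 * ℓ * A2)) := le_max_of_le_left hA.le
    split_ifs <;> positivity
  have h0 : 0 ≤ 12 * ℓ * (2 : ℝ) ^ (6 * ℓ) := by positivity
  have h1 : 5 * ℓ * Real.exp (2 * 2 ^ (16 * ℓ)) ≤ 5 * ℓ * C2l ℓ := by gcongr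
  have h2 : 0 ≤ 9 * ℓ * D2l ℓ := by positivity
  rw [phiConst, Lam2]
  nlinarith

theorem threshold_le {ℓ : ℝ} (hℓ : 1 ≤ ℓ) :
    (1000 * ℓ) ^ 8 ≤ 7 ^ 28 * (12 * Real.exp 1 * ℓ) ^ (28 * Real.log (192 * Real.exp 1 * ℓ)) := by
  have he := Real.exp_one_gt_d9
  have hb : 32 * ℓ ≤ 12 * Real.exp 1 * ℓ := by nlinarith
  have hlog : 1 ≤ Real.log (192 * Real.exp 1 * ℓ) := by
    rw [Real.le_log_iff_exp_le (by positivity)]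
    nlinarith
  have h1 : (12 * Real.exp 1 * ℓ) ^ (16 : ℝ) ≤
      (12 * Real.exp 1 * ℓ) ^ (28 * Real.log (192 * Real.exp 1 * ℓ)) :=
    Real.rpow_le_rpow_of_exponent_le (by linarith) (by linarith)
  have h2 : (1000 * ℓ) ^ 8 ≤ (12 * Real.exp 1 * ℓ) ^ (16 : ℝ) := by
    rw [show (16 : ℝ) = ((16 : ℕ) : ℝ) by norm_num, Real.rpow_natCast]
    calc (1000 * ℓ) ^ 8 ≤ ((32 * ℓ) ^ 2) ^ 8 := by
          gcongr
          nlinarith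
      _ = (32 * ℓ) ^ 16 := by ring
      _ ≤ _ := by gcongr
  calc _ ≤ _ := h2.trans h1
    _ ≤ _ := le_mul_of_one_le_left (by positivity) (by norm_num)

theorem sum_twisted_div_le_exp {t x L : ℝ} (ht : 0 ≤ t) (ht1 : t ≤ 1) {N j : ℕ}
    (hN : 3 ≤ N) (hNx : (N : ℝ) ≤ x) (hL : L = Real.log (Real.log x))
    (htL : 4 * (t * L) = Real.pi * j) :
    ∑ a ∈ Icc 1 N, twisted t a / a ≤ 16 * Real.exp 70 * Real.exp j := by
  have h1 := sum_twisted_div_le ht ht1 N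
  have h2 := normSum_le ht ht1 hN
  have hN3 : (3 : ℝ) ≤ N := by exact_mod_cast hN
  have hlogN : 0 < Real.log N := Real.log_pos (by linarith)
  have h3 : Real.log (Real.log N) ≤ L := by
    rw [hL]
    exact Real.log_le_log hlogN (Real.log_le_log (by linarith) hNx)
  have h4 : 1.26 * t * Real.log (Real.log N) ≤ j := by
    have h5 := Real.pi_lt_d2
    have h6 : t * Real.log (Real.log N) ≤ t * L := by gcongr
    have h7 : (0 : ℝ) ≤ j := Nat.cast_nonneg j
    nlinarith
  calc _ ≤ _ := h1
    _ ≤ 16 * (Real.exp 70 * Real.exp (1.26 * t * Real.log (Real.log N))) := by gcongr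
    _ ≤ 16 * (Real.exp 70 * Real.exp j) := by gcongr
    _ = _ := by ring

/-- An integer up to `x` with few prime factors has few divisors. -/
theorem hooleyDelta_le_exp {n j : ℕ} {x B : ℝ} (h0 : n ≠ 0) (hn : (n : ℝ) ≤ x)
    (hnj : n.primeFactors.card ≤ j) (hx3 : 3 ≤ Real.log x)
    (hB : j * Real.log (Real.log x) ≤ B) :
    (hooleyDelta n : ℝ) ≤ Real.exp (2 * B) := by
  have hn0 : (0 : ℝ) < n := by exact_mod_cast Nat.pos_of_ne_zero h0
  have hlogn : Real.log n ≤ Real.log x := Real.log_le_log hn0 hn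
  have hx0 : 0 < Real.log x := by linarith
  have hsq : 2 * Real.log n + 1 ≤ Real.log x ^ 2 := by
    have : 3 * Real.log x ≤ Real.log x ^ 2 := by rw [sq]; gcongr
    linarith
  calc (hooleyDelta n : ℝ) ≤ n.divisors.card := by
        exact_mod_cast hooleyDelta_le_card_divisors n
    _ ≤ (Real.log x ^ 2) ^ n.primeFactors.card := card_divisors_le_pow h0 hsq
    _ ≤ (Real.log x ^ 2) ^ j :=
        pow_le_pow_right₀ (one_le_pow₀ (by linarith)) hnj
    _ = Real.exp (2 * (j * Real.log (Real.log x))) := by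
        conv_lhs => rw [← Real.exp_log hx0]
        rw [← Real.exp_nat_mul, ← Real.exp_nat_mul]
        congr 1
        push_cast
        ring
    _ ≤ Real.exp (2 * B) := Real.exp_le_exp.2 (by linarith)

set_option maxHeartbeats 1600000 in
theorem sum_hooleyDelta_short_le {ℓ x y V s t : ℝ} {j : ℕ} (hℓ : 1 ≤ ℓ) (hyx : y ≤ x)
    (hV0 : 0 < V) (hyV : y = V ^ 100) (hxV : Real.log x ≤ 100 * ℓ * Real.log V)
    (hs : 1000 * ℓ ≤ s) (hxs : Real.log x = s ^ 8) (ht : 0 < t) (ht1 : t ≤ 1)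
    (htL : 4 * (t * Real.log (Real.log x)) = Real.pi * j) {U : Finset ℕ}
    (hU : ∀ n ∈ U, n ≠ 0 ∧ x - y < n ∧ (n : ℝ) ≤ x ∧ n.primeFactors.card ≤ j) :
    ∑ n ∈ U, (hooleyDelta n : ℝ) ≤
      phiConst ℓ * (y / Real.log x) * ((t ^ j)⁻¹ * Real.exp j) := by
  classical
  have hs1 : 1000 ≤ s := by linarith
  have hs0 : 0 < s := by linarith
  have hx0 : 0 < Real.log x := by rw [hxs]; positivity
  have hy0 : 0 < y := by rw [hyV]; positivity
  -- the size of `V`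
  have hlogV : 10 * s ^ 7 ≤ Real.log V := by
    have h1 : s ^ 7 * (1000 * ℓ) ≤ s ^ 7 * s := by gcongr
    rw [hxs] at hxV
    have h2 : ℓ * (10 * s ^ 7) ≤ ℓ * Real.log V := by nlinarith
    exact le_of_mul_le_mul_left h2 (by linarith)
  have hs7 : s ≤ s ^ 7 := le_self_pow₀ (by linarith) (by norm_num)
  have hs27 : 1000 * s ^ 2 ≤ s ^ 7 := by
    calc 1000 * s ^ 2 ≤ s * s ^ 2 := by gcongr
      _ = s ^ 3 := by ring
      _ ≤ s ^ 7 := pow_le_pow_right₀ (by linarith) (by norm_num)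
  have hlogV24 : 24 * ℓ ≤ Real.log V := by linarith
  have hlogV0 : 0 < Real.log V := by linarith
  have hV100 : 100 ≤ V := by
    have h1 := Real.add_one_le_exp (Real.log V)
    rw [Real.exp_log hV0] at h1
    linarith
  have hL : Real.log (Real.log x) ≤ 8 * s := by
    rw [hxs, Real.log_pow]
    have := Real.log_le_self hs0.le
    push_cast
    linarith
  have hL0 : 0 ≤ Real.log (Real.log x) := by
    refine Real.log_nonneg ?_
    rw [hxs]
    exact one_le_pow₀ (by linarith)
  have hxlogV : Real.log x ≤ V := by
    rw [← Real.exp_log hx0, ← Real.exp_log hV0]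
    exact Real.exp_le_exp.2 (by linarith)
  -- the two logarithmic means
  set F := ∑ a ∈ Icc 1 ⌊V ^ 25⌋₊, twisted t a / a with hFdef
  have hF : F ≤ 16 * Real.exp 70 * Real.exp j := by
    refine sum_twisted_div_le_exp ht.le ht1 (Nat.le_floor ?_) ?_ rfl htL
    · push_cast
      calc (3 : ℝ) ≤ V := by linarith
        _ ≤ V ^ 25 := le_self_pow₀ (by linarith) (by norm_num)
    · calc (⌊V ^ 25⌋₊ : ℝ) ≤ V ^ 25 := Nat.floor_le (by positivity)
        _ ≤ V ^ 100 := pow_le_pow_right₀ (by linarith) (by norm_num)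
        _ ≤ x := by rwa [← hyV]
  have hF0 : 0 ≤ F := Finset.sum_nonneg fun a _ =>
    div_nonneg (twisted_nonneg ht.le a) (Nat.cast_nonneg a)
  set K := rankinFactor ℓ with hK
  have hK0 : 0 ≤ K := Real.exp_nonneg _
  set Z := y / Real.log x with hZ
  have hZ0 : 0 ≤ Z := by positivity
  have hyZ : y / Real.log V ≤ 100 * ℓ * Z := by
    rw [hZ, ← mul_div_assoc, div_le_div_iff₀ hlogV0 hx0]
    nlinarith
  have ht0 : 0 ≤ (t ^ j)⁻¹ := by positivity
  have htj : 1 ≤ (t ^ j)⁻¹ * Real.exp j := by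
    have h1 : 1 ≤ (t ^ j)⁻¹ := (one_le_inv₀ (by positivity)).2 (pow_le_one₀ ht.le ht1)
    have h2 : 1 ≤ Real.exp j := Real.one_le_exp (Nat.cast_nonneg j)
    nlinarith
  -- the classes
  set U0 := U.filter fun n : ℕ => (n : ℝ) ≤ V ^ 25 with hU0
  set U1 := U.filter fun n => ∃ a k, IsHead (V ^ 25) n a k ∧ V < k.minFac with hU1
  set U2 := U.filter fun n => ∃ a k, IsHead (V ^ 25) n a k ∧ 24 * ℓ < Real.log k.minFac ∧
    (k.minFac : ℝ) ≤ V with hU2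
  set U3 := U.filter fun n => ∃ a k, IsHead (V ^ 25) n a k ∧ Real.log k.minFac ≤ 24 * ℓ with hU3
  have hsplit : ∑ n ∈ U, (hooleyDelta n : ℝ) ≤ ∑ n ∈ U0, (hooleyDelta n : ℝ) +
      ∑ n ∈ U1, (hooleyDelta n : ℝ) + ∑ n ∈ U2, (hooleyDelta n : ℝ) +
      ∑ n ∈ U3, (hooleyDelta n : ℝ) := by
    rw [hU0, hU1, hU2, hU3]
    simp only [Finset.sum_filter]
    rw [← Finset.sum_add_distrib, ← Finset.sum_add_distrib, ← Finset.sum_add_distrib]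
    refine Finset.sum_le_sum fun n _ => ?_
    have hΔ : (0 : ℝ) ≤ hooleyDelta n := Nat.cast_nonneg _
    have hite : ∀ P : Prop, 0 ≤ if P then (hooleyDelta n : ℝ) else 0 := fun P => by
      split_ifs <;> simp
    by_cases h0 : (n : ℝ) ≤ V ^ 25
    · rw [if_pos h0]
      linarith [hite (∃ a k, IsHead (V ^ 25) n a k ∧ V < k.minFac),
        hite (∃ a k, IsHead (V ^ 25) n a k ∧ 24 * ℓ < Real.log k.minFac ∧ (k.minFac : ℝ) ≤ V),
        hite (∃ a k, IsHead (V ^ 25) n a k ∧ Real.log k.minFac ≤ 24 * ℓ)]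
    · obtain ⟨a, k, hp⟩ := exists_isHead (one_le_pow₀ (by linarith)) (not_le.1 h0)
      by_cases h1 : Real.log k.minFac ≤ 24 * ℓ
      · rw [if_pos (⟨a, k, hp, h1⟩ : ∃ a k, IsHead (V ^ 25) n a k ∧ Real.log k.minFac ≤ 24 * ℓ)]
        linarith [hite (∃ a k, IsHead (V ^ 25) n a k ∧ V < k.minFac), hite ((n : ℝ) ≤ V ^ 25),
          hite (∃ a k, IsHead (V ^ 25) n a k ∧ 24 * ℓ < Real.log k.minFac ∧ (k.minFac : ℝ) ≤ V)]
      by_cases h2 : (k.minFac : ℝ) ≤ V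
      · rw [if_pos (⟨a, k, hp, not_le.1 h1, h2⟩ : ∃ a k, IsHead (V ^ 25) n a k ∧
          24 * ℓ < Real.log k.minFac ∧ (k.minFac : ℝ) ≤ V)]
        linarith [hite (∃ a k, IsHead (V ^ 25) n a k ∧ V < k.minFac), hite ((n : ℝ) ≤ V ^ 25),
          hite (∃ a k, IsHead (V ^ 25) n a k ∧ Real.log k.minFac ≤ 24 * ℓ)]
      · rw [if_pos (⟨a, k, hp, not_le.1 h2⟩ : ∃ a k, IsHead (V ^ 25) n a k ∧ V < k.minFac)]
        linarith [hite ((n : ℝ) ≤ V ^ 25),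
          hite (∃ a k, IsHead (V ^ 25) n a k ∧ 24 * ℓ < Real.log k.minFac ∧ (k.minFac : ℝ) ≤ V),
          hite (∃ a k, IsHead (V ^ 25) n a k ∧ Real.log k.minFac ≤ 24 * ℓ)]
  have hS0 : ∑ n ∈ U0, (hooleyDelta n : ℝ) ≤ Z := by
    refine (sum_hooleyDelta_le_sq (Y := V ^ 25) (by positivity) fun n hn =>
      ⟨(hU n (mem_filter.1 hn).1).1, (mem_filter.1 hn).2⟩).trans ?_
    rw [hZ, le_div_iff₀ hx0]
    calc (V ^ 25) ^ 2 * Real.log x ≤ (V ^ 25) ^ 2 * V := by gcongr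
      _ = V ^ 51 := by ring
      _ ≤ y := by rw [hyV]; exact pow_le_pow_right₀ (by linarith) (by norm_num)
  have htwist : ∀ W ⊆ U, ∑ n ∈ W, (hooleyDelta n : ℝ) ≤ (t ^ j)⁻¹ * ∑ n ∈ W, twisted t n := by
    intro W hW
    rw [Finset.mul_sum]
    exact Finset.sum_le_sum fun n hn => hooleyDelta_le_mul_twisted ht ht1 (hU n (hW hn)).2.2.2
  have hS1 : ∑ n ∈ U1, (hooleyDelta n : ℝ) ≤
      (t ^ j)⁻¹ * (Real.exp (70 * ℓ) * (900 * ℓ * Z) * (16 * Real.exp 70 * Real.exp j)) := by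
    refine (htwist U1 (filter_subset _ _)).trans ?_
    refine mul_le_mul_of_nonneg_left ?_ ht0
    refine (sum_twisted_large_le hyx hyV (by linarith) ht.le ht1 hxV fun n hn => ?_).trans ?_
    · obtain ⟨hn1, hn2⟩ := mem_filter.1 hn
      obtain ⟨h0, h1, h2, -⟩ := hU n hn1
      exact ⟨h0, h1, h2, hn2⟩
    · have h1 : Real.log 2 * (100 * ℓ) ≤ 70 * ℓ := by
        have := Real.log_two_lt_d9
        nlinarith
      have h2 : 9 * y / Real.log V ≤ 900 * ℓ * Z := by
        rw [mul_div_assoc]; linarith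
      gcongr
  have hS2 : ∑ n ∈ U2, (hooleyDelta n : ℝ) ≤
      (t ^ j)⁻¹ * ((3600 * ℓ * Z) * (K * (16 * Real.exp 70 * Real.exp j))) := by
    refine (htwist U2 (filter_subset _ _)).trans ?_
    refine mul_le_mul_of_nonneg_left ?_ ht0
    refine (sum_twisted_middle_le hyx hyV hℓ ht.le ht1 hxV hV0 hlogV0 fun n hn => ?_).trans ?_
    · obtain ⟨hn1, hn2⟩ := mem_filter.1 hn
      obtain ⟨h0, h1, h2, -⟩ := hU n hn1
      exact ⟨h0, h1, h2, hn2⟩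
    · have h2 : 36 * y / Real.log V ≤ 3600 * ℓ * Z := by
        rw [mul_div_assoc]; linarith
      gcongr
  have hS3 : ∑ n ∈ U3, (hooleyDelta n : ℝ) ≤ K * Z := by
    have hcard : (U3.card : ℝ) ≤ K * (y / V ^ 3) :=
      card_small_le hyx hyV hℓ hlogV24 hV100 fun n hn => by
        obtain ⟨hn1, hn2⟩ := mem_filter.1 hn
        obtain ⟨h0, h1, h2, -⟩ := hU n hn1
        exact ⟨h0, h1, h2, hn2⟩
    have hjL : (j : ℝ) ≤ 2 * Real.log (Real.log x) := by
      have h1 := Real.pi_gt_three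
      have h2 : t * Real.log (Real.log x) ≤ Real.log (Real.log x) := mul_le_of_le_one_left hL0 ht1
      nlinarith [show (0 : ℝ) ≤ j from Nat.cast_nonneg j]
    have hjB : j * Real.log (Real.log x) ≤ Real.log V := by
      have h5 : j * Real.log (Real.log x) ≤ 2 * (8 * s) * (8 * s) := by
        gcongr
        linarith
      linarith [show 2 * (8 * s) * (8 * s) = 128 * s ^ 2 by ring]
    have hx3 : 3 ≤ Real.log x := by
      rw [hxs]
      exact (by linarith : (3 : ℝ) ≤ s).trans (le_self_pow₀ (by linarith) (by norm_num))
    have hΔ : ∀ n ∈ U3, (hooleyDelta n : ℝ) ≤ V ^ 2 := by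
      intro n hn
      obtain ⟨h0, -, h2, h3⟩ := hU n (mem_filter.1 hn).1
      refine (hooleyDelta_le_exp h0 h2 h3 hx3 hjB).trans_eq ?_
      conv_rhs => rw [← Real.exp_log hV0]
      rw [← Real.exp_nat_mul]
      norm_num
    calc ∑ n ∈ U3, (hooleyDelta n : ℝ) ≤ ∑ _n ∈ U3, V ^ 2 := Finset.sum_le_sum hΔ
      _ = U3.card * V ^ 2 := by rw [Finset.sum_const, nsmul_eq_mul]
      _ ≤ K * (y / V ^ 3) * V ^ 2 := by gcongr
      _ = K * (y / V) := by field_simp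
      _ ≤ K * Z := by rw [hZ]; gcongr
  -- the constants
  set X : ℝ := 2 ^ (16 * ℓ) with hX
  have hKX : K ≤ Real.exp X := rankinFactor_le hℓ
  have hX140 : 140 * ℓ ≤ X := le_two_rpow hℓ
  have hXX : Real.exp (2 * X) = Real.exp X * Real.exp X := by rw [← Real.exp_add]; ring_nf
  have hX1 : 1 ≤ Real.exp X := Real.one_le_exp (by linarith)
  have hX70 : Real.exp 70 ≤ Real.exp X := Real.exp_le_exp.2 (by linarith)
  have h70 : Real.exp (70 * ℓ) * Real.exp 70 ≤ Real.exp (2 * X) := by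
    rw [← Real.exp_add]
    exact Real.exp_le_exp.2 (by linarith)
  have hKe : K * Real.exp 70 ≤ Real.exp (2 * X) := by rw [hXX]; gcongr
  have hK1 : 1 + K ≤ 2 * ℓ * Real.exp (2 * X) := by
    have h1 : Real.exp X ≤ Real.exp (2 * X) := Real.exp_le_exp.2 (by linarith)
    have h2 : Real.exp (2 * X) ≤ ℓ * Real.exp (2 * X) :=
      le_mul_of_one_le_left (Real.exp_nonneg _) hℓ
    linarith
  have hR0 : 0 ≤ Z * ((t ^ j)⁻¹ * Real.exp j) := by positivity
  calc ∑ n ∈ U, (hooleyDelta n : ℝ)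
      ≤ (1 + K) * Z + ((t ^ j)⁻¹ *
          (Real.exp (70 * ℓ) * (900 * ℓ * Z) * (16 * Real.exp 70 * Real.exp j)) +
          (t ^ j)⁻¹ * ((3600 * ℓ * Z) * (K * (16 * Real.exp 70 * Real.exp j)))) := by linarith
    _ ≤ (1 + K) * (Z * ((t ^ j)⁻¹ * Real.exp j)) + ((t ^ j)⁻¹ *
          (Real.exp (70 * ℓ) * (900 * ℓ * Z) * (16 * Real.exp 70 * Real.exp j)) +
          (t ^ j)⁻¹ * ((3600 * ℓ * Z) * (K * (16 * Real.exp 70 * Real.exp j)))) := by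
        gcongr
        exact le_mul_of_one_le_right hZ0 htj
    _ = ((1 + K) + 14400 * ℓ * (Real.exp (70 * ℓ) * Real.exp 70) +
          57600 * ℓ * (K * Real.exp 70)) * (Z * ((t ^ j)⁻¹ * Real.exp j)) := by ring
    _ ≤ (2 * ℓ * Real.exp (2 * X) + 14400 * ℓ * Real.exp (2 * X) +
          57600 * ℓ * Real.exp (2 * X)) * (Z * ((t ^ j)⁻¹ * Real.exp j)) := by gcongr
    _ ≤ (83740 * ℓ * Real.exp (2 * X)) * (Z * ((t ^ j)⁻¹ * Real.exp j)) := by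
        gcongr
        have : 0 ≤ ℓ * Real.exp (2 * X) := by positivity
        linarith
    _ ≤ phiConst ℓ * (Z * ((t ^ j)⁻¹ * Real.exp j)) := by
        gcongr
        exact le_phiConst hℓ
    _ = _ := by ring

end HooleyShort

/-- Explicit bound for the Erdős–Hooley Δ-function in short intervals, restricted
to integers with at most `j` distinct prime factors. -/
theorem statement_2 (ℓ : ℝ) (hℓ : 1 ≤ ℓ) (j : ℕ) (hj : 0 < j) (x y : ℝ)
    (hx : max (Real.exp (7 ^ 28 * (12 * Real.exp 1 * ℓ) ^
            (28 * Real.log (192 * Real.exp 1 * ℓ))))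
          (Real.exp (Real.exp (Real.pi * j / 4))) < x)
    (hy1 : x ^ (1 / ℓ) ≤ y) (hy2 : y ≤ x) :
    ∑ n ∈ (Finset.Icc 1 ⌊x⌋₊).filter
        (fun n : ℕ => x - y < (n : ℝ) ∧ n.primeFactors.card ≤ j),
        (hooleyDelta n : ℝ) ≤
      phiConst ℓ * (y / Real.log x) *
        (4 * Real.exp 1 * Real.log (Real.log x) / (Real.pi * j)) ^ j := by
  obtain ⟨hx1, hx2⟩ := max_lt_iff.1 hx
  have hx0 : 0 < x := (Real.exp_pos _).trans hx2
  have hy0 : 0 < y := (Real.rpow_pos_of_pos hx0 _).trans_le hy1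
  have hlogx : (1000 * ℓ) ^ 8 ≤ Real.log x :=
    (HooleyShort.threshold_le hℓ).trans ((Real.lt_log_iff_exp_lt hx0).2 hx1).le
  have hlogx0 : 0 < Real.log x := lt_of_lt_of_le (by positivity) hlogx
  have hL : Real.pi * j / 4 < Real.log (Real.log x) :=
    (Real.lt_log_iff_exp_lt hlogx0).2 ((Real.lt_log_iff_exp_lt hx0).2 hx2)
  have hj0 : (0 : ℝ) < j := by exact_mod_cast hj
  have hπj : 0 < Real.pi * j / 4 := by positivity
  have hL0 : 0 < Real.log (Real.log x) := hπj.trans hL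
  set t : ℝ := Real.pi * j / 4 / Real.log (Real.log x) with ht
  have ht0 : 0 < t := div_pos hπj hL0
  have ht1 : t ≤ 1 := (div_le_one hL0).2 hL.le
  have hbase : (4 * Real.exp 1 * Real.log (Real.log x) / (Real.pi * j)) ^ j =
      (t ^ j)⁻¹ * Real.exp j := by
    have h1 : 4 * Real.exp 1 * Real.log (Real.log x) / (Real.pi * j) = t⁻¹ * Real.exp 1 := by
      rw [ht]
      field_simp
    rw [h1, mul_pow, inv_pow, ← Real.exp_nat_mul, mul_one]
  rw [hbase]
  refine HooleyShort.sum_hooleyDelta_short_le (V := y ^ (1 / 100 : ℝ))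
    (s := Real.log x ^ (1 / 8 : ℝ)) hℓ hy2 (by positivity) ?_ ?_ ?_ ?_ ht0 ht1 ?_ ?_
  · rw [← Real.rpow_natCast, ← Real.rpow_mul hy0.le]
    norm_num
  · rw [Real.log_rpow hy0]
    have h1 := Real.log_le_log (by positivity) hy1
    rw [Real.log_rpow hx0, one_div, inv_mul_eq_div, div_le_iff₀ (by linarith)] at h1
    linarith
  · refine le_of_pow_le_pow_left₀ (n := 8) (by norm_num) (by positivity) ?_
    rw [← Real.rpow_natCast (Real.log x ^ (1 / 8 : ℝ)), ← Real.rpow_mul hlogx0.le]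
    norm_num at hlogx ⊢
    exact hlogx
  · rw [← Real.rpow_natCast, ← Real.rpow_mul hlogx0.le]
    norm_num
  · rw [ht]
    field_simp
  · intro n hn
    obtain ⟨h1, h2, h3⟩ := Finset.mem_filter.1 hn
    obtain ⟨h4, h5⟩ := Finset.mem_Icc.1 h1
    exact ⟨Nat.one_le_iff_ne_zero.1 h4, h2, (Nat.le_floor_iff hx0.le).1 h5, h3⟩
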